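/- Fix a > 1 and γ > 3. There exists ε₀ > 0, depending only on a and γ, with the following property: whenever μ± ∈ C¹(ℝ²) are nonnegative and satisfy |μ±| + |∂_e μ±| + |∂_p μ±| ≤ C_μ/(1+|e|^γ) with C_μ < ε₀, there exist toroidally symmetric functions φ⁰, A_φ⁰, twice continuously differentiable on Ω̄ with α-Hölder second derivatives for every α ∈ (0,1), vanishing on ∂Ω, which solve classically on Ω the equilibrium equations −Δφ⁰ = ∫_{ℝ³} ( μ⁺(e⁺,p⁺) − μ⁻(e⁻,p⁻) ) dv and −ΔA_φ⁰ + A_φ⁰/ρ² = ∫_{ℝ³} v̂_φ ( μ⁺(e⁺,p⁺) − μ⁻(e⁻,p⁻) ) dv, where e±(x,v) = ⟨v⟩ ± φ⁰(x) and p±(x,v) = ρ(x)(v_φ ± A_φ⁰(x)). -/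

import Mathlib

open MeasureTheory Real Set Filter
open scoped ENNReal NNReal

noncomputable section

abbrev R3 : Type := Fin 3 → ℝ

/-- The open solid torus with major radius `a` and minor radius `1`. -/
def torus (a : ℝ) : Set R3 :=
  {x | (a - Real.sqrt ((x 0) ^ 2 + (x 1) ^ 2)) ^ 2 + (x 2) ^ 2 < 1}

/-- Distance to the `x₃`-axis, `ρ(x) = √(x₁² + x₂²)`. -/
def rad (x : R3) : ℝ := Real.sqrt ((x 0) ^ 2 + (x 1) ^ 2)

/-- The toroidal unit vector `e_φ(x) = (-x₂, x₁, 0)/ρ(x)`. -/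
def ephi (x : R3) : R3 := ![-(x 1) / rad x, x 0 / rad x, 0]

/-- Euclidean dot product on `ℝ³`. -/
def dot (u v : R3) : ℝ := ∑ i, u i * v i

/-- Cross product on `ℝ³`. -/
def cross (u v : R3) : R3 :=
  ![u 1 * v 2 - u 2 * v 1, u 2 * v 0 - u 0 * v 2, u 0 * v 1 - u 1 * v 0]

/-- Squared Euclidean norm. -/
def nsq (v : R3) : ℝ := ∑ i, (v i) ^ 2

/-- The relativistic energy `⟨v⟩ = √(1 + |v|²)`. -/
def vb (v : R3) : ℝ := Real.sqrt (1 + nsq v)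

/-- The relativistic velocity `v̂ = v/⟨v⟩`. -/
def vhat (v : R3) : R3 := fun i => v i / vb v

/-- `i`-th partial derivative. -/
def pd (f : R3 → ℝ) (i : Fin 3) (x : R3) : ℝ := fderiv ℝ f x (Pi.single i 1)

/-- Gradient. -/
def grad (f : R3 → ℝ) (x : R3) : R3 := fun i => pd f i x

/-- Curl of a vector field on `ℝ³`. -/
def curl (F : R3 → R3) (x : R3) : R3 :=
  ![pd (fun y => F y 2) 1 x - pd (fun y => F y 1) 2 x,
    pd (fun y => F y 0) 2 x - pd (fun y => F y 2) 0 x,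
    pd (fun y => F y 1) 0 x - pd (fun y => F y 0) 1 x]

/-- Laplacian. -/
def lap (f : R3 → ℝ) (x : R3) : ℝ := ∑ i, pd (pd f i) i x

/-- Rotation by angle `β` about the `x₃`-axis. -/
def rotZ (β : ℝ) (x : R3) : R3 :=
  ![Real.cos β * x 0 - Real.sin β * x 1, Real.sin β * x 0 + Real.cos β * x 1, x 2]

/-- Toroidal symmetry of a scalar function of `x`. -/
def torSym (f : R3 → ℝ) : Prop := ∀ β x, f (rotZ β x) = f x

/-- Toroidal symmetry (equivariance) of a vector field. -/
def torSymV (F : R3 → R3) : Prop := ∀ β x, F (rotZ β x) = rotZ β (F x)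

/-- Toroidal symmetry of a function of `(x, v)`. -/
def torSym2 (g : R3 → R3 → ℝ) : Prop := ∀ β x v, g (rotZ β x) (rotZ β v) = g x v

/-- Outward unit normal at a point of `∂Ω`. -/
def nvec (a : ℝ) (x : R3) : R3 :=
  ![(rad x - a) * x 0 / rad x, (rad x - a) * x 1 / rad x, x 2]

/-- Specular reflection of the velocity `v` at the boundary point `x`. -/
def specRefl (a : ℝ) (x v : R3) : R3 := fun i => v i - 2 * dot v (nvec a x) * nvec a x i

/-- `g(x, v)` is specular on `∂Ω`. -/
def specular (a : ℝ) (g : R3 → R3 → ℝ) : Prop :=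
  ∀ x ∈ frontier (torus a), ∀ v : R3, g x v = g x (specRefl a x v)

/-- The transport (Vlasov) operator `D g = v̂·∇ₓ g + σ (E⁰ + v̂×B⁰)·∇_v g`,
with sign `σ = ±1` according to the species. -/
def DopS (σ : ℝ) (E0 B0 : R3 → R3) (g : R3 → R3 → ℝ) (x v : R3) : ℝ :=
  dot (vhat v) (grad (fun y => g y v) x)
    + σ * dot (fun i => E0 x i + cross (vhat v) (B0 x) i) (grad (fun w => g x w) v)

/-- Sign of a species: `+1` for ions (`true`), `-1` for electrons (`false`). -/
def sg (b : Bool) : ℝ := if b then 1 else -1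

/-- Partial derivative `∂_e` of a function `μ(e, p)`. -/
def d1 (F : ℝ × ℝ → ℝ) (q : ℝ × ℝ) : ℝ := fderiv ℝ F q (1, 0)

/-- Partial derivative `∂_p` of a function `μ(e, p)`. -/
def d2 (F : ℝ × ℝ → ℝ) (q : ℝ × ℝ) : ℝ := fderiv ℝ F q (0, 1)

/-- The equilibrium electric field `E⁰ = -∇φ⁰`. -/
def Efield (φ0 : R3 → ℝ) (x : R3) : R3 := fun i => -(grad φ0 x i)

/-- The equilibrium magnetic field `B⁰ = ∇×(A_φ⁰ e_φ)`. -/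
def Bfield (A : R3 → ℝ) (x : R3) : R3 := curl (fun y => fun i => A y * ephi y i) x

/-- The particle energy `e±(x,v) = ⟨v⟩ ± φ⁰(x)`. -/
def epm (σ : ℝ) (φ0 : R3 → ℝ) (x v : R3) : ℝ := vb v + σ * φ0 x

/-- The particle angular momentum `p±(x,v) = ρ(x)(v_φ ± A_φ⁰(x))`. -/
def ppm (σ : ℝ) (A : R3 → ℝ) (x v : R3) : ℝ := rad x * (dot v (ephi x) + σ * A x)


section Aux
open scoped ComplexConjugate

/-! ### The Green operator of the unit disk -/

abbrev UD : Set ℂ := Metric.ball 0 1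
abbrev CD : Set ℂ := Metric.closedBall 0 1

lemma rpow_int_bound (p : ℝ) (hp : p < 2) : ∃ C : ℝ, 0 ≤ C ∧ ∀ z ∈ CD,
    IntegrableOn (fun w : ℂ => ‖z - w‖ ^ (-p)) UD ∧
    ∫ w in UD, ‖z - w‖ ^ (-p) ≤ C := by
  have hinteg : IntegrableOn (fun w : ℂ => ‖w‖ ^ (-p)) (Metric.ball 0 2) := by
    refine integrableOn_ball_of_norm_le_rpow (C := 1) (α := p) (by simp) (by simpa using hp)
      (Filter.Eventually.of_forall fun w => ?_) (Measurable.aestronglyMeasurable (by fun_prop))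
    simp [abs_of_nonneg (Real.rpow_nonneg (norm_nonneg w) _)]
  refine ⟨∫ w in Metric.ball (0:ℂ) 2, ‖w‖ ^ (-p),
    integral_nonneg fun w => Real.rpow_nonneg (norm_nonneg _) _, fun z hz => ?_⟩
  have hz' : ‖z‖ ≤ 1 := by simpa using hz
  have hmp : MeasurePreserving (fun w : ℂ => z - w) volume volume :=
    Measure.measurePreserving_sub_left volume z
  have hemb : MeasurableEmbedding (fun w : ℂ => z - w) :=
    (MeasurableEquiv.subLeft z).measurableEmbedding
  have h1 : IntegrableOn (fun w : ℂ => ‖z - w‖ ^ (-p)) ((fun w => z - w) ⁻¹' Metric.ball 0 2) :=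
    (hmp.integrableOn_comp_preimage hemb (f := fun w : ℂ => ‖w‖ ^ (-p))).2 hinteg
  have hsub : UD ⊆ ((fun w => z - w) ⁻¹' Metric.ball (0:ℂ) 2) := by
    intro w hw
    have : ‖w‖ < 1 := by simpa using hw
    have h3 := norm_sub_le z w
    simp only [mem_preimage, Metric.mem_ball, dist_zero_right]
    linarith
  refine ⟨h1.mono_set hsub, ?_⟩
  rw [← hmp.setIntegral_preimage_emb hemb (fun w : ℂ => ‖w‖ ^ (-p))]
  exact setIntegral_mono_set h1
    (Filter.Eventually.of_forall fun w => Real.rpow_nonneg (norm_nonneg _) _)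
    hsub.eventuallyLE

lemma b_ge {z w : ℂ} (hz : ‖z‖ ≤ 1) (hw : ‖w‖ ≤ 1) : ‖z - w‖ ≤ ‖1 - z * conj w‖ := by
  have h1 : ‖1 - z * conj w‖ ^ 2 - ‖z - w‖ ^ 2 = (1 - ‖z‖ ^ 2) * (1 - ‖w‖ ^ 2) := by
    rw [← Complex.normSq_eq_norm_sq, ← Complex.normSq_eq_norm_sq, ← Complex.normSq_eq_norm_sq,
      ← Complex.normSq_eq_norm_sq]
    simp [Complex.normSq_apply]
    ring
  have h2 : 0 ≤ (1 - ‖z‖ ^ 2) * (1 - ‖w‖ ^ 2) := by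
    apply mul_nonneg <;> nlinarith [norm_nonneg z, norm_nonneg w]
  exact le_of_sq_le_sq (by linarith) (norm_nonneg _)
where le_of_sq_le_sq {x y : ℝ} (h : x ^ 2 ≤ y ^ 2) (hy : 0 ≤ y) : x ≤ y := by
        nlinarith [sq_nonneg (x - y)]

lemma b_eq {z w : ℂ} (hz : ‖z‖ = 1) : ‖z - w‖ = ‖1 - z * conj w‖ := by
  have h1 : ‖1 - z * conj w‖ ^ 2 - ‖z - w‖ ^ 2 = (1 - ‖z‖ ^ 2) * (1 - ‖w‖ ^ 2) := by
    rw [← Complex.normSq_eq_norm_sq, ← Complex.normSq_eq_norm_sq, ← Complex.normSq_eq_norm_sq,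
      ← Complex.normSq_eq_norm_sq]
    simp [Complex.normSq_apply]
    ring
  rw [hz] at h1
  have h2 : ‖z - w‖ ^ 2 = ‖1 - z * conj w‖ ^ 2 := by linarith
  exact (pow_left_inj₀ (norm_nonneg _) (norm_nonneg _) two_ne_zero).1 h2

lemma interp_aux {s m n β : ℝ} (hn : 0 < n) (hnm : n ≤ m) (hs : 0 ≤ s) (hsm : s ≤ m + n)
    (h0 : 0 < β) (h1 : β < 1) : s ^ 2 / (m * n) ≤ 2 * s ^ (1 + β) * n ^ (-1 - β) := by
  have hm : 0 < m := lt_of_lt_of_le hn hnm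
  have e1 : s ^ (2:ℕ) = s ^ (1 + β) * s ^ (1 - β) := by
    rw [← Real.rpow_natCast, ← Real.rpow_add_of_nonneg hs (by linarith) (by linarith)]
    congr 1; norm_num
  have e2 : s ^ (1 - β) ≤ 2 * m ^ (1 - β) := by
    calc s ^ (1 - β) ≤ (2 * m) ^ (1 - β) :=
          Real.rpow_le_rpow hs (by linarith) (by linarith)
      _ = 2 ^ (1 - β) * m ^ (1 - β) := Real.mul_rpow (by norm_num) hm.le
      _ ≤ 2 * m ^ (1 - β) := by
          gcongr
          calc (2:ℝ) ^ (1 - β) ≤ 2 ^ (1:ℝ) :=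
                Real.rpow_le_rpow_of_exponent_le (by norm_num) (by linarith)
            _ = 2 := by simp
  have e3 : m ^ (1 - β) = m * m ^ (-β) := by
    rw [sub_eq_add_neg, Real.rpow_add hm, Real.rpow_one]
  have e4 : m ^ (-β) ≤ n ^ (-β) := Real.rpow_le_rpow_of_nonpos hn hnm (by linarith)
  have e5 : n ^ (-1 - β) = n⁻¹ * n ^ (-β) := by
    rw [sub_eq_add_neg, Real.rpow_add hn, Real.rpow_neg_one]
  rw [div_le_iff₀ (by positivity), e1, e5]
  calc s ^ (1 + β) * s ^ (1 - β) ≤ s ^ (1 + β) * (2 * (m * n ^ (-β))) := by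
        gcongr
        refine e2.trans ?_
        rw [e3]; gcongr
    _ = 2 * s ^ (1 + β) * (n⁻¹ * n ^ (-β)) * (m * n) := by field_simp

lemma interp {s x y β : ℝ} (hx : 0 < x) (hy : 0 < y) (hs : 0 ≤ s) (hsm : s ≤ x + y)
    (h0 : 0 < β) (h1 : β < 1) :
    s ^ 2 / (x * y) ≤ 2 * s ^ (1 + β) * (x ^ (-1 - β) + y ^ (-1 - β)) := by
  have p1 := Real.rpow_nonneg hx.le (-1 - β)
  have p2 := Real.rpow_nonneg hy.le (-1 - β)
  have p3 := Real.rpow_nonneg hs (1 + β)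
  rcases le_total x y with h | h
  · have := interp_aux hx h hs (by linarith) h0 h1
    rw [mul_comm x y]
    nlinarith [mul_nonneg p3 p2]
  · have := interp_aux hy h hs (by linarith) h0 h1
    nlinarith [mul_nonneg p3 p1]

def KK (z w : ℂ) : ℂ := 1 / (z - w) + conj w / (1 - z * conj w)
def K1 (z w : ℂ) : ℂ := -1 / (z - w) ^ 2 + conj w ^ 2 / (1 - z * conj w) ^ 2
def GK (z w : ℂ) : ℝ := Real.log (‖1 - z * conj w‖ / ‖z - w‖)

@[fun_prop] lemma meas_conj : Measurable (fun w : ℂ => conj w) := Complex.continuous_conj.measurable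

lemma KK_meas (z : ℂ) : Measurable (KK z) := by unfold KK; fun_prop
lemma K1_meas (z : ℂ) : Measurable (K1 z) := by unfold K1; fun_prop
lemma GK_meas (z : ℂ) : Measurable (GK z) := by unfold GK; fun_prop

section pointwise
variable {z z0 w : ℂ}

lemma b_pos (hz : ‖z‖ ≤ 1) (hw : ‖w‖ < 1) : 1 - z * conj w ≠ 0 := by
  intro h
  have h2 : z * conj w = 1 := by linear_combination -h
  have h3 : ‖z‖ * ‖w‖ = 1 := by
    have := congrArg norm h2
    simpa using this
  nlinarith [norm_nonneg z, norm_nonneg w]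

lemma KK_bound (hz : ‖z‖ ≤ 1) (hw : ‖w‖ < 1) (h : z ≠ w) : ‖KK z w‖ ≤ 2 / ‖z - w‖ := by
  have hp : 0 < ‖z - w‖ := norm_pos_iff.2 (sub_ne_zero.2 h)
  have hb := b_ge hz hw.le
  unfold KK
  refine (norm_add_le _ _).trans ?_
  rw [norm_div, norm_div, RCLike.norm_conj, norm_one]
  have : ‖w‖ / ‖1 - z * conj w‖ ≤ 1 / ‖z - w‖ := by gcongr
  calc _ ≤ 1 / ‖z - w‖ + 1 / ‖z - w‖ := by gcongr
    _ = _ := by ring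

lemma K1_bound (hz : ‖z‖ ≤ 1) (hw : ‖w‖ < 1) (h : z ≠ w) : ‖K1 z w‖ ≤ 2 / ‖z - w‖ ^ 2 := by
  have hp : 0 < ‖z - w‖ := norm_pos_iff.2 (sub_ne_zero.2 h)
  have hb := b_ge hz hw.le
  unfold K1
  refine (norm_add_le _ _).trans ?_
  rw [norm_div, norm_div, norm_pow, norm_pow, norm_pow, RCLike.norm_conj, norm_neg, norm_one]
  have : ‖w‖ ^ 2 / ‖1 - z * conj w‖ ^ 2 ≤ 1 / ‖z - w‖ ^ 2 := by
    gcongr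
    nlinarith [norm_nonneg w]
  calc _ ≤ 1 / ‖z - w‖ ^ 2 + 1 / ‖z - w‖ ^ 2 := by gcongr
    _ = _ := by ring

lemma KK_exp (hz : ‖z‖ ≤ 1) (hz0 : ‖z0‖ ≤ 1) (hw : ‖w‖ < 1) (h : z ≠ w) (h0 : z0 ≠ w) :
    ‖KK z w - KK z0 w - (z - z0) * K1 z0 w‖ ≤
      2 * (‖z - z0‖ ^ 2 / (‖z - w‖ * ‖z0 - w‖ ^ 2)) := by
  have n1 := sub_ne_zero.2 h
  have n2 := sub_ne_zero.2 h0
  have n3 := b_pos hz hw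
  have n4 := b_pos hz0 hw
  have p1 : 0 < ‖z - w‖ := norm_pos_iff.2 n1
  have p2 : 0 < ‖z0 - w‖ := norm_pos_iff.2 n2
  have hb := b_ge hz hw.le
  have hb0 := b_ge hz0 hw.le
  have key : KK z w - KK z0 w - (z - z0) * K1 z0 w =
      (z - z0) ^ 2 / ((z - w) * (z0 - w) ^ 2)
      + conj w ^ 3 * (z - z0) ^ 2 / ((1 - z * conj w) * (1 - z0 * conj w) ^ 2) := by
    have a1 : 1 / (z - w) - 1 / (z0 - w) - (z - z0) * (-1 / (z0 - w) ^ 2)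
        = (z - z0) ^ 2 / ((z - w) * (z0 - w) ^ 2) := by
      field_simp; ring
    have a2 : conj w / (1 - z * conj w) - conj w / (1 - z0 * conj w)
        - (z - z0) * (conj w ^ 2 / (1 - z0 * conj w) ^ 2)
        = conj w ^ 3 * (z - z0) ^ 2 / ((1 - z * conj w) * (1 - z0 * conj w) ^ 2) := by
      rw [div_sub_div _ _ n3 n4, ← mul_div_assoc,
        div_sub_div _ _ (mul_ne_zero n3 n4) (pow_ne_zero 2 n4),
        div_eq_div_iff (by positivity) (by positivity)]
      ring
    rw [← a1, ← a2]; unfold KK K1; ring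
  rw [key]
  refine (norm_add_le _ _).trans ?_
  simp only [norm_div, norm_mul, norm_pow, RCLike.norm_conj]
  have hw3 : ‖w‖ ^ 3 ≤ 1 := pow_le_one₀ (norm_nonneg _) hw.le
  have : ‖w‖ ^ 3 * ‖z - z0‖ ^ 2 / (‖1 - z * conj w‖ * ‖1 - z0 * conj w‖ ^ 2)
      ≤ 1 * ‖z - z0‖ ^ 2 / (‖z - w‖ * ‖z0 - w‖ ^ 2) := by gcongr
  calc _ ≤ ‖z - z0‖ ^ 2 / (‖z - w‖ * ‖z0 - w‖ ^ 2)
        + 1 * ‖z - z0‖ ^ 2 / (‖z - w‖ * ‖z0 - w‖ ^ 2) := by gcongr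
    _ = _ := by ring

lemma GK_bound (hz : ‖z‖ ≤ 1) (hw : ‖w‖ < 1) (h : z ≠ w) : |GK z w| ≤ 2 / ‖z - w‖ := by
  have p1 : 0 < ‖z - w‖ := norm_pos_iff.2 (sub_ne_zero.2 h)
  have hb := b_ge hz hw.le
  have h1 : 1 ≤ ‖1 - z * conj w‖ / ‖z - w‖ := (one_le_div p1).2 hb
  unfold GK
  rw [abs_of_nonneg (Real.log_nonneg h1)]
  have h2 : ‖1 - z * conj w‖ ≤ 2 := by
    refine (norm_sub_le _ _).trans ?_
    rw [norm_mul, RCLike.norm_conj, norm_one]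
    nlinarith [norm_nonneg z, norm_nonneg w]
  calc _ ≤ ‖1 - z * conj w‖ / ‖z - w‖ - 1 := Real.log_le_sub_one_of_pos (by linarith)
    _ ≤ ‖1 - z * conj w‖ / ‖z - w‖ := by linarith
    _ ≤ _ := by gcongr

/-- one sided estimate: `log‖1+ζ‖ ≤ Re ζ + ‖ζ‖²/2`. -/
lemma log_le_aux (ζ : ℂ) (h : 1 + ζ ≠ 0) : Real.log ‖1 + ζ‖ ≤ ζ.re + ‖ζ‖ ^ 2 / 2 := by
  have p : 0 < ‖1 + ζ‖ := norm_pos_iff.2 h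
  have e : ‖1 + ζ‖ ^ 2 = 1 + 2 * ζ.re + ‖ζ‖ ^ 2 := by
    rw [← Complex.normSq_eq_norm_sq, ← Complex.normSq_eq_norm_sq]
    simp [Complex.normSq_apply]; ring
  have := Real.log_le_sub_one_of_pos (x := ‖1 + ζ‖ ^ 2) (by positivity)
  rw [Real.log_pow] at this
  push_cast at this
  linarith

lemma log_le_aux' (ζ : ℂ) (h : 1 + ζ ≠ 0) : Real.log ‖1 + ζ‖ ≤ ‖ζ‖ := by
  have p : 0 < ‖1 + ζ‖ := norm_pos_iff.2 h
  have := Real.log_le_sub_one_of_pos p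
  have h2 := norm_add_le 1 ζ
  simp at h2
  linarith

lemma log_exp_aux (X Y : ℂ) (hXY : (1 + X) * (1 - Y) = 1) :
    |Real.log ‖1 + X‖ - X.re| ≤ 2 * (‖X‖ + ‖Y‖) ^ (3/2 : ℝ) := by
  have n1 : 1 + X ≠ 0 := left_ne_zero_of_mul_eq_one hXY
  have n2 : 1 - Y ≠ 0 := right_ne_zero_of_mul_eq_one hXY
  have n2' : 1 + -Y ≠ 0 := by rwa [← sub_eq_add_neg]
  have e : Real.log ‖1 + X‖ = - Real.log ‖1 + -Y‖ := by
    have := congrArg norm hXY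
    rw [norm_mul, norm_one] at this
    have h3 := congrArg Real.log this
    rw [Real.log_mul (norm_ne_zero_iff.2 n1) (norm_ne_zero_iff.2 n2), Real.log_one] at h3
    rw [← sub_eq_add_neg]; linarith
  have a1 := log_le_aux X n1
  have a2 := log_le_aux' X n1
  have a3 := log_le_aux (-Y) n2'
  have a4 := log_le_aux' (-Y) n2'
  rw [norm_neg] at a3 a4
  rw [Complex.neg_re] at a3
  have e2 : X.re - Y.re = (X * Y).re := by
    have : X - Y = X * Y := by linear_combination hXY
    rw [← this, Complex.sub_re]
  have r1 := Complex.abs_re_le_norm X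
  have r2 := Complex.abs_re_le_norm (X * Y)
  rw [norm_mul] at r2
  rw [abs_le] at r1 r2
  set s := ‖X‖ + ‖Y‖ with hs
  have nX := norm_nonneg X
  have nY := norm_nonneg Y
  have s0 : 0 ≤ s := by positivity
  have b1 : |Real.log ‖1 + X‖ - X.re| ≤ 2 * s := by
    rw [abs_le]; constructor <;> linarith
  have b2 : |Real.log ‖1 + X‖ - X.re| ≤ 2 * s ^ 2 := by
    rw [abs_le]; constructor <;> nlinarith [mul_nonneg nX nY]
  rcases le_total s 1 with h | h
  · refine b2.trans ?_
    have : s ^ (2:ℕ) ≤ s ^ (3/2 : ℝ) := by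
      rcases s0.eq_or_lt with h0 | h0
      · rw [← h0]; norm_num
      rw [← Real.rpow_natCast]
      exact Real.rpow_le_rpow_of_exponent_ge h0 h (by norm_num)
    linarith
  · refine b1.trans ?_
    have : s ^ (1:ℝ) ≤ s ^ (3/2 : ℝ) := Real.rpow_le_rpow_of_exponent_le h (by norm_num)
    rw [Real.rpow_one] at this
    linarith

lemma add_rpow_aux {x y : ℝ} (hx : 0 ≤ x) (hy : 0 ≤ y) :
    (x + y) ^ (3/2 : ℝ) ≤ 4 * (x ^ (3/2 : ℝ) + y ^ (3/2 : ℝ)) := by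
  have h4 : (2:ℝ) ^ (3/2 : ℝ) ≤ 4 := by
    calc (2:ℝ) ^ (3/2 : ℝ) ≤ 2 ^ (2:ℝ) :=
          Real.rpow_le_rpow_of_exponent_le (by norm_num) (by norm_num)
      _ = 4 := by norm_num
  have px := Real.rpow_nonneg hx (3/2)
  have py := Real.rpow_nonneg hy (3/2)
  rcases le_total x y with h | h
  · calc (x + y) ^ (3/2 : ℝ) ≤ (2 * y) ^ (3/2 : ℝ) :=
          Real.rpow_le_rpow (by linarith) (by linarith) (by norm_num)
      _ = 2 ^ (3/2 : ℝ) * y ^ (3/2 : ℝ) := Real.mul_rpow (by norm_num) hy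
      _ ≤ _ := by nlinarith
  · calc (x + y) ^ (3/2 : ℝ) ≤ (2 * x) ^ (3/2 : ℝ) :=
          Real.rpow_le_rpow (by linarith) (by linarith) (by norm_num)
      _ = 2 ^ (3/2 : ℝ) * x ^ (3/2 : ℝ) := Real.mul_rpow (by norm_num) hx
      _ ≤ _ := by nlinarith

lemma log_exp (X Y : ℂ) (hXY : (1 + X) * (1 - Y) = 1) {s x y : ℝ} (hs : 0 ≤ s) (hx : 0 < x)
    (hy : 0 < y) (hX : ‖X‖ ≤ s / y) (hY : ‖Y‖ ≤ s / x) :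
    |Real.log ‖1 + X‖ - X.re| ≤ 8 * s ^ (3/2 : ℝ) * (x ^ (-(3/2) : ℝ) + y ^ (-(3/2) : ℝ)) := by
  refine (log_exp_aux X Y hXY).trans ?_
  have h1 : (‖X‖ + ‖Y‖) ^ (3/2 : ℝ) ≤ (s / y + s / x) ^ (3/2 : ℝ) :=
    Real.rpow_le_rpow (by positivity) (by linarith) (by norm_num)
  have h2 := add_rpow_aux (x := s / y) (y := s / x) (by positivity) (by positivity)
  rw [Real.div_rpow hs hy.le, Real.div_rpow hs hx.le] at h2
  rw [Real.rpow_neg hx.le, Real.rpow_neg hy.le]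
  calc _ ≤ 2 * (4 * (s ^ (3/2 : ℝ) / y ^ (3/2 : ℝ) + s ^ (3/2 : ℝ) / x ^ (3/2 : ℝ))) := by linarith
    _ = _ := by ring

lemma GK_exp (hz : ‖z‖ ≤ 1) (hz0 : ‖z0‖ ≤ 1) (hw : ‖w‖ < 1) (h : z ≠ w) (h0 : z0 ≠ w) :
    |GK z w - GK z0 w + ((z - z0) * KK z0 w).re| ≤
      16 * ‖z - z0‖ ^ (3/2 : ℝ) * (‖z - w‖ ^ (-(3/2) : ℝ) + ‖z0 - w‖ ^ (-(3/2) : ℝ)) := by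
  have n1 := sub_ne_zero.2 h
  have n2 := sub_ne_zero.2 h0
  have n3 := b_pos hz hw
  have n4 := b_pos hz0 hw
  have p1 : 0 < ‖z - w‖ := norm_pos_iff.2 n1
  have p2 : 0 < ‖z0 - w‖ := norm_pos_iff.2 n2
  have hb := b_ge hz hw.le
  have hb0 := b_ge hz0 hw.le
  have s0 := norm_nonneg (z - z0)
  have q1 := log_exp ((z - z0) / (z0 - w)) ((z - z0) / (z - w)) (by field_simp; ring) s0 p1 p2
    (by rw [norm_div]) (by rw [norm_div])
  have q2 := log_exp (-(z - z0) * conj w / (1 - z0 * conj w))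
    (-(z - z0) * conj w / (1 - z * conj w)) (by field_simp; ring) s0 p1 p2
    (by
      rw [norm_div, norm_mul, norm_neg, RCLike.norm_conj]
      gcongr
      nlinarith [norm_nonneg w])
    (by
      rw [norm_div, norm_mul, norm_neg, RCLike.norm_conj]
      gcongr
      nlinarith [norm_nonneg w])
  have e1 : 1 + (z - z0) / (z0 - w) = (z - w) / (z0 - w) := by field_simp; ring
  have e2 : 1 + -(z - z0) * conj w / (1 - z0 * conj w)
      = (1 - z * conj w) / (1 - z0 * conj w) := by field_simp; ring
  rw [e1, norm_div, Real.log_div p1.ne' p2.ne'] at q1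
  rw [e2, norm_div, Real.log_div (norm_ne_zero_iff.2 n3) (norm_ne_zero_iff.2 n4)] at q2
  have e3 : ((z - z0) * KK z0 w).re = ((z - z0) / (z0 - w)).re
      - (-(z - z0) * conj w / (1 - z0 * conj w)).re := by
    rw [← Complex.sub_re]; congr 1; unfold KK; ring
  unfold GK
  rw [Real.log_div (norm_ne_zero_iff.2 n3) p1.ne', Real.log_div (norm_ne_zero_iff.2 n4) p2.ne', e3]
  rw [abs_le] at q1 q2 ⊢
  constructor <;> linarith [q1.1, q1.2, q2.1, q2.2]

end pointwise

lemma ae_good (z z0 : ℂ) : ∀ᵐ w ∂(volume.restrict UD), ‖w‖ < 1 ∧ z ≠ w ∧ z0 ≠ w := by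
  have h1 : ∀ᵐ w ∂(volume.restrict UD), w ∈ UD := ae_restrict_mem measurableSet_ball
  have h2 : ∀ᵐ w ∂(volume.restrict UD), w ≠ z := by
    exact ae_restrict_of_ae (Measure.ae_ne volume z)
  have h3 : ∀ᵐ w ∂(volume.restrict UD), w ≠ z0 := by
    exact ae_restrict_of_ae (Measure.ae_ne volume z0)
  filter_upwards [h1, h2, h3] with w a b c
  exact ⟨by simpa using a, b.symm, c.symm⟩

def GF (f : ℂ → ℝ) (z : ℂ) : ℝ := (1 / (2 * π)) * ∫ w in UD, GK z w * f w
def DF (f : ℂ → ℝ) (z : ℂ) : ℂ := -(1 / (2 * π)) * ∫ w in UD, KK z w * f w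
def LF (f : ℂ → ℝ) (z : ℂ) : ℂ := -(1 / (2 * π)) * ∫ w in UD, K1 z w * ((f w - f z : ℝ) : ℂ)

lemma GK_int {f : ℂ → ℝ} (hf : Continuous f) {M : ℝ} (hM : ∀ w, |f w| ≤ M) {z : ℂ} (hz : z ∈ CD) :
    IntegrableOn (fun w => GK z w * f w) UD := by
  obtain ⟨C, hC, h⟩ := rpow_int_bound 1 (by norm_num)
  refine Integrable.mono' (((h z hz).1.const_mul (2 * M)))
    ((GK_meas z).mul hf.measurable).aestronglyMeasurable ?_
  filter_upwards [ae_good z z] with w hw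
  have := GK_bound (by simpa using hz) hw.1 hw.2.1
  rw [Real.norm_eq_abs, abs_mul, Real.rpow_neg_one]
  calc |GK z w| * |f w| ≤ (2 / ‖z - w‖) * M := by gcongr; exact hM w
    _ = _ := by ring

lemma KK_int {f : ℂ → ℝ} (hf : Continuous f) {M : ℝ} (hM : ∀ w, |f w| ≤ M) {z : ℂ} (hz : z ∈ CD) :
    IntegrableOn (fun w => KK z w * f w) UD := by
  obtain ⟨C, hC, h⟩ := rpow_int_bound 1 (by norm_num)
  refine Integrable.mono' (((h z hz).1.const_mul (2 * M)))
    ((KK_meas z).mul (Complex.measurable_ofReal.comp hf.measurable)).aestronglyMeasurable ?_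
  filter_upwards [ae_good z z] with w hw
  have := KK_bound (by simpa using hz) hw.1 hw.2.1
  rw [norm_mul, Complex.norm_real, Real.norm_eq_abs, Real.rpow_neg_one]
  calc ‖KK z w‖ * |f w| ≤ (2 / ‖z - w‖) * M := by gcongr; exact hM w
    _ = _ := by ring

lemma K1_int {f : ℂ → ℝ} (hf : Continuous f) {L : ℝ}  {z : ℂ} (hz : z ∈ CD)
    (hL : ∀ w ∈ CD, |f w - f z| ≤ L * ‖z - w‖) :
    IntegrableOn (fun w => K1 z w * ((f w - f z : ℝ) : ℂ)) UD := by
  obtain ⟨C, hC, h⟩ := rpow_int_bound 1 (by norm_num)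
  refine Integrable.mono' (((h z hz).1.const_mul (2 * L)))
    ((K1_meas z).mul (Complex.measurable_ofReal.comp
      (hf.measurable.sub_const _))).aestronglyMeasurable ?_
  filter_upwards [ae_good z z] with w hw
  have := K1_bound (by simpa using hz) hw.1 hw.2.1
  have p : 0 < ‖z - w‖ := norm_pos_iff.2 (sub_ne_zero.2 hw.2.1)
  rw [norm_mul, Complex.norm_real, Real.norm_eq_abs, Real.rpow_neg_one]
  calc ‖K1 z w‖ * |f w - f z| ≤ (2 / ‖z - w‖ ^ 2) * (L * ‖z - w‖) := by
        gcongr; exact hL w (by simpa using hw.1.le)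
    _ = _ := by field_simp

lemma GF_bound : ∃ C : ℝ, 0 ≤ C ∧ ∀ (f : ℂ → ℝ) (M : ℝ), Continuous f → (∀ w, |f w| ≤ M) →
    ∀ z ∈ CD, |GF f z| ≤ C * M := by
  obtain ⟨C, hC, h⟩ := rpow_int_bound 1 (by norm_num)
  refine ⟨1 / (2 * π) * (2 * C), by positivity, fun f M hf hM z hz => ?_⟩
  have hM0 : 0 ≤ M := (abs_nonneg _).trans (hM 0)
  unfold GF
  rw [abs_mul, abs_of_pos (by positivity : 0 < 1 / (2 * π)), mul_assoc]
  gcongr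
  rw [← Real.norm_eq_abs]
  refine (norm_integral_le_of_norm_le ((h z hz).1.const_mul (2 * M)) ?_).trans ?_
  · filter_upwards [ae_good z z] with w hw
    have := GK_bound (by simpa using hz) hw.1 hw.2.1
    rw [Real.norm_eq_abs, abs_mul, Real.rpow_neg_one]
    calc |GK z w| * |f w| ≤ (2 / ‖z - w‖) * M := by gcongr; exact hM w
      _ = _ := by ring
  · rw [integral_const_mul]
    nlinarith [(h z hz).2]

lemma norm_c : ‖(-(1 / (2 * π)) : ℂ)‖ = 1 / (2 * π) := by
  rw [norm_neg, norm_div, norm_mul, norm_one, Complex.norm_real]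
  simp [abs_of_pos Real.pi_pos]

lemma DF_bound : ∃ C : ℝ, 0 ≤ C ∧ ∀ (f : ℂ → ℝ) (M : ℝ), Continuous f → (∀ w, |f w| ≤ M) →
    ∀ z ∈ CD, ‖DF f z‖ ≤ C * M := by
  obtain ⟨C, hC, h⟩ := rpow_int_bound 1 (by norm_num)
  refine ⟨1 / (2 * π) * (2 * C), by positivity, fun f M hf hM z hz => ?_⟩
  have hM0 : 0 ≤ M := (abs_nonneg _).trans (hM 0)
  unfold DF
  rw [norm_mul, norm_c, mul_assoc]
  gcongr
  refine (norm_integral_le_of_norm_le ((h z hz).1.const_mul (2 * M)) ?_).trans ?_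
  · filter_upwards [ae_good z z] with w hw
    have := KK_bound (by simpa using hz) hw.1 hw.2.1
    rw [norm_mul, Complex.norm_real, Real.norm_eq_abs, Real.rpow_neg_one]
    calc ‖KK z w‖ * |f w| ≤ (2 / ‖z - w‖) * M := by gcongr; exact hM w
      _ = _ := by ring
  · rw [integral_const_mul]
    nlinarith [(h z hz).2]

lemma GF_exp : ∃ C : ℝ, 0 ≤ C ∧ ∀ (f : ℂ → ℝ) (M : ℝ), Continuous f → (∀ w, |f w| ≤ M) →
    ∀ z ∈ CD, ∀ z0 ∈ CD, |GF f z - GF f z0 - ((z - z0) * DF f z0).re|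
      ≤ C * M * ‖z - z0‖ ^ (3/2 : ℝ) := by
  obtain ⟨C, hC, h⟩ := rpow_int_bound (3/2) (by norm_num)
  refine ⟨1 / (2 * π) * (32 * C), by positivity, fun f M hf hM z hz z0 hz0 => ?_⟩
  have hM0 : 0 ≤ M := (abs_nonneg _).trans (hM 0)
  have i1 := GK_int hf hM hz
  have i2 := GK_int hf hM hz0
  have i3 := KK_int hf hM hz0
  have e : ((z - z0) * DF f z0).re
      = -(1 / (2 * π)) * ∫ w in UD, ((z - z0) * (KK z0 w * f w)).re := by
    have h1 : ∫ w in UD, ((z - z0) * (KK z0 w * f w)).re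
        = (∫ w in UD, (z - z0) * (KK z0 w * f w)).re := integral_re (i3.const_mul (z - z0))
    rw [h1, integral_const_mul, ← Complex.re_ofReal_mul]
    congr 1; unfold DF; push_cast; ring
  have e2 : GF f z - GF f z0 - ((z - z0) * DF f z0).re
      = 1 / (2 * π) * ∫ w in UD, (GK z w * f w - GK z0 w * f w
        + ((z - z0) * (KK z0 w * f w)).re) := by
    have i4 : IntegrableOn (fun w => ((z - z0) * (KK z0 w * f w)).re) UD :=
      (i3.const_mul (z - z0)).re
    have i5 : IntegrableOn (fun w => GK z w * f w - GK z0 w * f w) UD := i1.sub i2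
    rw [e, integral_add i5 i4, integral_sub i1 i2]
    unfold GF; ring
  rw [e2, abs_mul, abs_of_pos (by positivity : 0 < 1 / (2 * π)), mul_assoc, mul_assoc]
  gcongr
  rw [← Real.norm_eq_abs]
  refine (norm_integral_le_of_norm_le
    (((h z hz).1.add (h z0 hz0).1).const_mul (16 * ‖z - z0‖ ^ (3/2 : ℝ) * M)) ?_).trans ?_
  · filter_upwards [ae_good z z0] with w hw
    have := GK_exp (by simpa using hz) (by simpa using hz0) hw.1 hw.2.1 hw.2.2
    have e3 : GK z w * f w - GK z0 w * f w + ((z - z0) * (KK z0 w * f w)).re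
        = (GK z w - GK z0 w + ((z - z0) * KK z0 w).re) * f w := by
      rw [← mul_assoc, Complex.re_mul_ofReal]; ring
    rw [e3, Real.norm_eq_abs, abs_mul]
    calc _ ≤ (16 * ‖z - z0‖ ^ (3/2 : ℝ) * (‖z - w‖ ^ (-(3/2) : ℝ) + ‖z0 - w‖ ^ (-(3/2) : ℝ))) * M := by
          gcongr; exact hM w
      _ = _ := by simp only [Pi.add_apply]; ring
  · rw [integral_const_mul]
    simp only [Pi.add_apply]
    rw [integral_add (h z hz).1 (h z0 hz0).1]
    have hs : 0 ≤ ‖z - z0‖ ^ (3/2 : ℝ) := by positivity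
    calc _ ≤ 16 * ‖z - z0‖ ^ (3/2 : ℝ) * M * (C + C) := by
          gcongr
          · exact (h z hz).2
          · exact (h z0 hz0).2
      _ = _ := by ring

/-- averaging over rotations -/
lemma rot_avg (g : ℂ → ℂ) (hg : Measurable g) (hi : IntegrableOn g UD) :
    ∫ w in UD, g w = ∫ w in UD, circleAverage g 0 ‖w‖ := by
  have hrot : ∀ θ : ℝ, MeasurePreserving (fun w : ℂ => circleMap 0 1 θ * w)
      (volume.restrict UD) (volume.restrict UD) := by
    intro θ
    have hm : MeasurePreserving (fun w : ℂ => circleMap 0 1 θ * w) volume volume := by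
      let a : Circle := Circle.exp θ
      have := (rotation a).measurePreserving
      have e : (fun w : ℂ => circleMap 0 1 θ * w) = rotation a := by
        ext w; simp [a, circleMap, rotation_apply, Circle.coe_exp]
      rwa [e]
    have := hm.restrict_preimage (s := UD) measurableSet_ball
    convert this using 2
    ext w
    simp
  have hemb : ∀ θ : ℝ, MeasurableEmbedding (fun w : ℂ => circleMap 0 1 θ * w) := fun θ =>
    measurableEmbedding_mulLeft₀ (by simp)
  have hi' : ∀ θ : ℝ, IntegrableOn (fun w => g (circleMap 0 1 θ * w)) UD := fun θ =>
    ((hrot θ).integrable_comp_emb (hemb θ)).2 hi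
  have hI : Integrable (Function.uncurry fun (θ : ℝ) (w : ℂ) => g (circleMap 0 1 θ * w))
      ((volume.restrict (Set.uIoc 0 (2 * π))).prod (volume.restrict UD)) := by
    have : IsFiniteMeasure (volume.restrict (Set.uIoc 0 (2 * π))) :=
      ⟨by
        simp only [Set.uIoc_of_le (by positivity : 0 ≤ 2 * π), Measure.restrict_apply_univ,
          Real.volume_Ioc]
        exact ENNReal.ofReal_lt_top⟩
    rw [integrable_prod_iff]
    · refine ⟨Filter.Eventually.of_forall hi', ?_⟩
      have : ∀ θ : ℝ, ∫ w in UD, ‖g (circleMap 0 1 θ * w)‖ = ∫ w in UD, ‖g w‖ := fun θ =>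
        (hrot θ).integral_comp (hemb θ) (fun w => ‖g w‖)
      simp only [Function.uncurry_apply_pair, this]
      exact integrable_const _
    · apply Measurable.aestronglyMeasurable
      apply hg.comp
      have : Continuous (fun p : ℝ × ℂ => circleMap 0 1 p.1 * p.2) := by
        unfold circleMap; fun_prop
      exact this.measurable
  have h1 : ∫ θ in (0:ℝ)..2 * π, (∫ w in UD, g (circleMap 0 1 θ * w))
      = ∫ w in UD, (∫ θ in (0:ℝ)..2 * π, g (circleMap 0 1 θ * w)) :=
    intervalIntegral_integral_swap hI
  have h2 : ∀ θ : ℝ, ∫ w in UD, g (circleMap 0 1 θ * w) = ∫ w in UD, g w := fun θ =>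
    (hrot θ).integral_comp (hemb θ) g
  have h3 : ∀ w : ℂ, circleAverage g 0 ‖w‖
      = (2 * π)⁻¹ • ∫ θ in (0:ℝ)..2 * π, g (circleMap 0 1 θ * w) := by
    intro w
    rw [Real.circleAverage_eq_integral_add w.arg]
    congr 2
    ext θ
    congr 1
    simp only [circleMap, zero_add]
    conv_rhs => rw [← Complex.norm_mul_exp_arg_mul_I w]
    push_cast
    rw [add_mul, Complex.exp_add]
    ring
  simp only [h3]
  rw [integral_smul, ← h1]
  simp only [h2]
  simp only [intervalIntegral.integral_const, sub_zero]
  rw [smul_smul, inv_mul_cancel₀ (by positivity), one_smul]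


lemma avg_one {z : ℂ} {r : ℝ} (hr : 0 ≤ r) (hrz : r < ‖z‖) :
    circleAverage (fun w => 1 / (z - w)) 0 r = 1 / z := by
  have hd : DiffContOnCl ℂ (fun w : ℂ => 1 / (z - w)) (Metric.ball 0 |r|) := by
    refine DifferentiableOn.diffContOnCl_ball (U := Metric.closedBall 0 |r|) ?_ subset_rfl
    intro w hw
    have : z - w ≠ 0 := by
      intro h
      rw [sub_eq_zero] at h
      rw [abs_of_nonneg hr, mem_closedBall_zero_iff, ← h] at hw
      linarith
    fun_prop (disch := assumption)
  rw [hd.circleAverage, sub_zero]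

lemma avg_conj {h g : ℂ → ℂ} {r : ℝ} (hr : 0 ≤ r) (hd : DifferentiableOn ℂ h (Metric.closedBall 0 |r|))
    (h0 : h 0 = 0) (hg : ∀ w ∈ Metric.sphere (0:ℂ) |r|, g w = conj (h w)) :
    circleAverage g 0 r = 0 := by
  have h1 : circleAverage g 0 r = circleAverage (Complex.conjCLE.toContinuousLinearMap ∘ h) 0 r := by
    apply Real.circleAverage_congr_sphere
    intro w hw
    simpa using hg w hw
  have hci : CircleIntegrable h 0 r := by
    apply ContinuousOn.circleIntegrable hr
    refine hd.continuousOn.mono ?_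
    rw [abs_of_nonneg hr]
    exact Metric.sphere_subset_closedBall
  rw [h1, ContinuousLinearMap.circleAverage_comp_comm _ hci,
    (DifferentiableOn.diffContOnCl_ball hd subset_rfl).circleAverage, h0]
  simp

lemma avg_two {z : ℂ} {r : ℝ} (hr : ‖z‖ < r) :
    circleAverage (fun w => 1 / (z - w)) 0 r = 0 := by
  have hr0 : 0 < r := (norm_nonneg z).trans_lt hr
  refine avg_conj hr0.le (h := fun w => -w / ((r:ℂ) ^ 2 - conj z * w)) ?_ (by simp) ?_
  · intro w hw
    rw [abs_of_pos hr0, mem_closedBall_zero_iff] at hw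
    have : (r:ℂ) ^ 2 - conj z * w ≠ 0 := by
      intro h
      have h2 : (r:ℂ) ^ 2 = conj z * w := by linear_combination h
      have h3 := congrArg norm h2
      rw [norm_mul, norm_pow, RCLike.norm_conj, Complex.norm_real, Real.norm_eq_abs,
        abs_of_pos hr0] at h3
      nlinarith [norm_nonneg z, norm_nonneg w]
    fun_prop (disch := assumption)
  · intro w hw
    rw [abs_of_pos hr0, mem_sphere_zero_iff_norm] at hw
    have hw0 : w ≠ 0 := by
      intro h; rw [h, norm_zero] at hw; linarith
    have hwz : z - w ≠ 0 := by
      intro h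
      rw [sub_eq_zero] at h
      rw [h] at hr; linarith
    have e : (r:ℂ) ^ 2 = w * conj w := by
      rw [Complex.mul_conj, Complex.normSq_eq_norm_sq, hw]; push_cast; ring
    have hc : conj w ≠ 0 := by simpa using hw0
    simp only [map_div₀, map_neg, map_sub, map_pow, map_mul, Complex.conj_ofReal, Complex.conj_conj]
    rw [e, show w * conj w - z * conj w = (w - z) * conj w by ring]
    have hwz' : w - z ≠ 0 := by rw [← neg_sub]; exact neg_ne_zero.2 hwz
    rw [div_eq_div_iff hwz (by positivity)]
    ring

lemma avg_three {z : ℂ} {r : ℝ} (hz : ‖z‖ ≤ 1) (hr0 : 0 ≤ r) (hr : r < 1) :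
    circleAverage (fun w => conj w / (1 - z * conj w)) 0 r = 0 := by
  refine avg_conj hr0 (h := fun w => w / (1 - conj z * w)) ?_ (by simp) ?_
  · intro w hw
    rw [abs_of_nonneg hr0, mem_closedBall_zero_iff] at hw
    have : 1 - conj z * w ≠ 0 := by
      intro h
      have h2 : 1 = conj z * w := by linear_combination h
      have h3 := congrArg norm h2
      rw [norm_mul, norm_one, RCLike.norm_conj] at h3
      nlinarith [norm_nonneg z, norm_nonneg w]
    fun_prop (disch := assumption)
  · intro w hw
    simp

lemma avg_KK {z : ℂ} {r : ℝ} (hz : ‖z‖ ≤ 1) (hr0 : 0 ≤ r) (hr : r < 1) (hrz : r ≠ ‖z‖) :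
    circleAverage (KK z) 0 r = if r < ‖z‖ then 1 / z else 0 := by
  have c1 : CircleIntegrable (fun w => 1 / (z - w)) 0 r := by
    apply ContinuousOn.circleIntegrable hr0
    intro w hw
    rw [mem_sphere_zero_iff_norm] at hw
    have : z - w ≠ 0 := by
      intro h
      rw [sub_eq_zero] at h
      rw [h] at hrz; exact hrz hw.symm
    apply ContinuousAt.continuousWithinAt
    fun_prop (disch := assumption)
  have c2 : CircleIntegrable (fun w => conj w / (1 - z * conj w)) 0 r := by
    apply ContinuousOn.circleIntegrable hr0
    intro w hw
    rw [mem_sphere_zero_iff_norm] at hw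
    have : 1 - z * conj w ≠ 0 := b_pos hz (by linarith)
    apply ContinuousAt.continuousWithinAt
    refine ContinuousAt.div (f := fun w => conj w) (g := fun w => 1 - z * conj w) ?_ ?_ this
    · exact Complex.continuous_conj.continuousAt
    · exact (continuous_const.sub (continuous_const.mul Complex.continuous_conj)).continuousAt
  have e : KK z = fun w => 1 / (z - w) + conj w / (1 - z * conj w) := rfl
  rw [e, Real.circleAverage_fun_add c1 c2, avg_three hz hr0 hr, add_zero]
  split_ifs with h
  · exact avg_one hr0 h
  · exact avg_two (lt_of_le_of_ne (not_lt.1 h) hrz.symm)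

lemma int_KK {z : ℂ} (hz : z ∈ CD) : ∫ w in UD, KK z w = π * conj z := by
  have hz' : ‖z‖ ≤ 1 := by simpa using hz
  have hi : IntegrableOn (KK z) UD := by
    have := KK_int (f := fun _ => 1) continuous_const (M := 1) (by simp) hz
    simpa using this
  rw [rot_avg _ (KK_meas z) hi]
  have hsph : ∀ᵐ w ∂(volume.restrict UD), w ∉ Metric.sphere (0:ℂ) ‖z‖ := by
    apply ae_restrict_of_ae
    rw [ae_iff]
    simp only [not_not]
    exact Measure.addHaar_sphere volume 0 _
  have h1 : ∫ w in UD, circleAverage (KK z) 0 ‖w‖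
      = ∫ w in UD, (Metric.ball (0:ℂ) ‖z‖).indicator (fun _ => 1 / z) w := by
    apply integral_congr_ae
    filter_upwards [ae_good z z, hsph] with w hw hs
    rw [avg_KK hz' (norm_nonneg w) hw.1 (by simpa using hs)]
    simp [Set.indicator]
  rw [h1, setIntegral_indicator measurableSet_ball,
    inter_eq_right.2 (Metric.ball_subset_ball hz'), setIntegral_const, Measure.real,
    Complex.volume_ball]
  by_cases h0 : z = 0
  · simp [h0]
  · simp only [ENNReal.toReal_mul, ENNReal.toReal_pow, ENNReal.toReal_ofReal (norm_nonneg z)]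
    have e : (‖z‖ : ℂ) ^ 2 = z * conj z := by
      rw [Complex.mul_conj, Complex.normSq_eq_norm_sq]; push_cast; ring
    rw [Complex.real_smul]
    simp only [NNReal.coe_real_pi, ENNReal.coe_toReal, Complex.ofReal_mul, Complex.ofReal_pow]
    rw [e]
    field_simp

lemma DF_exp {f : ℂ → ℝ} (hf : Continuous f) {M L : ℝ} (hM : ∀ w, |f w| ≤ M)
    (hL : ∀ z ∈ CD, ∀ w ∈ CD, |f w - f z| ≤ L * ‖z - w‖) {β : ℝ} (h0 : 0 < β) (h1 : β < 1) :
    ∃ C : ℝ, 0 ≤ C ∧ ∀ z ∈ CD, ∀ z0 ∈ CD,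
      ‖DF f z - DF f z0 - ((z - z0) * LF f z0 - f z0 / 2 * conj (z - z0))‖
        ≤ C * ‖z - z0‖ ^ (1 + β) := by
  obtain ⟨C, hC, h⟩ := rpow_int_bound (1 + β) (by linarith)
  have hL0 : 0 ≤ L := by
    have := (abs_nonneg _).trans (hL 0 (by simp) 1 (by simp))
    simpa using this
  refine ⟨1 / (2 * π) * (8 * L * C), by positivity, fun z hz z0 hz0 => ?_⟩
  have i1 := KK_int hf hM hz
  have i2 := KK_int hf hM hz0
  have i3 := K1_int hf hz0 (hL z0 hz0)
  have i1' : IntegrableOn (KK z) UD := by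
    simpa using KK_int (f := fun _ => 1) continuous_const (M := 1) (by simp) hz
  have i2' : IntegrableOn (KK z0) UD := by
    simpa using KK_int (f := fun _ => 1) continuous_const (M := 1) (by simp) hz0
  have j : IntegrableOn (fun w => KK z w - KK z0 w) UD := i1'.sub i2'
  have j2 : IntegrableOn (fun w => KK z w * f w - KK z0 w * f w) UD := i1.sub i2
  have e0 : ∫ w in UD, (KK z w - KK z0 w) * f z0 = π * conj (z - z0) * f z0 := by
    rw [integral_mul_const, integral_sub i1' i2', int_KK hz, int_KK hz0, map_sub]; ring
  have e : DF f z - DF f z0 - ((z - z0) * LF f z0 - f z0 / 2 * conj (z - z0))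
      = -(1 / (2 * π)) * ∫ w in UD, ((KK z w * f w - KK z0 w * f w)
          - (KK z w - KK z0 w) * f z0
          - (z - z0) * (K1 z0 w * ((f w - f z0 : ℝ) : ℂ))) := by
    have j3 : IntegrableOn (fun w => (KK z w * f w - KK z0 w * f w)
          - (KK z w - KK z0 w) * f z0) UD := j2.sub (j.mul_const _)
    rw [integral_sub j3 (i3.const_mul _), integral_sub j2 (j.mul_const _), integral_sub i1 i2, e0,
      integral_const_mul]
    unfold DF LF
    have : (π : ℂ) ≠ 0 := by exact_mod_cast Real.pi_ne_zero
    field_simp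
    ring
  rw [e, norm_mul, norm_c, mul_assoc]
  gcongr
  refine (norm_integral_le_of_norm_le
    (((h z hz).1.add (h z0 hz0).1).const_mul (4 * L * ‖z - z0‖ ^ (1 + β))) ?_).trans ?_
  · filter_upwards [ae_good z z0] with w hw
    have hh := KK_exp (by simpa using hz) (by simpa using hz0) hw.1 hw.2.1 hw.2.2
    have p1 : 0 < ‖z - w‖ := norm_pos_iff.2 (sub_ne_zero.2 hw.2.1)
    have p2 : 0 < ‖z0 - w‖ := norm_pos_iff.2 (sub_ne_zero.2 hw.2.2)
    have tri : ‖z - z0‖ ≤ ‖z - w‖ + ‖z0 - w‖ := by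
      rw [norm_sub_rev z0 w]; exact norm_sub_le_norm_sub_add_norm_sub z w z0
    have hinteg := interp p1 p2 (norm_nonneg (z - z0)) tri h0 h1
    have e3 : (KK z w * f w - KK z0 w * f w) - (KK z w - KK z0 w) * f z0
          - (z - z0) * (K1 z0 w * ((f w - f z0 : ℝ) : ℂ))
        = (KK z w - KK z0 w - (z - z0) * K1 z0 w) * ((f w - f z0 : ℝ) : ℂ) := by
      push_cast; ring
    rw [e3, norm_mul, Complex.norm_real, Real.norm_eq_abs]
    calc _ ≤ (2 * (‖z - z0‖ ^ 2 / (‖z - w‖ * ‖z0 - w‖ ^ 2))) * (L * ‖z0 - w‖) := by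
          gcongr; exact hL z0 hz0 w (by simpa using hw.1.le)
      _ = 2 * L * (‖z - z0‖ ^ 2 / (‖z - w‖ * ‖z0 - w‖)) := by field_simp
      _ ≤ 2 * L * (2 * ‖z - z0‖ ^ (1 + β) * (‖z - w‖ ^ (-1 - β) + ‖z0 - w‖ ^ (-1 - β))) := by
          gcongr
      _ = _ := by
          simp only [Pi.add_apply]
          rw [show -(1 + β) = -1 - β by ring]; ring
  · rw [integral_const_mul]
    simp only [Pi.add_apply]
    rw [integral_add (h z hz).1 (h z0 hz0).1]
    calc _ ≤ 4 * L * ‖z - z0‖ ^ (1 + β) * (C + C) := by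
          gcongr
          · exact (h z hz).2
          · exact (h z0 hz0).2
      _ = _ := by ring

/-- Hölder continuity of the second derivative. -/
lemma LF_holder {f : ℂ → ℝ} (hf : Continuous f) {M L : ℝ} (hM : ∀ w, |f w| ≤ M)
    (hL : ∀ z ∈ CD, ∀ w ∈ CD, |f w - f z| ≤ L * ‖z - w‖) {β : ℝ} (h0 : 0 < β) (h1 : β < 1) :
    ∃ C : ℝ, 0 ≤ C ∧ ∀ z ∈ CD, ∀ z0 ∈ CD, ‖LF f z - LF f z0‖ ≤ C * ‖z - z0‖ ^ β := by
  obtain ⟨C, hC, h⟩ := DF_exp hf hM hL h0 h1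
  have hL0 : 0 ≤ L := by
    have := (abs_nonneg _).trans (hL 0 (by simp) 1 (by simp))
    simpa using this
  refine ⟨2 * C + L, by positivity, fun z hz z0 hz0 => ?_⟩
  by_cases hne : z = z0
  · simp [hne]; positivity
  have p : 0 < ‖z - z0‖ := norm_pos_iff.2 (sub_ne_zero.2 hne)
  have a1 := h z hz z0 hz0
  have a2 := h z0 hz0 z hz
  rw [norm_sub_rev z0 z] at a2
  have a3 := hL z0 hz0 z hz
  rw [norm_sub_rev z0 z] at a3
  have e : (z - z0) * (LF f z - LF f z0) =
      (DF f z - DF f z0 - ((z - z0) * LF f z0 - f z0 / 2 * conj (z - z0)))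
      + (DF f z0 - DF f z - ((z0 - z) * LF f z - f z / 2 * conj (z0 - z)))
      + ((f z - f z0 : ℝ) : ℂ) / 2 * conj (z - z0) := by
    simp only [map_sub]; push_cast; ring
  have e2 : ‖z - z0‖ * ‖LF f z - LF f z0‖ ≤ C * ‖z - z0‖ ^ (1 + β) + C * ‖z - z0‖ ^ (1 + β)
      + L * ‖z - z0‖ / 2 * ‖z - z0‖ := by
    rw [← norm_mul, e]
    refine (norm_add₃_le).trans ?_
    gcongr
    rw [norm_mul, norm_div, Complex.norm_real, RCLike.norm_conj, Real.norm_eq_abs]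
    have : ‖(2:ℂ)‖ = 2 := by simp
    rw [this]
    gcongr
  have hd : ‖z - z0‖ ≤ 2 := by
    have := norm_sub_le z z0
    have hz' : ‖z‖ ≤ 1 := by simpa using hz
    have hz0' : ‖z0‖ ≤ 1 := by simpa using hz0
    linarith
  have hd2 : ‖z - z0‖ / 2 ≤ ‖z - z0‖ ^ β := by
    have q : (‖z - z0‖ / 2) ≤ (‖z - z0‖ / 2) ^ β := by
      conv_lhs => rw [← Real.rpow_one (‖z - z0‖ / 2)]
      exact Real.rpow_le_rpow_of_exponent_ge (by positivity) (by linarith) h1.le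
    refine q.trans ?_
    exact Real.rpow_le_rpow (by positivity) (by linarith) h0.le
  rw [Real.rpow_add p, Real.rpow_one] at e2
  have e3 : ‖z - z0‖ * ‖LF f z - LF f z0‖ ≤ ‖z - z0‖ * ((2 * C + L) * ‖z - z0‖ ^ β) := by
    refine e2.trans ?_
    have : L * (‖z - z0‖ / 2) * ‖z - z0‖ ≤ L * ‖z - z0‖ ^ β * ‖z - z0‖ := by gcongr
    nlinarith
  exact le_of_mul_le_mul_left e3 p

lemma GF_boundary (f : ℂ → ℝ) {z : ℂ} (hz : ‖z‖ = 1) : GF f z = 0 := by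
  unfold GF
  rw [setIntegral_congr_fun (g := fun _ => 0) measurableSet_ball, integral_zero, mul_zero]
  intro w hw
  have hw' : ‖w‖ < 1 := by simpa using hw
  have : ‖z - w‖ ≠ 0 := by
    intro h
    rw [norm_eq_zero, sub_eq_zero] at h
    rw [h] at hz; linarith
  simp only [GK]
  rw [← b_eq hz, div_self this, Real.log_one, zero_mul]

lemma hasFD_of_rpow {E F : Type*} [NormedAddCommGroup E] [NormedSpace ℝ E] [NormedAddCommGroup F]
    [NormedSpace ℝ F] {s : Set E} {g : E → F} {A : E →L[ℝ] F} {z0 : E} {C p : ℝ} (hp : 1 < p)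
    (h : ∀ z ∈ s, ‖g z - g z0 - A (z - z0)‖ ≤ C * ‖z - z0‖ ^ p) : HasFDerivWithinAt g A s z0 := by
  rw [hasFDerivWithinAt_iff_isLittleO]
  have h1 : (fun z => g z - g z0 - A (z - z0)) =O[nhdsWithin z0 s] fun z => ‖z - z0‖ ^ p := by
    refine Asymptotics.IsBigO.of_bound C ?_
    filter_upwards [self_mem_nhdsWithin] with z hz
    refine (h z hz).trans (le_of_eq ?_)
    rw [Real.norm_of_nonneg (by positivity)]
  refine h1.trans_isLittleO ?_
  have h2 : (fun z => ‖z - z0‖ ^ p) = fun z : E => ‖z - z0‖ ^ (p - 1) * ‖z - z0‖ := by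
    funext z
    by_cases hz : ‖z - z0‖ = 0
    · rw [hz, Real.zero_rpow (by linarith)]; simp
    · rw [← Real.rpow_add_one hz]; ring_nf
  rw [h2]
  have h3 : Tendsto (fun z : E => ‖z - z0‖ ^ (p - 1)) (nhdsWithin z0 s) (nhds 0) := by
    have : ContinuousAt (fun z : E => ‖z - z0‖ ^ (p - 1)) z0 := by
      apply ContinuousAt.rpow_const (by fun_prop)
      right; linarith
    have h4 := this.tendsto
    simp only [sub_self, norm_zero] at h4
    rw [Real.zero_rpow (by linarith)] at h4
    exact h4.mono_left nhdsWithin_le_nhds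
  have := (Asymptotics.isLittleO_one_iff ℝ).2 h3
  have h5 := this.mul_isBigO (Asymptotics.isBigO_refl (fun z : E => ‖z - z0‖) _)
  simp only [one_mul] at h5
  exact h5.of_norm_right

/-- The differential of `GF`. -/
def dG (d : ℂ) : ℂ →L[ℝ] ℝ := Complex.reCLM.comp (ContinuousLinearMap.mul ℝ ℂ d)
def dD (l : ℂ) (c : ℝ) : ℂ →L[ℝ] ℂ :=
  ContinuousLinearMap.mul ℝ ℂ l - (c / 2) • (Complex.conjCLE : ℂ →L[ℝ] ℂ)

lemma GF_fd {f : ℂ → ℝ} (hf : Continuous f) {M : ℝ} (hM : ∀ w, |f w| ≤ M) {z0 : ℂ} (hz0 : z0 ∈ CD) :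
    HasFDerivWithinAt (GF f) (dG (DF f z0)) CD z0 := by
  obtain ⟨C, hC, h⟩ := GF_exp
  refine hasFD_of_rpow (C := C * M) (p := 3 / 2) (by norm_num) ?_
  intro z hz
  have := h f M hf hM z hz z0 hz0
  simpa [dG, mul_comm] using this

lemma DF_fd {f : ℂ → ℝ} (hf : Continuous f) {M L : ℝ} (hM : ∀ w, |f w| ≤ M)
    (hL : ∀ z ∈ CD, ∀ w ∈ CD, |f w - f z| ≤ L * ‖z - w‖) {z0 : ℂ} (hz0 : z0 ∈ CD) :
    HasFDerivWithinAt (DF f) (dD (LF f z0) (f z0)) CD z0 := by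
  obtain ⟨C, hC, h⟩ := DF_exp hf hM hL (β := 1 / 2) (by norm_num) (by norm_num)
  refine hasFD_of_rpow (C := C) (p := 1 + 1 / 2) (by norm_num) ?_
  intro z hz
  have := h z hz z0 hz0
  refine le_trans (le_of_eq ?_) this
  congr 2
  simp [dD]
  ring

lemma GF_lip : ∃ C : ℝ, 0 ≤ C ∧ ∀ (f : ℂ → ℝ) (M : ℝ), Continuous f → (∀ w, |f w| ≤ M) →
    ∀ z ∈ CD, ∀ z0 ∈ CD, |GF f z - GF f z0| ≤ C * M * ‖z - z0‖ := by
  obtain ⟨C, hC, h⟩ := GF_exp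
  obtain ⟨D, hD, h'⟩ := DF_bound
  refine ⟨2 * C + D, by positivity, ?_⟩
  intro f M hf hM z hz z0 hz0
  have h1 := h f M hf hM z hz z0 hz0
  have h2 := h' f M hf hM z0 hz0
  have hM0 : 0 ≤ M := (abs_nonneg _).trans (hM 0)
  have hd : ‖z - z0‖ ≤ 2 := by
    have := norm_sub_le z z0
    simp only [Metric.mem_closedBall, dist_zero_right] at hz hz0
    linarith
  have h3 : ‖z - z0‖ ^ (3 / 2 : ℝ) ≤ 2 * ‖z - z0‖ := by
    by_cases h0 : ‖z - z0‖ = 0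
    · rw [h0, Real.zero_rpow (by norm_num)]; simp
    have : ‖z - z0‖ ^ (3 / 2 : ℝ) = ‖z - z0‖ ^ (1 / 2 : ℝ) * ‖z - z0‖ := by
      rw [← Real.rpow_add_one h0]; norm_num
    rw [this]
    gcongr
    calc ‖z - z0‖ ^ (1 / 2 : ℝ) ≤ 2 ^ (1 / 2 : ℝ) := by gcongr
      _ ≤ 2 ^ (1 : ℝ) := by gcongr <;> norm_num
      _ = 2 := by norm_num
  have h4 : |((z - z0) * DF f z0).re| ≤ ‖z - z0‖ * (D * M) := by
    refine (Complex.abs_re_le_norm _).trans ?_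
    rw [norm_mul]; gcongr
  have h5 : |GF f z - GF f z0| ≤ |GF f z - GF f z0 - ((z - z0) * DF f z0).re| +
      |((z - z0) * DF f z0).re| := by
    have := abs_add_le (GF f z - GF f z0 - ((z - z0) * DF f z0).re) (((z - z0) * DF f z0).re)
    simpa using this
  have h6 : C * M * ‖z - z0‖ ^ (3 / 2 : ℝ) ≤ C * M * (2 * ‖z - z0‖) := by gcongr
  nlinarith

lemma GF_add {f g : ℂ → ℝ} (hf : Continuous f) {M N : ℝ} (hM : ∀ w, |f w| ≤ M)
    (hg : Continuous g) (hN : ∀ w, |g w| ≤ N) {z : ℂ} (hz : z ∈ CD) :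
    GF (fun w => f w + g w) z = GF f z + GF g z := by
  unfold GF
  rw [← mul_add, ← integral_add (GK_int hf hM hz) (GK_int hg hN hz)]
  congr 2; funext w; ring

lemma GF_smul {f : ℂ → ℝ} (c : ℝ) (z : ℂ) :
    GF (fun w => c * f w) z = c * GF f z := by
  unfold GF
  rw [mul_left_comm, ← integral_const_mul c]
  congr 2; funext w; ring

/-- Radial projection onto the closed disk. -/
def prj (w : ℂ) : CD := ⟨((max 1 ‖w‖)⁻¹ : ℝ) • w, by
  have : 0 < max 1 ‖w‖ := by positivity
  simp only [Metric.mem_closedBall, dist_zero_right, norm_smul, norm_inv, Real.norm_eq_abs,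
    abs_of_pos this]
  rw [inv_mul_le_iff₀ this]; simp⟩

lemma prj_cont : Continuous prj := by
  unfold prj
  apply Continuous.subtype_mk
  have h : Continuous fun w : ℂ => (max 1 ‖w‖)⁻¹ := by
    apply Continuous.inv₀ (by fun_prop)
    intro x; positivity
  exact h.smul continuous_id

lemma prj_eq {w : ℂ} (hw : w ∈ CD) : prj w = ⟨w, hw⟩ := by
  simp only [Metric.mem_closedBall, dist_zero_right] at hw
  ext1
  simp [prj, max_eq_left hw]

/-- Continuous functions on the closed disk. -/
abbrev XX := BoundedContinuousFunction CD ℝ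

def xt (f : XX) (w : ℂ) : ℝ := f (prj w)
lemma xt_cont (f : XX) : Continuous (xt f) := f.continuous.comp prj_cont
lemma xt_bound (f : XX) (w : ℂ) : |xt f w| ≤ ‖f‖ := f.norm_coe_le_norm _
lemma xt_eq (f : XX) (w : CD) : xt f w = f w := by unfold xt; rw [prj_eq w.2]
lemma xt_eq' (f : XX) {w : ℂ} (hw : w ∈ CD) : xt f w = f ⟨w, hw⟩ := by unfold xt; rw [prj_eq hw]

lemma GF_contOn {f : ℂ → ℝ} (hf : Continuous f) {M : ℝ} (hM : ∀ w, |f w| ≤ M) :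
    ContinuousOn (GF f) CD := fun z hz => (GF_fd hf hM hz).continuousWithinAt

/-- Green operator on `XX`. -/
def Gop : XX →L[ℝ] XX :=
  LinearMap.mkContinuousOfExistsBound
    { toFun := fun f => BoundedContinuousFunction.mkOfCompact
        ⟨fun z : CD => GF (xt f) z, (GF_contOn (xt_cont f) (xt_bound f)).domRestrict⟩
      map_add' := by
        intro f g
        ext z
        exact GF_add (xt_cont f) (xt_bound f) (xt_cont g) (xt_bound g) z.2
      map_smul' := by
        intro c f
        ext z
        exact GF_smul c z } (by
    obtain ⟨C, hC, h⟩ := GF_bound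
    refine ⟨C, fun f => ?_⟩
    rw [BoundedContinuousFunction.norm_le (by positivity)]
    intro z
    exact h _ _ (xt_cont f) (xt_bound f) z z.2)

lemma Gop_apply (f : XX) (z : CD) : Gop f z = GF (xt f) z := rfl

lemma Gop_compact : IsCompactOperator Gop := by
  refine (isCompactOperator_iff_isCompact_closure_image_closedBall (Gop : XX →ₗ[ℝ] XX) one_pos).2 ?_
  obtain ⟨C, hC, h⟩ := GF_bound
  obtain ⟨D, hD, h'⟩ := GF_lip
  apply BoundedContinuousFunction.arzela_ascoli (Icc (-C) C) isCompact_Icc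
  · rintro _ z ⟨f, hf, rfl⟩
    simp only [Metric.mem_closedBall, dist_zero_right] at hf
    have := h _ 1 (xt_cont f) (fun w => (xt_bound f w).trans hf) z z.2
    rw [mul_one] at this
    exact abs_le.1 this
  · apply LipschitzWith.uniformEquicontinuous _ (Real.toNNReal D) _ |>.equicontinuous
    rintro ⟨_, f, hf, rfl⟩
    apply LipschitzWith.of_dist_le_mul
    intro x y
    simp only [Metric.mem_closedBall, dist_zero_right] at hf
    have := h' _ 1 (xt_cont f) (fun w => (xt_bound f w).trans hf) x x.2 y y.2
    rw [mul_one] at this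
    rw [Real.coe_toNNReal _ hD]
    rw [Real.dist_eq, Subtype.dist_eq, dist_eq_norm]
    exact this

lemma second_test {g g' : ℝ → ℝ} {g2 : ℝ} (h1 : ∀ᶠ t in nhds 0, HasDerivAt g (g' t) t)
    (h2 : HasDerivAt g' g2 0) (hmax : IsLocalMax g 0) : g2 ≤ 0 := by
  by_contra! hpos
  have hd : deriv g =ᶠ[nhds 0] g' := h1.mono fun t ht => ht.deriv
  have hdd : deriv (deriv g) 0 = g2 := by rw [hd.deriv_eq, h2.deriv]
  have hc : ContinuousAt g 0 := h1.self_of_nhds.continuousAt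
  have hd0 : deriv g 0 = 0 := hmax.deriv_eq_zero
  have hmin := isLocalMin_of_deriv_deriv_pos (by rw [hdd]; exact hpos) hd0 hc
  have hconst : g =ᶠ[nhds 0] fun _ => g 0 := by
    filter_upwards [hmin, hmax] with t h1 h2 using le_antisymm h2 h1
  have h3 : deriv g =ᶠ[nhds 0] fun _ => 0 := by
    filter_upwards [hconst.eventuallyEq_nhds] with t ht
    rw [ht.deriv_eq]; simp
  have := h3.deriv_eq
  rw [hdd] at this
  simp at this
  linarith

lemma slice_path (z0 h : ℂ) (t : ℝ) : HasDerivAt (fun t : ℝ => z0 + t * h) h t := by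
  have := (Complex.ofRealCLM.hasDerivAt (x := t)).mul_const h
  simpa using this.const_add z0

lemma GF_slice1 {f : ℂ → ℝ} (hf : Continuous f) {M : ℝ} (hM : ∀ w, |f w| ≤ M) {z0 : ℂ}
    (hz0 : z0 ∈ UD) (h : ℂ) :
    ∀ᶠ t : ℝ in nhds 0, HasDerivAt (fun t : ℝ => GF f (z0 + t * h)) (DF f (z0 + t * h) * h).re t := by
  have hc : ContinuousAt (fun t : ℝ => z0 + t * h) 0 := (slice_path z0 h 0).continuousAt
  have : ∀ᶠ t : ℝ in nhds 0, z0 + t * h ∈ UD :=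
    hc.eventually_mem (by simpa using Metric.isOpen_ball.mem_nhds hz0)
  filter_upwards [this] with t ht
  have hn : CD ∈ nhds (z0 + t * h) :=
    mem_of_superset (Metric.isOpen_ball.mem_nhds ht) Metric.ball_subset_closedBall
  have h1 := (GF_fd hf hM (Metric.ball_subset_closedBall ht)).hasFDerivAt hn
  have := h1.comp_hasDerivAt t (slice_path z0 h t)
  simpa [dG, Function.comp_def] using this

lemma DF_slice1 {f : ℂ → ℝ} (hf : Continuous f) {M L : ℝ} (hM : ∀ w, |f w| ≤ M)
    (hL : ∀ z ∈ CD, ∀ w ∈ CD, |f w - f z| ≤ L * ‖z - w‖) {z0 : ℂ}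
    (hz0 : z0 ∈ UD) (h : ℂ) :
    HasDerivAt (fun t : ℝ => (DF f (z0 + t * h) * h).re)
      ((LF f z0 * h - f z0 / 2 * conj h) * h).re 0 := by
  have hn : CD ∈ nhds (z0 + (0 : ℝ) * h) := by
    simpa using
    mem_of_superset (Metric.isOpen_ball.mem_nhds hz0) Metric.ball_subset_closedBall
  have h0 : z0 + (0 : ℝ) * h = z0 := by simp
  have h1 := (DF_fd hf hM hL (z0 := z0 + (0 : ℝ) * h)
    (by rw [h0]; exact Metric.ball_subset_closedBall hz0)).hasFDerivAt hn
  have h2 := (h1.comp_hasDerivAt 0 (slice_path z0 h 0)).mul_const h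
  have h3 := Complex.reCLM.hasFDerivAt.comp_hasDerivAt (0 : ℝ) h2
  rw [h0] at h3
  simpa [dD, Function.comp_def] using h3

/-- The barrier. -/
def psi (M x : ℝ) : ℝ := M * x ^ (1 / 2 : ℝ) - x ^ (5 / 2 : ℝ)
def psi1 (M x : ℝ) : ℝ := M * (1 / 2 * x ^ (-1 / 2 : ℝ)) - 5 / 2 * x ^ (3 / 2 : ℝ)
def psi2 (M x : ℝ) : ℝ := -(M / 4 * x ^ (-3 / 2 : ℝ)) - 15 / 4 * x ^ (1 / 2 : ℝ)

lemma psi_d1 (M : ℝ) {x : ℝ} (hx : 0 < x) : HasDerivAt (psi M) (psi1 M x) x := by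
  have h1 := (Real.hasDerivAt_rpow_const (x := x) (p := 1 / 2) (Or.inl hx.ne')).const_mul M
  have h2 := (Real.hasDerivAt_rpow_const (x := x) (p := 5 / 2) (Or.inl hx.ne'))
  refine (h1.sub h2).congr_deriv ?_
  unfold psi1; norm_num

lemma psi_d2 (M : ℝ) {x : ℝ} (hx : 0 < x) : HasDerivAt (psi1 M) (psi2 M x) x := by
  have h1 := ((Real.hasDerivAt_rpow_const (x := x) (p := -1 / 2) (Or.inl hx.ne')).const_mul
    (1 / 2)).const_mul M
  have h2 := (Real.hasDerivAt_rpow_const (x := x) (p := 3 / 2) (Or.inl hx.ne')).const_mul (5 / 2)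
  refine (h1.sub h2).congr_deriv ?_
  unfold psi2; norm_num; ring

lemma psi_eq (M : ℝ) {x : ℝ} (hx : 0 < x) :
    psi2 M x + psi M x / (4 * x ^ 2) = - 4 * x ^ (1 / 2 : ℝ) := by
  unfold psi psi2
  have h1 : x ^ (1 / 2 : ℝ) = x ^ (-3 / 2 : ℝ) * x ^ 2 := by
    rw [← Real.rpow_natCast, ← Real.rpow_add hx]; norm_num
  have h2 : x ^ (5 / 2 : ℝ) = x ^ (-3 / 2 : ℝ) * x ^ 4 := by
    rw [← Real.rpow_natCast, ← Real.rpow_add hx]; norm_num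
  rw [h1, h2]
  field_simp
  ring

lemma psi_pos {M x : ℝ} (hx : 0 < x) (hM : x ^ 2 < M) : 0 < psi M x := by
  unfold psi
  have h2 : x ^ (5 / 2 : ℝ) = x ^ (1 / 2 : ℝ) * x ^ 2 := by
    rw [← Real.rpow_natCast, ← Real.rpow_add hx]; norm_num
  rw [h2]
  have : 0 < x ^ (1 / 2 : ℝ) := by positivity
  nlinarith

lemma re_pos {a : ℝ} (ha : 1 < a) {z : ℂ} (hz : z ∈ CD) : 0 < a + z.re := by
  simp only [Metric.mem_closedBall, dist_zero_right] at hz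
  have := (abs_le.1 (Complex.abs_re_le_norm z)).1
  linarith

lemma re_ge {a : ℝ} {z : ℂ} (hz : z ∈ CD) : a - 1 ≤ a + z.re := by
  simp only [Metric.mem_closedBall, dist_zero_right] at hz
  have := (abs_le.1 (Complex.abs_re_le_norm z)).1
  linarith

lemma re_le {a : ℝ} {z : ℂ} (hz : z ∈ CD) : a + z.re ≤ a + 1 := by
  simp only [Metric.mem_closedBall, dist_zero_right] at hz
  have := (abs_le.1 (Complex.abs_re_le_norm z)).2
  linarith

def Vx (a c : ℝ) (ha : 1 < a) : XX := BoundedContinuousFunction.mkOfCompact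
  ⟨fun z : CD => c / (a + z.1.re) ^ 2, by
    apply Continuous.div continuous_const (by fun_prop)
    intro z
    exact pow_ne_zero _ (re_pos ha z.2).ne'⟩

lemma Vx_apply (a c : ℝ) (ha : 1 < a) (z : CD) : Vx a c ha z = c / (a + z.1.re) ^ 2 := rfl

/-- Lipschitz on the disk. -/
def LpD (f : CD → ℝ) : Prop := ∃ L : ℝ, 0 ≤ L ∧ ∀ z w : CD, |f z - f w| ≤ L * ‖z.1 - w.1‖

lemma Lp_mul {f g : XX} (hf : LpD f) (hg : LpD g) : LpD (f * g) := by
  obtain ⟨L, hL, h⟩ := hf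
  obtain ⟨K, hK, k⟩ := hg
  refine ⟨L * ‖g‖ + ‖f‖ * K, by positivity, fun z w => ?_⟩
  have e : (f * g) z - (f * g) w = (f z - f w) * g z + f w * (g z - g w) := by
    simp; ring
  change |(f * g) z - (f * g) w| ≤ _
  rw [e]
  refine (abs_add_le _ _).trans ?_
  rw [abs_mul, abs_mul]
  have h1 : |g z| ≤ ‖g‖ := g.norm_coe_le_norm _
  have h2 : |f w| ≤ ‖f‖ := f.norm_coe_le_norm _
  calc _ ≤ (L * ‖z.1 - w.1‖) * ‖g‖ + ‖f‖ * (K * ‖z.1 - w.1‖) := by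
        gcongr
        · exact h z w
        · exact k z w
    _ = _ := by ring

lemma Lp_add {f g : XX} (hf : LpD f) (hg : LpD g) : LpD (f + g) := by
  obtain ⟨L, hL, h⟩ := hf
  obtain ⟨K, hK, k⟩ := hg
  refine ⟨L + K, by positivity, fun z w => ?_⟩
  have e : (f + g) z - (f + g) w = (f z - f w) + (g z - g w) := by
    simp; ring
  change |(f + g) z - (f + g) w| ≤ _
  rw [e, add_mul]
  exact (abs_add_le _ _).trans (add_le_add (h z w) (k z w))

lemma Lp_Gop (f : XX) : LpD (Gop f) := by
  obtain ⟨D, hD, h'⟩ := GF_lip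
  exact ⟨D * ‖f‖, by positivity, fun z w => h' _ _ (xt_cont f) (xt_bound f) z z.2 w w.2⟩

lemma Lp_Vx (a c : ℝ) (ha : 1 < a) : LpD (Vx a c ha) := by
  have h0 : 0 < a - 1 := by linarith
  refine ⟨|c| * (2 * (a + 1)) / (a - 1) ^ 4, by positivity, fun z w => ?_⟩
  rw [Vx_apply, Vx_apply]
  have h1 := re_pos ha z.2
  have h2 := re_pos ha w.2
  have h3 := re_ge (a := a) z.2
  have h4 := re_ge (a := a) w.2
  have h5 := re_le (a := a) z.2
  have h6 := re_le (a := a) w.2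
  have h7 : |w.1.re - z.1.re| ≤ ‖z.1 - w.1‖ := by
    rw [norm_sub_rev]; simpa using Complex.abs_re_le_norm (w.1 - z.1)
  generalize z.1.re = x at *
  generalize w.1.re = y at *
  have e : c / (a + x) ^ 2 - c / (a + y) ^ 2 =
    c * ((a + x + (a + y)) * (y - x)) / ((a + x) ^ 2 * (a + y) ^ 2) := by
    field_simp; ring
  rw [e, abs_div, abs_mul, abs_mul, abs_of_pos (a := a + x + (a + y)) (by linarith),
    abs_of_pos (a := (a + x) ^ 2 * (a + y) ^ 2) (by positivity), div_mul_eq_mul_div, mul_assoc |c|]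
  have : (a - 1) ^ 4 ≤ (a + x) ^ 2 * (a + y) ^ 2 := by
    calc (a - 1) ^ 4 = (a - 1) ^ 2 * (a - 1) ^ 2 := by ring
      _ ≤ _ := by gcongr
  gcongr
  linarith

lemma xt_lip {f : XX} (h : LpD f) : ∃ L : ℝ, ∀ z ∈ CD, ∀ w ∈ CD, |xt f w - xt f z| ≤ L * ‖z - w‖ := by
  obtain ⟨L, hL, h⟩ := h
  refine ⟨L, fun z hz w hw => ?_⟩
  rw [xt_eq' f hz, xt_eq' f hw, norm_sub_rev]
  exact h _ _

lemma max_princ {a c : ℝ} (ha : 1 < a) (hc : c ≤ 1 / 4) (w : XX) (hw : Gop (Vx a c ha * w) = w)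
    (z : CD) : w z ≤ 0 := by
  set M := (a + 1) ^ 2 + 1 with hM
  have hps : ∀ z ∈ CD, 0 < psi M (a + z.re) := fun z hz =>
    psi_pos (re_pos ha hz) (by have := re_le (a := a) hz; have := re_pos ha hz; nlinarith)
  have hcont : Continuous fun z : CD => w z / psi M (a + z.1.re) := by
    apply Continuous.div w.continuous
    · unfold psi
      apply Continuous.sub
      · apply Continuous.mul continuous_const
        apply Continuous.rpow_const (by fun_prop); intro z; right; norm_num
      · apply Continuous.rpow_const (by fun_prop); intro z; right; norm_num
    · intro z; exact (hps z z.2).ne'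
  obtain ⟨z1, -, hz1⟩ := isCompact_univ.exists_isMaxOn (α := ℝ) ⟨z, mem_univ z⟩ hcont.continuousOn
  set m := w z1 / psi M (a + z1.1.re) with hm
  have hz1' : ∀ y : CD, w y ≤ m * psi M (a + y.1.re) := by
    intro y
    have := hz1 (mem_univ y)
    exact (div_le_iff₀ (hps y y.2)).1 this
  have heq : w z1 = m * psi M (a + z1.1.re) := by
    rw [hm, div_mul_cancel₀ _ (hps z1 z1.2).ne']
  suffices hm0 : m ≤ 0 by
    exact (hz1' z).trans (mul_nonpos_of_nonpos_of_nonneg hm0 (hps z z.2).le)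
  by_contra! hm0
  -- interior
  have hinteg : z1.1 ∈ UD := by
    rw [Metric.mem_ball, dist_zero_right]
    refine lt_of_le_of_ne (by simpa only [Metric.mem_closedBall, dist_zero_right] using z1.2) fun h1 => ?_
    have : w z1 = 0 := by rw [← hw, Gop_apply, GF_boundary _ h1]
    rw [heq] at this
    have := mul_pos hm0 (hps z1 z1.2)
    linarith
  set F : XX := Vx a c ha * w with hF
  obtain ⟨L, hL⟩ := xt_lip (f := F) (Lp_mul (Lp_Vx a c ha) (by rw [← hw]; exact Lp_Gop _))
  set z0 := z1.1 with hz0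
  have hwv : ∀ y (hy : y ∈ CD), w ⟨y, hy⟩ = GF (xt F) y := by
    intro y hy; conv_lhs => rw [← hw]
    rfl
  have hloc : ∀ h : ℂ, IsLocalMax
      (fun t : ℝ => GF (xt F) (z0 + t * h) - m * psi M (a + (z0 + t * h).re)) 0 := by
    intro h
    have hc : ContinuousAt (fun t : ℝ => z0 + t * h) 0 := (slice_path z0 h 0).continuousAt
    have : ∀ᶠ t : ℝ in nhds 0, z0 + t * h ∈ UD :=
      hc.eventually_mem (by simpa using Metric.isOpen_ball.mem_nhds hinteg)
    filter_upwards [this] with t ht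
    have h1 := hz1' ⟨z0 + t * h, Metric.ball_subset_closedBall ht⟩
    rw [hwv] at h1
    have h2 := heq
    have h3 := hwv z0 z1.2
    have h4 : GF (xt F) z0 = m * psi M (a + z0.re) := by rw [← h3]; exact h2
    simp only [Complex.ofReal_zero, zero_mul, add_zero]
    rw [h4]
    simp only at h1
    linarith
  have hρ := re_pos ha z1.2
  -- direction 1
  have e1 : ((LF (xt F) z0 * 1 - xt F z0 / 2 * conj 1) * 1).re - m * psi2 M (a + z0.re) ≤ 0 := by
    refine second_test (g' := fun t : ℝ => (DF (xt F) (z0 + t * 1) * 1).re - m * psi1 M (a + z0.re + t))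
      ?_ ?_ (hloc 1)
    · have hpos : ∀ᶠ t : ℝ in nhds 0, 0 < a + z0.re + t := by
        have : ContinuousAt (fun t : ℝ => a + z0.re + t) 0 := by fun_prop
        exact this.eventually (by simpa using lt_mem_nhds hρ)
      filter_upwards [GF_slice1 (xt_cont F) (xt_bound F) hinteg 1, hpos] with t ht hp
      refine ht.sub (HasDerivAt.const_mul m ?_)
      have := (psi_d1 M hp).comp_const_add (a + z0.re) t
      simpa [add_assoc] using this
    · refine (DF_slice1 (xt_cont F) (xt_bound F) hL hinteg 1).sub (HasDerivAt.const_mul m ?_)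
      have h0 : HasDerivAt (psi1 M) (psi2 M (a + z0.re)) (a + z0.re + 0) := by
        simpa using psi_d2 M hρ
      exact h0.comp_const_add (a + z0.re) 0
  have e2 : ((LF (xt F) z0 * Complex.I - xt F z0 / 2 * conj Complex.I) * Complex.I).re ≤ 0 := by
    refine second_test (g' := fun t : ℝ => (DF (xt F) (z0 + t * Complex.I) * Complex.I).re)
      ?_ ?_ (hloc Complex.I)
    · filter_upwards [GF_slice1 (xt_cont F) (xt_bound F) hinteg Complex.I] with t ht
      have := ht.sub_const (m * psi M (a + z0.re))
      simpa using this
    · exact DF_slice1 (xt_cont F) (xt_bound F) hL hinteg Complex.I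
  have e3 : xt F z0 = c / (a + z0.re) ^ 2 * (m * psi M (a + z0.re)) := by
    rw [xt_eq F z1, ← heq]; rfl
  have e4 := psi_eq M hρ
  have e5 := hps z0 z1.2
  simp at e1 e2
  generalize (LF (xt F) z0).re = l at *
  have e6 : psi2 M (a + z0.re) = - 4 * (a + z0.re) ^ (1 / 2 : ℝ) -
    psi M (a + z0.re) / (4 * (a + z0.re) ^ 2) := by linarith
  have e7 : -xt F z0 - m * psi2 M (a + z0.re) ≤ 0 := by linarith
  rw [e6, e3] at e7
  have e8 : 0 < (a + z0.re) ^ (1 / 2 : ℝ) := by positivity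
  have e9 : -(c / (a + z0.re) ^ 2 * (m * psi M (a + z0.re))) - m * (- 4 * (a + z0.re) ^ (1 / 2 : ℝ) -
    psi M (a + z0.re) / (4 * (a + z0.re) ^ 2)) = m * (4 * (a + z0.re) ^ (1 / 2 : ℝ)) +
     m * psi M (a + z0.re) * (1 / 4 - c) / (a + z0.re) ^ 2 := by
    field_simp; ring
  rw [e9] at e7
  have : 0 ≤ m * psi M (a + z0.re) * (1 / 4 - c) / (a + z0.re) ^ 2 := by
    have : 0 ≤ 1 / 4 - c := by linarith
    positivity
  have : 0 < m * (4 * (a + z0.re) ^ (1 / 2 : ℝ)) := by positivity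
  linarith

/-- Linear solver. -/
lemma solver {a c : ℝ} (ha : 1 < a) (hc : c ≤ 1 / 4) : ∃ S : XX →L[ℝ] XX,
    ∀ f : XX, S f = Gop (Vx a c ha * S f + f) := by
  set T : XX →L[ℝ] XX := Gop.comp (ContinuousLinearMap.mul ℝ XX (Vx a c ha)) with hT
  have hTc : IsCompactOperator T := Gop_compact.comp_clm _
  have hTa : ∀ w, T w = Gop (Vx a c ha * w) := fun w => rfl
  have h1 : (1 : ℝ) ∈ resolventSet ℝ T := by
    refine (hTc.hasEigenvalue_or_mem_resolventSet one_ne_zero).resolve_left ?_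
    intro he
    obtain ⟨w, hw⟩ := he.exists_hasEigenvector
    have hw1 : Gop (Vx a c ha * w) = w := by
      have := hw.apply_eq_smul
      simpa [hTa] using this
    have hw2 : Gop (Vx a c ha * (-w)) = -w := by
      have e : Vx a c ha * -w = -(Vx a c ha * w) := by ext z; simp
      rw [e, map_neg, hw1]
    apply hw.2
    ext z
    have a1 := max_princ ha hc w hw1 z
    have a2 := max_princ ha hc (-w) hw2 z
    simp at a2
    exact le_antisymm a1 a2
  rw [spectrum.mem_resolventSet_iff] at h1
  obtain ⟨u, hu⟩ := h1
  refine ⟨(↑u⁻¹ : XX →L[ℝ] XX).comp Gop, fun f => ?_⟩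
  set y := ((↑u⁻¹ : XX →L[ℝ] XX).comp Gop) f with hy
  have h2 : (u : XX →L[ℝ] XX) y = Gop f := by
    have : (u : XX →L[ℝ] XX) ((↑u⁻¹ : XX →L[ℝ] XX) (Gop f)) = ((u : XX →L[ℝ] XX) * ↑u⁻¹) (Gop f) := rfl
    rw [Units.mul_inv] at this
    exact this
  rw [hu] at h2
  simp only [map_one, sub_apply, one_apply_eq_self, hTa] at h2
  rw [map_add, ← h2]
  abel

lemma nsq_nonneg (v : R3) : 0 ≤ nsq v := by unfold nsq; positivity
lemma nsq_cont : Continuous nsq := by unfold nsq; fun_prop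
lemma vb_cont : Continuous vb := by unfold vb; have := nsq_cont; fun_prop
lemma vb_ge (v : R3) : 1 ≤ vb v := by
  unfold vb; rw [Real.one_le_sqrt]; linarith [nsq_nonneg v]
lemma vb_sq (v : R3) : vb v ^ 2 = 1 + nsq v := by
  unfold vb; rw [Real.sq_sqrt]; linarith [nsq_nonneg v]

lemma vb_norm (v : R3) : 1 + ‖v‖ ≤ 2 * vb v := by
  have h : ‖v‖ ≤ vb v := by
    rw [pi_norm_le_iff_of_nonneg (by linarith [vb_ge v])]
    intro i
    apply Real.abs_le_sqrt
    have : v i ^ 2 ≤ nsq v := Finset.single_le_sum (f := fun i => v i ^ 2) (fun i _ => by positivity) (Finset.mem_univ i)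
    linarith
  linarith [vb_ge v]

lemma abs_le_vb (v : R3) (i : Fin 3) : |v i| ≤ vb v := by
  apply Real.abs_le_sqrt
  have : v i ^ 2 ≤ nsq v := Finset.single_le_sum (f := fun i => v i ^ 2) (fun i _ => by positivity) (Finset.mem_univ i)
  linarith

lemma vb_int {γ : ℝ} (hγ : 3 < γ) : Integrable (fun v : R3 => vb v ^ (-γ)) := by
  have h1 : Integrable (fun v : R3 => (2 : ℝ) ^ γ * (1 + ‖v‖) ^ (-γ)) :=
    (integrable_one_add_norm (by simpa using hγ)).const_mul _
  refine h1.mono' ?_ ?_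
  · refine Continuous.aestronglyMeasurable (vb_cont.rpow_const fun v => Or.inl ?_)
    linarith [vb_ge v]
  · refine Eventually.of_forall fun v => ?_
    have h0 := vb_ge v
    rw [Real.norm_of_nonneg (by positivity)]
    have h2 := vb_norm v
    have : (2 * vb v) ^ (-γ) ≤ (1 + ‖v‖) ^ (-γ) :=
      Real.rpow_le_rpow_of_nonpos (by positivity) h2 (by linarith)
    rw [Real.mul_rpow (by norm_num) (by linarith)] at this
    calc vb v ^ (-γ) = 2 ^ γ * (2 ^ (-γ) * vb v ^ (-γ)) := by
          rw [← mul_assoc, ← Real.rpow_add (by norm_num)]; simp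
      _ ≤ _ := by gcongr

lemma vb_nsq {γ : ℝ} (v : R3) : (1 + nsq v) ^ (-γ / 2) = vb v ^ (-γ) := by
  rw [← vb_sq, ← Real.rpow_natCast, ← Real.rpow_mul (by linarith [vb_ge v])]
  congr 1; push_cast; ring

def JJ (k : ℝ → ℝ → ℝ) (r : ℝ) : ℝ := ∫ v : R3, k (1 + nsq v) (r * v 0)
def QQ (k : ℝ → ℝ → ℝ) (s u : ℝ) : ℝ := ∫ t in Ioi s, k t u

/-- The equivalence between `ℝ × ℂ` and `R3`. -/
def cyl : ℝ × ℂ ≃ᵐ R3 :=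
  ((MeasurableEquiv.refl ℝ).prodCongr Complex.measurableEquivPi).trans
    (MeasurableEquiv.piFinSuccAbove (fun _ : Fin 3 => ℝ) 0).symm

lemma cyl_mp : MeasurePreserving cyl := by
  have h1 : MeasurePreserving (Prod.map (id : ℝ → ℝ) Complex.measurableEquivPi)
      (volume.prod volume) (volume.prod volume) :=
    (MeasurePreserving.id volume).prod Complex.volume_preserving_equiv_pi
  have h2 := (volume_preserving_piFinSuccAbove (fun _ : Fin 3 => ℝ) 0).symm
  exact h2.comp h1

lemma cyl_zero (p : ℝ × ℂ) : cyl p 0 = p.1 := rfl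
lemma cyl_nsq (p : ℝ × ℂ) : nsq (cyl p) = p.1 ^ 2 + ‖p.2‖ ^ 2 := by
  have h1 : cyl p 1 = p.2.re := rfl
  have h2 : cyl p 2 = p.2.im := rfl
  unfold nsq
  rw [Fin.sum_univ_three, h1, h2, cyl_zero, Complex.sq_norm, Complex.normSq_apply]
  ring

lemma inner_int (g : ℝ → ℝ) (s : ℝ) : ∫ y : ℂ, g (s + ‖y‖ ^ 2) = π * ∫ t in Ioi s, g t := by
  rw [integral_fun_norm_addHaar volume (fun y => g (s + y ^ 2))]
  have him : (fun y : ℝ => s + y ^ 2) '' Ioi 0 = Ioi s := by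
    ext t
    simp only [mem_image, mem_Ioi]
    constructor
    · rintro ⟨y, hy, rfl⟩; nlinarith
    · intro ht
      exact ⟨√(t - s), Real.sqrt_pos.2 (by linarith), by rw [Real.sq_sqrt (by linarith)]; ring⟩
  rw [← him, integral_image_eq_integral_abs_deriv_smul (f' := fun y => 2 * y) measurableSet_Ioi]
  · have hb : volume.real (Metric.ball (0 : ℂ) 1) = π := by
      simp [Measure.real, Complex.volume_ball]
    rw [hb, Complex.finrank_real_complex]
    simp only [smul_eq_mul, nsmul_eq_mul]
    rw [← mul_assoc, mul_comm ((2 : ℕ) : ℝ) π, mul_assoc, ← integral_const_mul]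
    congr 1
    apply setIntegral_congr_fun measurableSet_Ioi
    intro y hy
    simp only [mem_Ioi] at hy
    simp only
    rw [abs_of_pos (by positivity)]
    push_cast
    ring
  · intro y hy
    have := ((hasDerivAt_pow 2 y).const_add s).hasDerivWithinAt (s := Ioi 0)
    simpa using this
  · intro x hx y hy hxy
    simp only [mem_Ioi] at hx hy
    simp only at hxy
    nlinarith

section
variable {γ r0 r1 D : ℝ} {k : ℝ → ℝ → ℝ}

lemma k_bd_v (hr0 : 0 < r0) (hD : 0 ≤ D)
    (hb : ∀ t u, 1 + u ^ 2 / r1 ^ 2 ≤ t → |k t u| ≤ D * t ^ (-γ / 2)) {r : ℝ} (hr : r ∈ Icc r0 r1)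
    (v : R3) : |k (1 + nsq v) (r * v 0)| ≤ D * vb v ^ (-γ) := by
  rw [← vb_nsq]
  apply hb
  have h1 : v 0 ^ 2 ≤ nsq v := Finset.single_le_sum (f := fun i => v i ^ 2) (fun i _ => by positivity) (Finset.mem_univ 0)
  have hr0' : 0 < r := hr0.trans_le hr.1
  have : (r * v 0) ^ 2 / r1 ^ 2 ≤ v 0 ^ 2 := by
    have hr1 : 0 < r1 := hr0'.trans_le hr.2
    rw [div_le_iff₀ (by positivity), mul_pow, mul_comm]
    gcongr
    exact hr.2
  linarith

lemma k_int_v (hγ : 3 < γ) (hr0 : 0 < r0) (hD : 0 ≤ D) (hk : Continuous (Function.uncurry k))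
    (hb : ∀ t u, 1 + u ^ 2 / r1 ^ 2 ≤ t → |k t u| ≤ D * t ^ (-γ / 2)) {r : ℝ} (hr : r ∈ Icc r0 r1) :
    Integrable fun v : R3 => k (1 + nsq v) (r * v 0) := by
  refine ((vb_int hγ).const_mul D).mono' ?_ (Eventually.of_forall fun v => k_bd_v hr0 hD hb hr v)
  have h := nsq_cont
  have : Continuous fun v : R3 => Function.uncurry k (1 + nsq v, r * v 0) :=
    hk.comp (by fun_prop)
  exact this.aestronglyMeasurable

lemma JJ_bound (hγ : 3 < γ) (hr0 : 0 < r0) (hD : 0 ≤ D)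
    (hb : ∀ t u, 1 + u ^ 2 / r1 ^ 2 ≤ t → |k t u| ≤ D * t ^ (-γ / 2)) {r : ℝ} (hr : r ∈ Icc r0 r1) :
    |JJ k r| ≤ D * ∫ v : R3, vb v ^ (-γ) := by
  unfold JJ
  rw [← integral_const_mul, ← Real.norm_eq_abs]
  exact norm_integral_le_of_norm_le ((vb_int hγ).const_mul D)
    (Eventually.of_forall fun v => k_bd_v hr0 hD hb hr v)

lemma JJ_eq (hγ : 3 < γ) (hr0 : 0 < r0) (hD : 0 ≤ D) (hk : Continuous (Function.uncurry k))
    (hb : ∀ t u, 1 + u ^ 2 / r1 ^ 2 ≤ t → |k t u| ≤ D * t ^ (-γ / 2)) {r : ℝ} (hr : r ∈ Icc r0 r1) :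
    Integrable (fun u => QQ k (1 + u ^ 2 / r ^ 2) u) ∧
    JJ k r = π / r * ∫ u, QQ k (1 + u ^ 2 / r ^ 2) u := by
  have hr' : 0 < r := hr0.trans_le hr.1
  have h1 := k_int_v hγ hr0 hD hk hb hr
  have h2 : Integrable (fun p : ℝ × ℂ => k (1 + (p.1 ^ 2 + ‖p.2‖ ^ 2)) (r * p.1))
      (volume.prod volume) := by
    have := (cyl_mp.integrable_comp_emb cyl.measurableEmbedding).2 h1
    simp only [Function.comp_def, cyl_nsq, cyl_zero] at this
    exact this
  have h3 : JJ k r = ∫ u : ℝ, ∫ y : ℂ, k (1 + (u ^ 2 + ‖y‖ ^ 2)) (r * u) := by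
    have e := integral_prod _ h2
    rw [← e]
    have := cyl_mp.integral_comp' (fun v : R3 => k (1 + nsq v) (r * v 0))
    rw [JJ, ← this]
    simp only [cyl_nsq, cyl_zero]
    rfl
  have h4 : ∀ u : ℝ, ∫ y : ℂ, k (1 + (u ^ 2 + ‖y‖ ^ 2)) (r * u) = π * QQ k (1 + u ^ 2) (r * u) := by
    intro u
    have := inner_int (fun t => k t (r * u)) (1 + u ^ 2)
    simp only [add_assoc] at this ⊢
    exact this
  have h5 := h2.integral_prod_left
  simp only [h4] at h5 h3
  have h6 : Integrable fun u => QQ k (1 + u ^ 2) (r * u) := by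
    have := h5.const_mul π⁻¹
    refine this.congr (Eventually.of_forall fun u => ?_)
    simp only
    rw [inv_mul_cancel_left₀ Real.pi_ne_zero]
  have h7 : (fun u => QQ k (1 + u ^ 2 / r ^ 2) u) = fun u =>
      (fun x => QQ k (1 + x ^ 2) (r * x)) (r⁻¹ * u) := by
    funext u
    simp only
    rw [mul_inv_cancel_left₀ hr'.ne', mul_pow, inv_pow, div_eq_inv_mul]
  constructor
  · rw [h7]
    exact h6.comp_mul_left' (inv_ne_zero hr'.ne')
  · rw [h7, Measure.integral_comp_mul_left (fun x => QQ k (1 + x ^ 2) (r * x)), h3, integral_const_mul,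
      inv_inv, abs_of_pos hr', smul_eq_mul, ← mul_assoc, div_mul_cancel₀ _ hr'.ne']

lemma QQ_lip (hγ : 3 < γ) (hD : 0 ≤ D) (hk : Continuous (Function.uncurry k))
    (hb : ∀ t u, 1 + u ^ 2 / r1 ^ 2 ≤ t → |k t u| ≤ D * t ^ (-γ / 2)) {s s' u : ℝ}
    (hs : 1 + u ^ 2 / r1 ^ 2 ≤ s) (hss : s ≤ s') :
    |QQ k s u - QQ k s' u| ≤ D * (1 + u ^ 2 / r1 ^ 2) ^ (-γ / 2) * |s - s'| := by
  have h0 : (0 : ℝ) < 1 + u ^ 2 / r1 ^ 2 := by positivity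
  have hkt : Continuous fun t => k t u := hk.comp (by fun_prop : Continuous fun t : ℝ => (t, u))
  have hi : IntegrableOn (fun t => k t u) (Ioi s) := by
    have := (integrableOn_Ioi_rpow_of_lt (a := -γ / 2) (by linarith) (h0.trans_le hs)).const_mul D
    refine this.mono' hkt.aestronglyMeasurable ?_
    refine (ae_restrict_iff' measurableSet_Ioi).2 (Eventually.of_forall fun t ht => ?_)
    exact hb _ _ (hs.trans (mem_Ioi.1 ht).le)
  unfold QQ
  rw [intervalIntegral.integral_Ioi_sub_Ioi hi hss, abs_sub_comm s s', ← Real.norm_eq_abs]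
  apply intervalIntegral.norm_integral_le_of_norm_le_const
  intro t ht
  rw [uIoc_of_le hss] at ht
  refine (hb _ _ (hs.trans ht.1.le)).trans ?_
  have : t ^ (-γ / 2) ≤ (1 + u ^ 2 / r1 ^ 2) ^ (-γ / 2) :=
    Real.rpow_le_rpow_of_nonpos h0 (hs.trans ht.1.le) (by linarith)
  gcongr

lemma w1_int (hγ : 3 < γ) (hr1 : 0 < r1) :
    Integrable fun u : ℝ => (1 + u ^ 2 / r1 ^ 2) ^ (-γ / 2) * u ^ 2 := by
  have h1 : Integrable fun x : ℝ => (2 : ℝ) ^ γ * (1 + ‖x‖) ^ (-(γ - 2)) :=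
    (integrable_one_add_norm (by simp; linarith)).const_mul _
  have h2 : Integrable fun x : ℝ => (1 + x ^ 2) ^ (-γ / 2) * x ^ 2 := by
    refine h1.mono' ?_ ?_
    · refine Continuous.aestronglyMeasurable ?_
      apply Continuous.mul _ (by fun_prop)
      apply Continuous.rpow_const (by fun_prop)
      intro x; left; positivity
    · refine Eventually.of_forall fun x => ?_
      rw [Real.norm_of_nonneg (by positivity)]
      have a1 : ((1 + ‖x‖) ^ 2 / 4) ≤ 1 + x ^ 2 := by
        rw [Real.norm_eq_abs]
        nlinarith [sq_nonneg (|x| - 1), sq_abs x]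
      have a2 : (1 + x ^ 2) ^ (-γ / 2) ≤ ((1 + ‖x‖) ^ 2 / 4) ^ (-γ / 2) :=
        Real.rpow_le_rpow_of_nonpos (by positivity) a1 (by linarith)
      have a3 : ((1 + ‖x‖) ^ 2 / 4) ^ (-γ / 2) = 2 ^ γ * (1 + ‖x‖) ^ (-γ) := by
        have : (1 + ‖x‖) ^ 2 / 4 = ((1 + ‖x‖) / 2) ^ (2 : ℝ) := by
          rw [Real.rpow_ofNat]; ring
        rw [this, ← Real.rpow_mul (by positivity), Real.div_rpow (by positivity) (by norm_num),
          show 2 * (-γ / 2) = -γ by ring, Real.rpow_neg (by norm_num : (0 : ℝ) ≤ 2)]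
        field_simp
      have a4 : (1 + ‖x‖) ^ (-(γ - 2)) = (1 + ‖x‖) ^ (-γ) * (1 + ‖x‖) ^ 2 := by
        rw [← Real.rpow_natCast, ← Real.rpow_add (by positivity)]; congr 1; push_cast; ring
      rw [a4, ← mul_assoc, ← a3]
      have a5 : x ^ 2 ≤ (1 + ‖x‖) ^ 2 := by
        rw [← sq_abs, ← Real.norm_eq_abs]; gcongr; linarith
      gcongr
  have h3 := (h2.comp_mul_left' (R := r1⁻¹) (inv_ne_zero hr1.ne')).const_mul (r1 ^ 2)
  refine h3.congr (Eventually.of_forall fun u => ?_)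
  simp only
  rw [mul_pow, inv_pow]
  field_simp

lemma JJ_lip (hγ : 3 < γ) (hr0 : 0 < r0) (h01 : r0 ≤ r1) : ∃ K : ℝ, 0 ≤ K ∧
    ∀ (k : ℝ → ℝ → ℝ) (D : ℝ), 0 ≤ D → Continuous (Function.uncurry k) →
    (∀ t u, 1 + u ^ 2 / r1 ^ 2 ≤ t → |k t u| ≤ D * t ^ (-γ / 2)) →
    ∀ r ∈ Icc r0 r1, ∀ r' ∈ Icc r0 r1, |JJ k r - JJ k r'| ≤ K * D * |r - r'| := by
  have hr1 : 0 < r1 := hr0.trans_le h01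
  set I1 : ℝ := ∫ u : ℝ, (1 + u ^ 2 / r1 ^ 2) ^ (-γ / 2) * u ^ 2 with hI1
  have hI1' : 0 ≤ I1 := integral_nonneg fun u => by positivity
  set I0 : ℝ := ∫ v : R3, vb v ^ (-γ) with hI0
  have hI0' : 0 ≤ I0 := integral_nonneg fun v => by have := vb_ge v; positivity
  refine ⟨π / r0 * (2 * r1 / r0 ^ 4 * I1) + I0 / r0, by positivity, ?_⟩
  intro k D hD hk hb
  have key : ∀ r ∈ Icc r0 r1, ∀ r' ∈ Icc r0 r1, r' ≤ r → |JJ k r - JJ k r'| ≤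
      (π / r0 * (2 * r1 / r0 ^ 4 * I1) + I0 / r0) * D * |r - r'| := by
    intro r hr r' hr' hle
    have hrp : 0 < r := hr0.trans_le hr.1
    have hrp' : 0 < r' := hr0.trans_le hr'.1
    obtain ⟨i1, e1⟩ := JJ_eq hγ hr0 hD hk hb hr
    obtain ⟨i2, e2⟩ := JJ_eq hγ hr0 hD hk hb hr'
    have e3 := JJ_bound hγ hr0 hD hb hr'
    set N := ∫ u, QQ k (1 + u ^ 2 / r ^ 2) u
    set N' := ∫ u, QQ k (1 + u ^ 2 / r' ^ 2) u
    have hN : |N - N'| ≤ D * |1 / r ^ 2 - 1 / r' ^ 2| * I1 := by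
      rw [← integral_sub i1 i2, hI1, ← integral_const_mul, ← Real.norm_eq_abs]
      refine norm_integral_le_of_norm_le ((w1_int hγ hr1).const_mul _) (Eventually.of_forall fun u => ?_)
      have hs : 1 + u ^ 2 / r1 ^ 2 ≤ 1 + u ^ 2 / r ^ 2 := by
        gcongr; exact hr.2
      have hss : 1 + u ^ 2 / r ^ 2 ≤ 1 + u ^ 2 / r' ^ 2 := by gcongr
      refine (QQ_lip hγ hD hk hb hs hss).trans (le_of_eq ?_)
      have : (1 + u ^ 2 / r ^ 2) - (1 + u ^ 2 / r' ^ 2) = (1 / r ^ 2 - 1 / r' ^ 2) * u ^ 2 := by ring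
      rw [this, abs_mul, abs_of_nonneg (sq_nonneg u)]
      ring
    have hd : |1 / r ^ 2 - 1 / r' ^ 2| ≤ 2 * r1 / r0 ^ 4 * |r - r'| := by
      have : 1 / r ^ 2 - 1 / r' ^ 2 = -((r + r') * (r - r')) / (r ^ 2 * r' ^ 2) := by
        field_simp; ring
      rw [this, abs_div, abs_neg, abs_mul, abs_of_pos (a := r + r') (by positivity),
        abs_of_pos (a := r ^ 2 * r' ^ 2) (by positivity), div_mul_eq_mul_div]
      have hq : r0 ^ 4 ≤ r ^ 2 * r' ^ 2 := by
        calc r0 ^ 4 = r0 ^ 2 * r0 ^ 2 := by ring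
          _ ≤ _ := by
            gcongr
            · exact hr.1
            · exact hr'.1
      gcongr
      linarith [hr.2, hr'.2]
    have hfin : JJ k r - JJ k r' = π / r * (N - N') + (r' - r) / r * JJ k r' := by
      rw [e1, e2]; field_simp; ring
    rw [hfin]
    refine (abs_add_le _ _).trans ?_
    rw [abs_mul, abs_mul, abs_of_pos (a := π / r) (by positivity), abs_div, abs_of_pos hrp,
      abs_sub_comm r' r]
    calc _ ≤ π / r0 * (D * (2 * r1 / r0 ^ 4 * |r - r'|) * I1) + |r - r'| / r0 * (D * I0) := by
          have h := hr.1
          gcongr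
          exact hN.trans (by gcongr)
      _ = _ := by ring
  intro r hr r' hr'
  rcases le_total r' r with h | h
  · exact key r hr r' hr' h
  · rw [abs_sub_comm, abs_sub_comm r r']; exact key r' hr' r hr h

end

/-- Profile hypotheses. -/
def Pro (γ C : ℝ) (μ : ℝ × ℝ → ℝ) : Prop := ContDiff ℝ 1 μ ∧ ∀ e p : ℝ,
  |μ (e, p)| + |d1 μ (e, p)| + |d2 μ (e, p)| ≤ C / (1 + |e| ^ γ)

lemma Pro_nonneg {γ C : ℝ} {μ : ℝ × ℝ → ℝ} (h : Pro γ C μ) : 0 ≤ C := by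
  have h1 := h.2 0 0
  have h2 : 0 ≤ C / (1 + |(0 : ℝ)| ^ γ) := le_trans (by positivity) h1
  by_contra! hc
  have : C / (1 + |(0 : ℝ)| ^ γ) < 0 := div_neg_of_neg_of_pos hc (by positivity)
  linarith

lemma wt {γ s e : ℝ} (hγ : 3 < γ) (hs : 1 ≤ s) (he : s - 1 ≤ e) :
    1 / (1 + |e| ^ γ) ≤ 2 ^ γ * s ^ (-γ) := by
  have hs0 : 0 < s := by linarith
  have he0 : 0 ≤ e := by linarith
  rw [abs_of_nonneg he0]
  have e1 : (2 : ℝ) ^ γ * s ^ (-γ) = 1 / (s / 2) ^ γ := by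
    rw [Real.rpow_neg hs0.le, Real.div_rpow hs0.le (by norm_num)]; field_simp
  rw [e1]
  apply one_div_le_one_div_of_le (by positivity)
  rcases le_total s 2 with h | h
  · have : (s / 2) ^ γ ≤ 1 := Real.rpow_le_one (by positivity) (by linarith) (by linarith)
    have : 0 ≤ e ^ γ := by positivity
    linarith
  · have : (s / 2) ^ γ ≤ e ^ γ := Real.rpow_le_rpow (by positivity) (by linarith) (by linarith)
    linarith

section
variable {γ C : ℝ} {μ : ℝ × ℝ → ℝ}

lemma mu_bd' (hγ : 3 < γ) (h : Pro γ C μ) {s e p : ℝ} (hs : 1 ≤ s) (he : s - 1 ≤ e) :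
    |μ (e, p)| + |d1 μ (e, p)| + |d2 μ (e, p)| ≤ C * 2 ^ γ * s ^ (-γ) := by
  refine (h.2 e p).trans ?_
  rw [div_eq_mul_one_div, mul_assoc]
  exact mul_le_mul_of_nonneg_left (wt hγ hs he) (Pro_nonneg h)

lemma mu_bd (hγ : 3 < γ) (h : Pro γ C μ) {s φ p : ℝ} (hs : 1 ≤ s) (hφ : |φ| ≤ 1) :
    |μ (s + φ, p)| ≤ C * 2 ^ γ * s ^ (-γ) := by
  have := mu_bd' hγ h (p := p) hs (e := s + φ) (by linarith [(abs_le.1 hφ).1])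
  linarith [abs_nonneg (d1 μ (s + φ, p)), abs_nonneg (d2 μ (s + φ, p))]

lemma mu_lip (hγ : 3 < γ) (h : Pro γ C μ) {s φ p φ' p' : ℝ} (hs : 1 ≤ s) (hφ : |φ| ≤ 1)
    (hφ' : |φ'| ≤ 1) :
    |μ (s + φ, p) - μ (s + φ', p')| ≤ C * 2 ^ γ * s ^ (-γ) * (|φ - φ'| + |p - p'|) := by
  have hC := Pro_nonneg h
  have hconv : Convex ℝ {q : ℝ × ℝ | s - 1 ≤ q.1} :=
    convex_halfSpace_ge (LinearMap.fst ℝ ℝ ℝ).isLinear _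
  have key := hconv.norm_image_sub_le_of_norm_fderiv_le (𝕜 := ℝ) (f := μ) (C := C * 2 ^ γ * s ^ (-γ))
    (x := (s + φ', p')) (y := (s + φ, p))
    (fun x _ => (h.1.differentiable one_ne_zero) x) ?_ ?_ ?_
  · rw [Real.norm_eq_abs] at key
    refine key.trans ?_
    gcongr
    rw [Prod.mk_sub_mk, Prod.norm_mk]
    apply max_le
    · rw [add_sub_add_left_eq_sub]
      exact le_add_of_nonneg_right (abs_nonneg _)
    · exact le_add_of_nonneg_left (abs_nonneg _)
  · rintro ⟨e, q⟩ hx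
    simp only [mem_ofPred_eq] at hx
    have hb := mu_bd' hγ h (p := q) hs hx
    refine ContinuousLinearMap.opNorm_le_bound _ (by positivity) fun x => ?_
    have hx : x = x.1 • ((1 : ℝ), (0 : ℝ)) + x.2 • ((0 : ℝ), (1 : ℝ)) := by ext <;> simp
    have e1 : fderiv ℝ μ (e, q) x = x.1 * d1 μ (e, q) + x.2 * d2 μ (e, q) := by
      conv_lhs => rw [hx]
      rw [map_add, map_smul, map_smul]; rfl
    rw [e1]
    have n1 : |x.1| ≤ ‖x‖ := norm_fst_le x
    have n2 : |x.2| ≤ ‖x‖ := norm_snd_le x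
    calc _ ≤ |x.1| * |d1 μ (e, q)| + |x.2| * |d2 μ (e, q)| := by
          rw [← abs_mul, ← abs_mul]; exact abs_add_le _ _
      _ ≤ ‖x‖ * |d1 μ (e, q)| + ‖x‖ * |d2 μ (e, q)| := by gcongr
      _ = (|d1 μ (e, q)| + |d2 μ (e, q)|) * ‖x‖ := by ring
      _ ≤ _ := by
        gcongr
        linarith [abs_nonneg (μ (e, q))]
  · simp only [mem_ofPred_eq]; linarith [(abs_le.1 hφ').1]
  · simp only [mem_ofPred_eq]; linarith [(abs_le.1 hφ).1]

def MJ (j : ℕ) (μ : ℝ × ℝ → ℝ) (r φ B : ℝ) : ℝ :=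
  ∫ v : R3, (v 0 / vb v) ^ j * μ (vb v + φ, r * v 0 + B)

lemma vh_le (v : R3) (j : ℕ) : |(v 0 / vb v) ^ j| ≤ 1 := by
  rw [abs_pow]
  apply pow_le_one₀ (abs_nonneg _)
  rw [abs_div, abs_of_pos (a := vb v) (by linarith [vb_ge v]), div_le_one (by linarith [vb_ge v])]
  exact abs_le_vb v 0

lemma MJ_cont (h : Pro γ C μ) (j : ℕ) (r φ B : ℝ) :
    Continuous fun v : R3 => (v 0 / vb v) ^ j * μ (vb v + φ, r * v 0 + B) := by
  have h1 := vb_cont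
  have h2 := h.1.continuous
  apply Continuous.mul
  · apply Continuous.pow
    apply Continuous.div (by fun_prop) h1
    intro v; linarith [vb_ge v]
  · fun_prop

lemma MJ_int (hγ : 3 < γ) (h : Pro γ C μ) (j : ℕ) (r B : ℝ) {φ : ℝ} (hφ : |φ| ≤ 1) :
    Integrable fun v : R3 => (v 0 / vb v) ^ j * μ (vb v + φ, r * v 0 + B) := by
  refine ((vb_int hγ).const_mul (C * 2 ^ γ)).mono' (MJ_cont h j r φ B).aestronglyMeasurable
    (Eventually.of_forall fun v => ?_)
  rw [norm_mul, Real.norm_eq_abs, Real.norm_eq_abs]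
  calc _ ≤ 1 * |μ (vb v + φ, r * v 0 + B)| := by gcongr; exact vh_le v j
    _ ≤ _ := by rw [one_mul]; exact mu_bd hγ h (vb_ge v) hφ

lemma MJ_bd (hγ : 3 < γ) (h : Pro γ C μ) (j : ℕ) (r B : ℝ) {φ : ℝ} (hφ : |φ| ≤ 1) :
    |MJ j μ r φ B| ≤ C * 2 ^ γ * ∫ v : R3, vb v ^ (-γ) := by
  unfold MJ
  rw [← integral_const_mul, ← Real.norm_eq_abs]
  refine norm_integral_le_of_norm_le ((vb_int hγ).const_mul _) (Eventually.of_forall fun v => ?_)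
  rw [norm_mul, Real.norm_eq_abs, Real.norm_eq_abs]
  calc _ ≤ 1 * |μ (vb v + φ, r * v 0 + B)| := by gcongr; exact vh_le v j
    _ ≤ _ := by rw [one_mul]; exact mu_bd hγ h (vb_ge v) hφ

lemma MJ_lip1 (hγ : 3 < γ) (h : Pro γ C μ) (j : ℕ) (r B B' : ℝ) {φ φ' : ℝ} (hφ : |φ| ≤ 1)
    (hφ' : |φ'| ≤ 1) :
    |MJ j μ r φ B - MJ j μ r φ' B'| ≤
      C * 2 ^ γ * (∫ v : R3, vb v ^ (-γ)) * (|φ - φ'| + |B - B'|) := by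
  unfold MJ
  rw [← integral_sub (MJ_int hγ h j r B hφ) (MJ_int hγ h j r B' hφ'), mul_right_comm,
    ← integral_const_mul, ← Real.norm_eq_abs]
  refine norm_integral_le_of_norm_le ((vb_int hγ).const_mul _) (Eventually.of_forall fun v => ?_)
  rw [← mul_sub, norm_mul, Real.norm_eq_abs, Real.norm_eq_abs]
  have := mu_lip hγ h (s := vb v) (p := r * v 0 + B) (p' := r * v 0 + B') (vb_ge v) hφ hφ'
  rw [add_sub_add_left_eq_sub] at this
  calc _ ≤ 1 * |μ (vb v + φ, r * v 0 + B) - μ (vb v + φ', r * v 0 + B')| := by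
        gcongr; exact vh_le v j
    _ ≤ _ := by rw [one_mul]; refine this.trans (le_of_eq ?_); ring

/-- The kernel in the variables `t = ⟨v⟩²`, `u = r v₀`. -/
def kk (j : ℕ) (μ : ℝ × ℝ → ℝ) (φ B t u : ℝ) : ℝ :=
  (u / √(max t 1)) ^ j * μ (√(max t 1) + φ, u + B)

lemma kk_cont (h : Pro γ C μ) (j : ℕ) (φ B : ℝ) : Continuous (Function.uncurry (kk j μ φ B)) := by
  have h2 := h.1.continuous
  unfold Function.uncurry kk
  apply Continuous.mul
  · apply Continuous.pow
    apply Continuous.div (by fun_prop) (by fun_prop)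
    intro v
    positivity
  · fun_prop

lemma kk_bd (hγ : 3 < γ) (h : Pro γ C μ) (j : ℕ) {φ B r1 : ℝ} (hφ : |φ| ≤ 1) (hr1 : 0 < r1)
    (t u : ℝ) (ht : 1 + u ^ 2 / r1 ^ 2 ≤ t) :
    |kk j μ φ B t u| ≤ r1 ^ j * (C * 2 ^ γ) * t ^ (-γ / 2) := by
  have hq : 0 ≤ u ^ 2 / r1 ^ 2 := by positivity
  have ht1 : 1 ≤ t := by linarith
  have hC := Pro_nonneg h
  unfold kk
  rw [max_eq_left ht1, abs_mul, mul_assoc]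
  have hs : 1 ≤ √t := Real.one_le_sqrt.2 ht1
  have h1 : |(u / √t) ^ j| ≤ r1 ^ j := by
    rw [abs_pow]
    gcongr
    rw [abs_div, abs_of_pos (a := √t) (by linarith), div_le_iff₀ (by linarith)]
    apply abs_le_of_sq_le_sq _ (by positivity)
    rw [mul_pow, Real.sq_sqrt (by linarith)]
    have : u ^ 2 / r1 ^ 2 ≤ t := by linarith
    rw [div_le_iff₀ (by positivity)] at this
    linarith
  have h2 : |μ (√t + φ, u + B)| ≤ C * 2 ^ γ * t ^ (-γ / 2) := by
    refine (mu_bd hγ h hs hφ).trans (le_of_eq ?_)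
    rw [Real.sqrt_eq_rpow, ← Real.rpow_mul (by linarith)]
    congr 2; ring
  gcongr

lemma MJ_JJ (j : ℕ) {r φ B : ℝ} (hr : 0 < r) : MJ j μ r φ B = JJ (kk j μ φ B) r / r ^ j := by
  unfold MJ JJ
  rw [← integral_div]
  congr 1
  funext v
  unfold kk
  rw [max_eq_left (by linarith [nsq_nonneg v])]
  change _ = (r * v 0 / vb v) ^ j * μ (vb v + φ, r * v 0 + B) / r ^ j
  have hrj : r ^ j ≠ 0 := pow_ne_zero _ hr.ne'
  rw [mul_div_assoc r, mul_pow r, mul_assoc, mul_div_cancel_left₀ _ hrj]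

end

/-- Joint Lipschitz bound. -/
lemma MJ_lip {γ r0 r1 : ℝ} (hγ : 3 < γ) (hr0 : 0 < r0) (h01 : r0 ≤ r1) : ∃ K : ℝ, 0 ≤ K ∧
    ∀ (μ : ℝ × ℝ → ℝ) (C : ℝ), Pro γ C μ → ∀ j < 2, ∀ r ∈ Icc r0 r1, ∀ r' ∈ Icc r0 r1,
    ∀ φ φ' B B' : ℝ, |φ| ≤ 1 → |φ'| ≤ 1 → |MJ j μ r φ B| ≤ K * C ∧
      |MJ j μ r φ B - MJ j μ r' φ' B'| ≤ K * C * (|r - r'| + |φ - φ'| + |B - B'|) := by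
  obtain ⟨K, hK, hJ⟩ := JJ_lip hγ hr0 h01
  have hr1 : 0 < r1 := hr0.trans_le h01
  set I0 : ℝ := ∫ v : R3, vb v ^ (-γ) with hI0
  have hI0' : 0 ≤ I0 := integral_nonneg fun v => by have := vb_ge v; positivity
  set K2 : ℝ := 2 ^ γ * I0 with hK2
  have hK2' : 0 ≤ K2 := by positivity
  set K3 : ℝ := K * 2 ^ γ + K * r1 * 2 ^ γ / r0 + K2 / r0 with hK3
  have hK3' : 0 ≤ K3 := by positivity
  refine ⟨K2 + K3, by positivity, ?_⟩
  intro μ C h j hj r hr r' hr' φ φ' B B' hφ hφ'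
  have hC := Pro_nonneg h
  have hrp : 0 < r := hr0.trans_le hr.1
  have hrp' : 0 < r' := hr0.trans_le hr'.1
  have b0 := MJ_bd hγ h j r B hφ
  have b0' := MJ_bd hγ h j r' B hφ
  have b1 := MJ_lip1 hγ h j r' B B' hφ hφ'
  have b2 : |MJ j μ r φ B - MJ j μ r' φ B| ≤ K3 * C * |r - r'| := by
    have hjj := hJ (kk j μ φ B) (r1 ^ j * (C * 2 ^ γ)) (by positivity) (kk_cont h j φ B)
      (kk_bd hγ h j hφ hr1) r hr r' hr'
    interval_cases j
    · rw [MJ_JJ 0 hrp, MJ_JJ 0 hrp']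
      simp only [pow_zero, div_one]
      refine hjj.trans ?_
      calc _ = (K * 2 ^ γ) * C * |r - r'| := by ring
        _ ≤ _ := by
          gcongr
          rw [hK3, add_assoc]
          exact le_add_of_nonneg_right (by positivity)
    · have e : MJ 1 μ r φ B - MJ 1 μ r' φ B = (JJ (kk 1 μ φ B) r - JJ (kk 1 μ φ B) r') / r +
          (r' - r) / r * MJ 1 μ r' φ B := by
        rw [MJ_JJ 1 hrp, MJ_JJ 1 hrp']; field_simp; ring
      rw [e]
      refine (abs_add_le _ _).trans ?_
      rw [abs_mul, abs_div, abs_div, abs_of_pos hrp, abs_sub_comm r' r]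
      calc _ ≤ (K * (r1 ^ 1 * (C * 2 ^ γ)) * |r - r'|) / r0 + |r - r'| / r0 * (C * 2 ^ γ * I0) := by
            gcongr
            · exact hr.1
            · exact hr.1
        _ = (K * r1 * 2 ^ γ / r0 + K2 / r0) * C * |r - r'| := by rw [hK2]; ring
        _ ≤ _ := by
          gcongr
          rw [hK3, add_assoc]
          exact le_add_of_nonneg_left (by positivity)
  constructor
  · refine b0.trans ?_
    calc _ = K2 * C := by rw [hK2]; ring
      _ ≤ _ := by gcongr; linarith
  · calc |MJ j μ r φ B - MJ j μ r' φ' B'| ≤ |MJ j μ r φ B - MJ j μ r' φ B| +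
          |MJ j μ r' φ B - MJ j μ r' φ' B'| := abs_sub_le _ _ _
      _ ≤ K3 * C * |r - r'| + K2 * C * (|φ - φ'| + |B - B'|) := by
        refine add_le_add b2 (b1.trans (le_of_eq ?_))
        rw [hK2]; ring
      _ ≤ _ := by
        have h1 : 0 ≤ C * |r - r'| := by positivity
        have h2 : 0 ≤ C * (|φ - φ'| + |B - B'|) := by positivity
        nlinarith

def cl (x : ℝ) : ℝ := max (-1) (min 1 x)
lemma cl_abs (x : ℝ) : |cl x| ≤ 1 := by
  rw [abs_le]; exact ⟨le_max_left _ _, max_le (by norm_num) (min_le_left _ _)⟩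
lemma cl_lip (x y : ℝ) : |cl x - cl y| ≤ |x - y| := by
  unfold cl
  refine (abs_max_sub_max_le_max _ _ _ _).trans ?_
  rw [sub_self, abs_zero]
  refine max_le (abs_nonneg _) ((abs_min_sub_min_le_max _ _ _ _).trans ?_)
  rw [sub_self, abs_zero]
  exact max_le (abs_nonneg _) le_rfl
lemma cl_eq {x : ℝ} (h : |x| ≤ 1) : cl x = x := by
  rw [abs_le] at h
  unfold cl; rw [min_eq_right h.2, max_eq_right h.1]
lemma cl_cont : Continuous cl := by unfold cl; fun_prop

def rr (a : ℝ) (z : CD) : ℝ := a + z.1.re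
lemma rr_mem {a : ℝ} (z : CD) : rr a z ∈ Icc (a - 1) (a + 1) := ⟨re_ge z.2, re_le z.2⟩
lemma rr_cont (a : ℝ) : Continuous (rr a) := by unfold rr; fun_prop
lemma rr_lip (a : ℝ) (z w : CD) : |rr a z - rr a w| ≤ ‖z.1 - w.1‖ := by
  unfold rr; rw [add_sub_add_left_eq_sub, ← Complex.sub_re]; exact Complex.abs_re_le_norm _

/-- Square root of the radius, as an element of `XX`. -/
def sqx (a : ℝ) : XX := BoundedContinuousFunction.mkOfCompact
  ⟨fun z => √(rr a z), by have := rr_cont a; fun_prop⟩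
def isqx (a : ℝ) (ha : 1 < a) : XX := BoundedContinuousFunction.mkOfCompact
  ⟨fun z => (√(rr a z))⁻¹, by
    have := rr_cont a
    apply Continuous.inv₀ (by fun_prop)
    intro z; exact (Real.sqrt_pos.2 (re_pos ha z.2)).ne'⟩
lemma sqx_apply (a : ℝ) (z : CD) : sqx a z = √(rr a z) := rfl
lemma isqx_apply (a : ℝ) (ha : 1 < a) (z : CD) : isqx a ha z = (√(rr a z))⁻¹ := rfl

lemma sqrt_lip {r0 x y : ℝ} (hr0 : 0 < r0) (hx : r0 ≤ x) (hy : r0 ≤ y) :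
    |√x - √y| ≤ (2 * √r0)⁻¹ * |x - y| := by
  have h1 : √r0 ≤ √x := Real.sqrt_le_sqrt hx
  have h2 : √r0 ≤ √y := Real.sqrt_le_sqrt hy
  have h0 : 0 < √r0 := Real.sqrt_pos.2 hr0
  have e : x - y = (√x - √y) * (√x + √y) := by
    have := Real.sq_sqrt (hr0.le.trans hx); have := Real.sq_sqrt (hr0.le.trans hy); nlinarith
  rw [e, abs_mul, abs_of_pos (a := √x + √y) (by linarith), ← div_eq_inv_mul, le_div_iff₀ (by positivity)]
  gcongr
  linarith

lemma Lp_sqx {a : ℝ} (ha : 1 < a) : LpD (sqx a) := by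
  refine ⟨(2 * √(a - 1))⁻¹, by positivity, fun z w => ?_⟩
  rw [sqx_apply, sqx_apply]
  refine (sqrt_lip (by linarith) (rr_mem z).1 (rr_mem w).1).trans ?_
  gcongr
  exact rr_lip a z w

lemma Lp_isqx {a : ℝ} (ha : 1 < a) : LpD (isqx a ha) := by
  obtain ⟨L, hL, h⟩ := Lp_sqx ha
  have h0 : 0 < √(a - 1) := Real.sqrt_pos.2 (by linarith)
  refine ⟨L / (√(a - 1)) ^ 2, by positivity, fun z w => ?_⟩
  rw [isqx_apply, isqx_apply]
  have h1 : √(a - 1) ≤ √(rr a z) := Real.sqrt_le_sqrt (rr_mem z).1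
  have h2 : √(a - 1) ≤ √(rr a w) := Real.sqrt_le_sqrt (rr_mem w).1
  have h3 := h z w
  rw [sqx_apply, sqx_apply, abs_sub_comm] at h3
  have p1 := h0.trans_le h1
  have p2 := h0.trans_le h2
  generalize √(rr a z) = x at *
  generalize √(rr a w) = y at *
  have e : x⁻¹ - y⁻¹ = (y - x) / (x * y) := by field_simp
  rw [e, abs_div, abs_of_pos (a := x * y) (by positivity), div_mul_eq_mul_div]
  have : √(a - 1) ^ 2 ≤ x * y := by rw [sq]; gcongr
  gcongr

lemma isqx_le {a : ℝ} (ha : 1 < a) : ‖isqx a ha‖ ≤ (√(a - 1))⁻¹ := by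
  have h0 : 0 < √(a - 1) := Real.sqrt_pos.2 (by linarith)
  rw [BoundedContinuousFunction.norm_le (by positivity)]
  intro z
  rw [isqx_apply, Real.norm_of_nonneg (by positivity)]
  gcongr
  exact (rr_mem z).1

def FJ (a : ℝ) (j : ℕ) (μ : Bool → ℝ × ℝ → ℝ) (φ B : CD → ℝ) (z : CD) : ℝ :=
  √(rr a z) * (MJ j (μ true) (rr a z) (φ z) (B z) - MJ j (μ false) (rr a z) (- φ z) (- B z))

lemma NN_exists {a γ : ℝ} (ha : 1 < a) (hγ : 3 < γ) : ∃ K : ℝ, 0 ≤ K ∧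
    ∀ (μ : Bool → ℝ × ℝ → ℝ) (C : ℝ), (∀ b, Pro γ C (μ b)) → ∀ j < 2,
    ∃ N : XX → XX → XX, (∀ u w z, N u w z = FJ a j μ (fun z => cl (isqx a ha z * u z))
        (fun z => sqx a z * w z) z) ∧
      (∀ u w, ‖N u w‖ ≤ K * C) ∧
      (∀ u w u' w', ‖N u w - N u' w'‖ ≤ K * C * (‖u - u'‖ + ‖w - w'‖)) ∧
      (∀ u w : XX, LpD u → LpD w → LpD (N u w)) := by
  obtain ⟨K, hK, hM⟩ := MJ_lip hγ (r0 := a - 1) (r1 := a + 1) (by linarith) (by linarith)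
  refine ⟨‖sqx a‖ * (2 * K) * (1 + ‖isqx a ha‖ + ‖sqx a‖), by positivity, ?_⟩
  intro μ C hμ j hj
  have hC := Pro_nonneg (hμ true)
  -- one species
  have sp : ∀ (b : Bool) (φ φ' B B' : ℝ) (z w : CD), |φ| ≤ 1 → |φ'| ≤ 1 →
      |MJ j (μ b) (rr a z) φ B| ≤ K * C ∧
      |MJ j (μ b) (rr a z) φ B - MJ j (μ b) (rr a w) φ' B'| ≤
        K * C * (|rr a z - rr a w| + |φ - φ'| + |B - B'|) := fun b φ φ' B B' z w h h' =>
    hM (μ b) C (hμ b) j hj _ (rr_mem z) _ (rr_mem w) φ φ' B B' h h'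
  let DD : (φ B : ℝ) → CD → ℝ := fun φ B z =>
    MJ j (μ true) (rr a z) φ B - MJ j (μ false) (rr a z) (- φ) (- B)
  have dd : ∀ (φ φ' B B' : ℝ) (z w : CD), |φ| ≤ 1 → |φ'| ≤ 1 →
      |DD φ B z| ≤ 2 * K * C ∧
      |DD φ B z - DD φ' B' w| ≤ 2 * K * C * (|rr a z - rr a w| + |φ - φ'| + |B - B'|) := by
    intro φ φ' B B' z w h h'
    obtain ⟨a1, a2⟩ := sp true φ φ' B B' z w h h'
    obtain ⟨b1, b2⟩ := sp false (-φ) (-φ') (-B) (-B') z w (by rwa [abs_neg]) (by rwa [abs_neg])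
    have n1 : |-φ - -φ'| = |φ - φ'| := by rw [← abs_neg]; congr 1; ring
    have n2 : |-B - -B'| = |B - B'| := by rw [← abs_neg]; congr 1; ring
    rw [n1, n2] at b2
    constructor
    · refine (abs_sub _ _).trans ?_; linarith
    · have e : DD φ B z - DD φ' B' w = (MJ j (μ true) (rr a z) φ B - MJ j (μ true) (rr a w) φ' B') -
        (MJ j (μ false) (rr a z) (-φ) (-B) - MJ j (μ false) (rr a w) (-φ') (-B')) := by
        simp only [DD]; ring
      rw [e]
      refine (abs_sub _ _).trans ?_
      linarith
  have ddc : ∀ φ B : CD → ℝ, Continuous φ → Continuous B → Continuous fun z => DD (cl (φ z)) (B z) z := by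
    intro φ B hφ hB
    rw [continuous_iff_continuousAt]
    intro z0
    rw [ContinuousAt, tendsto_iff_dist_tendsto_zero]
    refine squeeze_zero (fun _ => dist_nonneg) (fun z => (dd (cl (φ z)) (cl (φ z0)) (B z) (B z0) z z0
      (cl_abs _) (cl_abs _)).2) ?_
    have : Continuous fun z : CD => 2 * K * C * (|rr a z - rr a z0| + |cl (φ z) - cl (φ z0)| +
      |B z - B z0|) := by
      have := rr_cont a
      have := cl_cont
      fun_prop
    have := this.tendsto z0
    simpa using this
  let DX : XX → XX → XX := fun u w => BoundedContinuousFunction.mkOfCompact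
    ⟨fun z => DD (cl (isqx a ha z * u z)) (sqx a z * w z) z,
      ddc _ _ ((isqx a ha * u).continuous) ((sqx a * w).continuous)⟩
  have DXa : ∀ u w z, DX u w z = DD (cl (isqx a ha z * u z)) (sqx a z * w z) z := fun u w z => rfl
  have dx1 : ∀ u w, ‖DX u w‖ ≤ 2 * K * C := by
    intro u w
    rw [BoundedContinuousFunction.norm_le (by positivity)]
    intro z
    exact (dd _ 0 _ 0 z z (cl_abs _) (by simp)).1
  have dx2 : ∀ u w u' w', ‖DX u w - DX u' w'‖ ≤ 2 * K * C * (‖isqx a ha‖ * ‖u - u'‖ +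
      ‖sqx a‖ * ‖w - w'‖) := by
    intro u w u' w'
    rw [BoundedContinuousFunction.norm_le (by positivity)]
    intro z
    refine ((dd _ _ _ _ z z (cl_abs _) (cl_abs _)).2).trans ?_
    rw [sub_self, abs_zero, zero_add]
    gcongr
    · refine (cl_lip _ _).trans ?_
      rw [← mul_sub, abs_mul]
      gcongr
      · exact (isqx a ha).norm_coe_le_norm z
      · exact (u - u').norm_coe_le_norm z
    · rw [← mul_sub, abs_mul]
      gcongr
      · exact (sqx a).norm_coe_le_norm z
      · exact (w - w').norm_coe_le_norm z
  have dx3 : ∀ u w : XX, LpD u → LpD w → LpD (DX u w) := by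
    intro u w hu hw
    obtain ⟨L1, hL1, h1⟩ := Lp_mul (Lp_isqx ha) hu
    obtain ⟨L2, hL2, h2⟩ := Lp_mul (Lp_sqx ha) hw
    refine ⟨2 * K * C * (1 + L1 + L2), by positivity, fun z y => ?_⟩
    rw [DXa, DXa]
    refine ((dd _ _ _ _ z y (cl_abs _) (cl_abs _)).2).trans ?_
    rw [mul_assoc _ _ ‖z.1 - y.1‖]
    gcongr
    rw [add_mul, add_mul, one_mul]
    refine add_le_add (add_le_add (rr_lip a z y) ?_) ?_
    · exact (cl_lip _ _).trans (h1 z y)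
    · exact h2 z y
  refine ⟨fun u w => sqx a * DX u w, fun u w z => rfl, ?_, ?_, ?_⟩
  · intro u w
    refine (norm_mul_le _ _).trans ?_
    calc _ ≤ ‖sqx a‖ * (2 * K * C) := by gcongr; exact dx1 u w
      _ = ‖sqx a‖ * (2 * K) * 1 * C := by ring
      _ ≤ _ := by gcongr; rw [add_assoc]; exact le_add_of_nonneg_right (by positivity)
  · intro u w u' w'
    have e : sqx a * DX u w - sqx a * DX u' w' = sqx a * (DX u w - DX u' w') := by
      ext z; simp; ring
    simp only
    rw [e]
    refine (norm_mul_le _ _).trans ?_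
    calc _ ≤ ‖sqx a‖ * (2 * K * C * (‖isqx a ha‖ * ‖u - u'‖ + ‖sqx a‖ * ‖w - w'‖)) := by
            gcongr; exact dx2 _ _ _ _
      _ = ‖sqx a‖ * (2 * K) * C * (‖isqx a ha‖ * ‖u - u'‖ + ‖sqx a‖ * ‖w - w'‖) := by ring
      _ ≤ ‖sqx a‖ * (2 * K) * C * ((1 + ‖isqx a ha‖ + ‖sqx a‖) * (‖u - u'‖ + ‖w - w'‖)) := by
        gcongr
        have h1 := norm_nonneg (isqx a ha)
        have h2 := norm_nonneg (sqx a)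
        have h3 := norm_nonneg (u - u')
        have h4 := norm_nonneg (w - w')
        nlinarith [mul_nonneg h1 h4, mul_nonneg h2 h3]
      _ = _ := by ring
  · intro u w hu hw
    exact Lp_mul (Lp_sqx ha) (dx3 u w hu hw)

/-- Solution of the reduced problem on the disk. -/
lemma disk_solution {a γ : ℝ} (ha : 1 < a) (hγ : 3 < γ) : ∃ ε0 : ℝ, 0 < ε0 ∧
    ∀ (μ : Bool → ℝ × ℝ → ℝ) (C : ℝ), (∀ b, Pro γ C (μ b)) → C < ε0 →
    ∃ h g : XX, LpD h ∧ LpD g ∧ (∀ z, |(√(rr a z))⁻¹ * Gop h z| ≤ 1) ∧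
      (∀ z, h z = (1 / 4) / (rr a z) ^ 2 * Gop h z + FJ a 0 μ (fun z => (√(rr a z))⁻¹ * Gop h z)
        (fun z => √(rr a z) * Gop g z) z) ∧
      (∀ z, g z = (- 3 / 4) / (rr a z) ^ 2 * Gop g z + FJ a 1 μ (fun z => (√(rr a z))⁻¹ * Gop h z)
        (fun z => √(rr a z) * Gop g z) z) := by
  obtain ⟨S1, hS1⟩ := solver (c := 1 / 4) ha le_rfl
  obtain ⟨S2, hS2⟩ := solver (c := -3 / 4) ha (by norm_num)
  obtain ⟨K, hK, hN⟩ := NN_exists ha hγ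
  set Q : ℝ := (‖S1‖ + ‖S2‖ + 1) * (K + 1) with hQ
  have hQ0 : 0 < Q := by positivity
  have h0 : 0 < √(a - 1) := Real.sqrt_pos.2 (by linarith)
  refine ⟨min (1 / (4 * Q)) (√(a - 1) / Q), by positivity, ?_⟩
  intro μ C hμ hC
  have hC0 := Pro_nonneg (hμ true)
  obtain ⟨N1, n11, n12, n13, n14⟩ := hN μ C hμ 0 (by norm_num)
  obtain ⟨N2, n21, n22, n23, n24⟩ := hN μ C hμ 1 (by norm_num)
  have hc1 : Q * C < 1 / 4 := by
    have := lt_of_lt_of_le hC (min_le_left _ _)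
    rw [lt_div_iff₀ (by positivity)] at this
    linarith
  have hc2 : Q * C < √(a - 1) := by
    have := lt_of_lt_of_le hC (min_le_right _ _)
    rw [lt_div_iff₀ (by positivity)] at this
    linarith
  have hq1 : ‖S1‖ * (K * C) ≤ Q * C := by
    rw [hQ, ← mul_assoc]
    gcongr
    · linarith [norm_nonneg S2]
    · linarith
  have hq2 : ‖S2‖ * (K * C) ≤ Q * C := by
    rw [hQ, ← mul_assoc]
    gcongr
    · linarith [norm_nonneg S1]
    · linarith
  let T : XX × XX → XX × XX := fun p => (S1 (N1 p.1 p.2), S2 (N2 p.1 p.2))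
  have hT : ContractingWith (1 / 2) T := by
    refine ⟨by rw [← NNReal.coe_lt_coe]; norm_num, LipschitzWith.of_dist_le_mul ?_⟩
    intro p q
    have e0 : ((1 / 2 : ℝ≥0) : ℝ) = 1 / 2 := by norm_num
    rw [dist_eq_norm, dist_eq_norm, e0]
    have m1 : ‖p.1 - q.1‖ ≤ ‖p - q‖ := norm_fst_le (p - q)
    have m2 : ‖p.2 - q.2‖ ≤ ‖p - q‖ := norm_snd_le (p - q)
    have e : T p - T q = (S1 (N1 p.1 p.2 - N1 q.1 q.2), S2 (N2 p.1 p.2 - N2 q.1 q.2)) := by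
      simp only [T, map_sub]; rfl
    rw [e, Prod.norm_mk]
    have m3 : 0 ≤ ‖p - q‖ := norm_nonneg _
    apply max_le
    · refine (S1.le_opNorm _).trans ?_
      calc _ ≤ ‖S1‖ * (K * C * (‖p.1 - q.1‖ + ‖p.2 - q.2‖)) := by gcongr; exact n13 _ _ _ _
        _ = ‖S1‖ * (K * C) * (‖p.1 - q.1‖ + ‖p.2 - q.2‖) := by ring
        _ ≤ 1 / 4 * (‖p - q‖ + ‖p - q‖) := by gcongr; linarith
        _ = _ := by ring
    · refine (S2.le_opNorm _).trans ?_
      calc _ ≤ ‖S2‖ * (K * C * (‖p.1 - q.1‖ + ‖p.2 - q.2‖)) := by gcongr; exact n23 _ _ _ _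
        _ = ‖S2‖ * (K * C) * (‖p.1 - q.1‖ + ‖p.2 - q.2‖) := by ring
        _ ≤ 1 / 4 * (‖p - q‖ + ‖p - q‖) := by gcongr; linarith
        _ = _ := by ring
  have hfix := hT.fixedPoint_isFixedPt
  generalize ContractingWith.fixedPoint T hT = p at hfix
  obtain ⟨u, w⟩ := p
  have hu : S1 (N1 u w) = u := congrArg Prod.fst hfix
  have hw : S2 (N2 u w) = w := congrArg Prod.snd hfix
  have gu : u = Gop (Vx a (1 / 4) ha * u + N1 u w) := by
    have := hS1 (N1 u w); rwa [hu] at this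
  have gw : w = Gop (Vx a (-3 / 4) ha * w + N2 u w) := by
    have := hS2 (N2 u w); rwa [hw] at this
  have lu : LpD u := by rw [gu]; exact Lp_Gop _
  have lw : LpD w := by rw [gw]; exact Lp_Gop _
  have bu : ‖u‖ ≤ √(a - 1) := by
    rw [← hu]
    refine (S1.le_opNorm _).trans ?_
    have : ‖S1‖ * ‖N1 u w‖ ≤ ‖S1‖ * (K * C) := by gcongr; exact n12 u w
    linarith
  have hb1 : ∀ z, |isqx a ha z * u z| ≤ 1 := by
    intro z
    rw [abs_mul]
    have b1 : |isqx a ha z| ≤ (√(a - 1))⁻¹ := ((isqx a ha).norm_coe_le_norm z).trans (isqx_le ha)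
    have b2 : |u z| ≤ √(a - 1) := (u.norm_coe_le_norm z).trans bu
    calc _ ≤ (√(a - 1))⁻¹ * √(a - 1) := by gcongr
      _ = 1 := inv_mul_cancel₀ h0.ne'
  have hcl : (fun z => cl (isqx a ha z * u z)) = fun z => (√(rr a z))⁻¹ * u z := by
    funext z
    rw [cl_eq (hb1 z)]; rfl
  refine ⟨Vx a (1 / 4) ha * u + N1 u w, Vx a (-3 / 4) ha * w + N2 u w,
    Lp_add (Lp_mul (Lp_Vx _ _ ha) lu) (n14 u w lu lw), Lp_add (Lp_mul (Lp_Vx _ _ ha) lw) (n24 u w lu lw),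
    ?_, ?_, ?_⟩
  · intro z
    rw [← gu]
    exact hb1 z
  · intro z
    rw [← gu, ← gw, ← hcl]
    rw [BoundedContinuousFunction.add_apply, n11]
    rfl
  · intro z
    rw [← gu, ← gw, ← hcl]
    rw [BoundedContinuousFunction.add_apply, n21]
    rfl

section HolderCalculus
set_option linter.unusedSectionVars false
variable {E F G H : Type*} [NormedAddCommGroup E] [NormedSpace ℝ E] [NormedAddCommGroup F]
  [NormedSpace ℝ F] [NormedAddCommGroup G] [NormedSpace ℝ G] [NormedAddCommGroup H] [NormedSpace ℝ H]

/-- Hölder continuity with every exponent in `(0,1)`. -/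
def HolA (s : Set E) (f : E → F) : Prop :=
  ∀ α : ℝ, 0 < α → α < 1 → ∃ C : ℝ, 0 ≤ C ∧ ∀ x ∈ s, ∀ y ∈ s, ‖f x - f y‖ ≤ C * ‖x - y‖ ^ α

def C1A (s : Set E) (f : E → F) : Prop :=
  HolA s f ∧ ∃ f' : E → E →L[ℝ] F, (∀ x ∈ s, HasFDerivWithinAt f (f' x) s x) ∧ HolA s f'

def C2A (s : Set E) (f : E → F) : Prop :=
  HolA s f ∧ ∃ f' : E → E →L[ℝ] F, (∀ x ∈ s, HasFDerivWithinAt f (f' x) s x) ∧ C1A s f'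

lemma bdd_dist {s : Set E} (hs : Bornology.IsBounded s) : ∃ D : ℝ, 0 ≤ D ∧ ∀ x ∈ s, ∀ y ∈ s, ‖x - y‖ ≤ D := by
  refine ⟨Metric.diam s, Metric.diam_nonneg, fun x hx y hy => ?_⟩
  rw [← dist_eq_norm]; exact Metric.dist_le_diam_of_mem hs hx hy

lemma HolA.bdd {s : Set E} {f : E → F} (h : HolA s f) (hs : Bornology.IsBounded s) :
    ∃ M : ℝ, 0 ≤ M ∧ ∀ x ∈ s, ‖f x‖ ≤ M := by
  obtain ⟨D, hD, hd⟩ := bdd_dist hs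
  obtain ⟨C, hC, hc⟩ := h (1 / 2) (by norm_num) (by norm_num)
  rcases s.eq_empty_or_nonempty with rfl | ⟨y, hy⟩
  · exact ⟨0, le_rfl, fun x hx => hx.elim⟩
  refine ⟨‖f y‖ + C * D ^ (1 / 2 : ℝ), by positivity, fun x hx => ?_⟩
  have h1 := hc x hx y hy
  have h2 : C * ‖x - y‖ ^ (1 / 2 : ℝ) ≤ C * D ^ (1 / 2 : ℝ) := by
    gcongr; exact hd x hx y hy
  have := norm_add_le (f y) (f x - f y)
  rw [add_sub_cancel] at this
  linarith

lemma HolA_of_lip {s : Set E} {f : E → F} (hs : Bornology.IsBounded s) {L : ℝ}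
    (h : ∀ x ∈ s, ∀ y ∈ s, ‖f x - f y‖ ≤ L * ‖x - y‖) : HolA s f := by
  intro α h0 h1
  obtain ⟨D, hD, hd⟩ := bdd_dist hs
  refine ⟨|L| * D ^ (1 - α), by positivity, fun x hx y hy => ?_⟩
  have e : ‖x - y‖ = ‖x - y‖ ^ (1 - α) * ‖x - y‖ ^ α := by
    rcases (norm_nonneg (x - y)).eq_or_lt with h | h
    · rw [← h, Real.zero_rpow h0.ne', mul_zero]
    · rw [← Real.rpow_add h]; simp
  calc _ ≤ L * ‖x - y‖ := h x hx y hy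
    _ ≤ |L| * ‖x - y‖ := by gcongr; exact le_abs_self _
    _ = |L| * (‖x - y‖ ^ (1 - α) * ‖x - y‖ ^ α) := by rw [← e]
    _ ≤ |L| * (D ^ (1 - α) * ‖x - y‖ ^ α) := by
      gcongr
      exact hd x hx y hy
    _ = _ := by ring

lemma HolA.add {s : Set E} {f g : E → F} (hf : HolA s f) (hg : HolA s g) :
    HolA s (fun x => f x + g x) := by
  intro α h0 h1
  obtain ⟨C, hC, h⟩ := hf α h0 h1
  obtain ⟨D, hD, h'⟩ := hg α h0 h1
  refine ⟨C + D, by positivity, fun x hx y hy => ?_⟩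
  have e : f x + g x - (f y + g y) = (f x - f y) + (g x - g y) := by abel
  rw [e, add_mul]
  exact (norm_add_le _ _).trans (add_le_add (h x hx y hy) (h' x hx y hy))

lemma HolA.bilin {s : Set E} (hs : Bornology.IsBounded s) (B : F →L[ℝ] G →L[ℝ] H) {f : E → F}
    {g : E → G} (hf : HolA s f) (hg : HolA s g) : HolA s (fun x => B (f x) (g x)) := by
  intro α h0 h1
  obtain ⟨M, hM, m⟩ := hf.bdd hs
  obtain ⟨N, hN, n⟩ := hg.bdd hs
  obtain ⟨C, hC, h⟩ := hf α h0 h1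
  obtain ⟨D, hD, h'⟩ := hg α h0 h1
  refine ⟨‖B‖ * C * N + ‖B‖ * M * D, by positivity, fun x hx y hy => ?_⟩
  have e : B (f x) (g x) - B (f y) (g y) = B (f x - f y) (g x) + B (f y) (g x - g y) := by
    simp
  rw [e, add_mul]
  refine (norm_add_le _ _).trans (add_le_add ?_ ?_)
  · calc _ ≤ ‖B‖ * ‖f x - f y‖ * ‖g x‖ := B.le_opNorm₂ _ _
      _ ≤ ‖B‖ * (C * ‖x - y‖ ^ α) * N := by
        gcongr
        · exact h x hx y hy
        · exact n x hx
      _ = _ := by ring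
  · calc _ ≤ ‖B‖ * ‖f y‖ * ‖g x - g y‖ := B.le_opNorm₂ _ _
      _ ≤ ‖B‖ * M * (D * ‖x - y‖ ^ α) := by
        gcongr
        · exact m y hy
        · exact h' x hx y hy
      _ = _ := by ring

lemma HolA.clm {s : Set E} (T : F →L[ℝ] G) {f : E → F} (hf : HolA s f) :
    HolA s (fun x => T (f x)) := by
  intro α h0 h1
  obtain ⟨C, hC, h⟩ := hf α h0 h1
  refine ⟨‖T‖ * C, by positivity, fun x hx y hy => ?_⟩
  rw [← map_sub, mul_assoc]
  exact (T.le_opNorm _).trans (by gcongr; exact h x hx y hy)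

lemma HolA.comp {s : Set E} {t : Set F} {f : F → G} (hf : HolA t f) {q : E → F} (hq : MapsTo q s t)
    {L : ℝ} (hL : ∀ x ∈ s, ∀ y ∈ s, ‖q x - q y‖ ≤ L * ‖x - y‖) : HolA s (fun x => f (q x)) := by
  intro α h0 h1
  obtain ⟨C, hC, h⟩ := hf α h0 h1
  refine ⟨C * |L| ^ α, by positivity, fun x hx y hy => ?_⟩
  calc _ ≤ C * ‖q x - q y‖ ^ α := h _ (hq hx) _ (hq hy)
    _ ≤ C * (|L| * ‖x - y‖) ^ α := by
      gcongr
      refine (hL x hx y hy).trans ?_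
      gcongr; exact le_abs_self _
    _ = _ := by rw [Real.mul_rpow (by positivity) (by positivity)]; ring

lemma C1A.add {s : Set E} {f g : E → F} (hf : C1A s f) (hg : C1A s g) :
    C1A s (fun x => f x + g x) := by
  obtain ⟨h1, f', h2, h3⟩ := hf
  obtain ⟨k1, g', k2, k3⟩ := hg
  exact ⟨h1.add k1, fun x => f' x + g' x, fun x hx => (h2 x hx).add (k2 x hx), h3.add k3⟩

lemma C1A.bilin {s : Set E} (hs : Bornology.IsBounded s) (B : F →L[ℝ] G →L[ℝ] H) {f : E → F}
    {g : E → G} (hf : C1A s f) (hg : C1A s g) : C1A s (fun x => B (f x) (g x)) := by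
  obtain ⟨h1, f', h2, h3⟩ := hf
  obtain ⟨k1, g', k2, k3⟩ := hg
  refine ⟨h1.bilin hs B k1, fun x => B.precompR E (f x) (g' x) + B.precompL E (f' x) (g x),
    fun x hx => B.hasFDerivWithinAt_of_bilinear (h2 x hx) (k2 x hx), ?_⟩
  exact (h1.bilin hs (B.precompR E) k3).add (h3.bilin hs (B.precompL E) k1)

lemma C2A.c1 {s : Set E} {f : E → F} (hf : C2A s f) : C1A s f := by
  obtain ⟨h1, f', h2, h3⟩ := hf
  exact ⟨h1, f', h2, h3.1⟩

lemma C2A.bilin {s : Set E} (hs : Bornology.IsBounded s) (B : F →L[ℝ] G →L[ℝ] H) {f : E → F}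
    {g : E → G} (hf : C2A s f) (hg : C2A s g) : C2A s (fun x => B (f x) (g x)) := by
  have hf1 := hf.c1
  have hg1 := hg.c1
  obtain ⟨h1, f', h2, h3⟩ := hf
  obtain ⟨k1, g', k2, k3⟩ := hg
  refine ⟨h1.bilin hs B k1, fun x => B.precompR E (f x) (g' x) + B.precompL E (f' x) (g x),
    fun x hx => B.hasFDerivWithinAt_of_bilinear (h2 x hx) (k2 x hx), ?_⟩
  exact (hf1.bilin hs (B.precompR E) k3).add (h3.bilin hs (B.precompL E) hg1)

lemma lip_of_smooth {s : Set E} (hs : IsCompact s) {f : E → F} (hf : ∀ x ∈ s, ContDiffAt ℝ 1 f x) :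
    ∃ L : ℝ, ∀ x ∈ s, ∀ y ∈ s, ‖f x - f y‖ ≤ L * ‖x - y‖ := by
  have : LocallyLipschitzOn s f := by
    intro x hx
    obtain ⟨K, t, ht, h⟩ := (hf x hx).exists_lipschitzOnWith
    exact ⟨K, t, mem_nhdsWithin_of_mem_nhds ht, h⟩
  obtain ⟨K, hK⟩ := this.exists_lipschitzOnWith_of_compact hs
  refine ⟨K, fun x hx y hy => ?_⟩
  rw [← dist_eq_norm, ← dist_eq_norm]
  exact hK.dist_le_mul x hx y hy

lemma C2A_of_smooth {s : Set E} (hs : IsCompact s) {f : E → F} (hf : ∀ x ∈ s, ContDiffAt ℝ 3 f x) :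
    C2A s f := by
  have hb := hs.isBounded
  have f1 : ∀ x ∈ s, ContDiffAt ℝ 2 (fderiv ℝ f) x := fun x hx =>
    (hf x hx).fderiv_right (by norm_num)
  have f2 : ∀ x ∈ s, ContDiffAt ℝ 1 (fderiv ℝ (fderiv ℝ f)) x := fun x hx =>
    (f1 x hx).fderiv_right (by norm_num)
  obtain ⟨L0, l0⟩ := lip_of_smooth hs (fun x hx => (hf x hx).of_le (by norm_num))
  obtain ⟨L1, l1⟩ := lip_of_smooth hs (fun x hx => (f1 x hx).of_le (by norm_num))
  obtain ⟨L2, l2⟩ := lip_of_smooth hs f2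
  refine ⟨HolA_of_lip hb l0, fderiv ℝ f, fun x hx => ?_, HolA_of_lip hb l1, fderiv ℝ (fderiv ℝ f),
    fun x hx => ?_, HolA_of_lip hb l2⟩
  · exact ((hf x hx).differentiableAt (by norm_num)).hasFDerivAt.hasFDerivWithinAt
  · exact ((f1 x hx).differentiableAt (by norm_num)).hasFDerivAt.hasFDerivWithinAt

lemma C1A.comp {s : Set E} {t : Set F} {f : F → G} (hf : C1A t f) {q : E → F} (hq : MapsTo q s t)
    (hs : IsCompact s) (h : ∀ x ∈ s, ContDiffAt ℝ 3 q x) : C1A s (fun x => f (q x)) := by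
  obtain ⟨h1, f', h2, h3⟩ := hf
  obtain ⟨L0, l0⟩ := lip_of_smooth hs (fun x hx => (h x hx).of_le (by norm_num))
  obtain ⟨k1, q', k2, k3⟩ := (C2A_of_smooth hs h).c1
  refine ⟨h1.comp hq l0, fun x => ContinuousLinearMap.compL ℝ E F G (f' (q x)) (q' x), fun x hx => ?_, ?_⟩
  · exact (h2 (q x) (hq hx)).comp x (k2 x hx) hq
  · exact (h3.comp hq l0).bilin hs.isBounded _ k3

lemma C2A.comp {s : Set E} {t : Set F} {f : F → G} (hf : C2A t f) {q : E → F} (hq : MapsTo q s t)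
    (hs : IsCompact s) (h : ∀ x ∈ s, ContDiffAt ℝ 3 q x) : C2A s (fun x => f (q x)) := by
  obtain ⟨h1, f', h2, h3⟩ := hf
  obtain ⟨L0, l0⟩ := lip_of_smooth hs (fun x hx => (h x hx).of_le (by norm_num))
  obtain ⟨k1, q', k2, k3⟩ := C2A_of_smooth hs h
  refine ⟨h1.comp hq l0, fun x => ContinuousLinearMap.compL ℝ E F G (f' (q x)) (q' x), fun x hx => ?_, ?_⟩
  · exact (h2 (q x) (hq hx)).comp x (k2 x hx) hq
  · exact (h3.comp hq hs h).bilin hs.isBounded _ k3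

lemma HolA.cont {s : Set E} {f : E → F} (hf : HolA s f) : ContinuousOn f s := by
  obtain ⟨C, hC, h⟩ := hf (1 / 2) (by norm_num) (by norm_num)
  intro y hy
  rw [ContinuousWithinAt, tendsto_iff_norm_sub_tendsto_zero]
  have : Tendsto (fun x => C * ‖x - y‖ ^ (1 / 2 : ℝ)) (nhdsWithin y s) (nhds (C * ‖y - y‖ ^ (1 / 2 : ℝ))) := by
    apply Tendsto.mono_left _ nhdsWithin_le_nhds
    apply ContinuousAt.tendsto
    apply ContinuousAt.mul continuousAt_const
    apply ContinuousAt.rpow_const (by fun_prop) (Or.inr (by norm_num))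
  rw [sub_self, norm_zero, Real.zero_rpow (by norm_num), mul_zero] at this
  refine squeeze_zero' (Eventually.of_forall fun _ => norm_nonneg _) ?_ this
  filter_upwards [self_mem_nhdsWithin] with x hx using h x hx y hy

lemma C2A.final {s : Set E} (hs : UniqueDiffOn ℝ s) {f : E → F} (hf : C2A s f) :
    ContDiffOn ℝ 2 f s ∧ ∀ α : ℝ, 0 < α → α < 1 → ∃ C : ℝ≥0,
      HolderOnWith C α.toNNReal (iteratedFDerivWithin ℝ 2 f s) s := by
  obtain ⟨h1, f', h2, h3, f'', h4, h5⟩ := hf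
  have e1 : ∀ x ∈ s, fderivWithin ℝ f s x = f' x := fun x hx => (h2 x hx).fderivWithin (hs x hx)
  have h4' : ∀ x ∈ s, HasFDerivWithinAt (fderivWithin ℝ f s) (f'' x) s x := fun x hx =>
    (h4 x hx).congr e1 (e1 x hx)
  have e2 : ∀ x ∈ s, fderivWithin ℝ (fderivWithin ℝ f s) s x = f'' x := fun x hx =>
    (h4' x hx).fderivWithin (hs x hx)
  constructor
  · have c1 : ContDiffOn ℝ (0 + 1) (fderivWithin ℝ f s) s := by
      apply contDiffOn_succ_of_fderivWithin
      · exact fun x hx => (h4' x hx).differentiableWithinAt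
      · intro h; simp at h
      · rw [contDiffOn_zero]
        exact h5.cont.congr e2
    have c2 : ContDiffOn ℝ (1 + 1) f s := by
      apply contDiffOn_succ_of_fderivWithin
      · exact fun x hx => (h2 x hx).differentiableWithinAt
      · intro h; simp at h
      · rw [zero_add] at c1; exact c1
    rw [one_add_one_eq_two] at c2
    exact c2
  · intro α h0 h1
    obtain ⟨C, hC, k⟩ := h5 α h0 h1
    refine ⟨C.toNNReal, ?_⟩
    intro x hx y hy
    have hb : dist (iteratedFDerivWithin ℝ 2 f s x) (iteratedFDerivWithin ℝ 2 f s y) ≤ C * dist x y ^ α := by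
      rw [dist_eq_norm, dist_eq_norm]
      refine (ContinuousMultilinearMap.opNorm_le_bound (M := C * ‖x - y‖ ^ α) (by positivity) ?_)
      intro m
      rw [sub_apply, iteratedFDerivWithin_two_apply f hs hx,
        iteratedFDerivWithin_two_apply f hs hy, e2 x hx, e2 y hy]
      have : f'' x (m 0) (m 1) - f'' y (m 0) (m 1) = (f'' x - f'' y) (m 0) (m 1) := by simp
      rw [this, Fin.prod_univ_two, ← mul_assoc]
      refine ((f'' x - f'' y).le_opNorm₂ _ _).trans ?_
      gcongr
      exact k x hx y hy
    rw [edist_dist, edist_dist, Real.coe_toNNReal α h0.le,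
      ENNReal.ofReal_rpow_of_nonneg dist_nonneg h0.le]
    have : ((C.toNNReal : ℝ≥0) : ℝ≥0∞) = ENNReal.ofReal C := rfl
    rw [this, ← ENNReal.ofReal_mul hC]
    exact ENNReal.ofReal_le_ofReal hb

end HolderCalculus

lemma rad_cont : Continuous rad := by unfold rad; fun_prop

lemma torus_eq (a : ℝ) : torus a = {x | (rad x - a) ^ 2 + (x 2) ^ 2 < 1} := by
  ext x
  simp only [torus, rad, mem_ofPred_eq]
  rw [sub_sq_comm]

lemma torus_open (a : ℝ) : IsOpen (torus a) := by
  rw [torus_eq]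
  have := rad_cont
  exact isOpen_lt (by fun_prop) continuous_const

lemma torus_clos (a : ℝ) : closure (torus a) ⊆ {x | (rad x - a) ^ 2 + (x 2) ^ 2 ≤ 1} := by
  rw [torus_eq]
  have := rad_cont
  apply closure_minimal
  · intro x hx
    simp only [mem_ofPred_eq] at hx ⊢
    exact hx.le
  · exact isClosed_le (by fun_prop) continuous_const

lemma torus_front {a : ℝ} {x : R3} (hx : x ∈ frontier (torus a)) : (rad x - a) ^ 2 + (x 2) ^ 2 = 1 := by
  rw [(torus_open a).frontier_eq] at hx
  have h1 := torus_clos a hx.1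
  have h2 := hx.2
  rw [torus_eq] at h2
  simp only [mem_ofPred_eq, not_lt] at h1 h2
  exact le_antisymm h1 h2

def qm (a : ℝ) (x : R3) : ℂ := ((rad x - a : ℝ) : ℂ) + ((x 2 : ℝ) : ℂ) * Complex.I
lemma qm_re (a : ℝ) (x : R3) : (qm a x).re = rad x - a := by simp [qm]
lemma qm_im (a : ℝ) (x : R3) : (qm a x).im = x 2 := by simp [qm]
lemma qm_norm (a : ℝ) (x : R3) : ‖qm a x‖ ^ 2 = (rad x - a) ^ 2 + (x 2) ^ 2 := by
  rw [← Complex.normSq_eq_norm_sq, Complex.normSq_apply, qm_re, qm_im]; ring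

lemma qm_UD {a : ℝ} {x : R3} (hx : x ∈ torus a) : qm a x ∈ UD := by
  rw [torus_eq] at hx
  rw [Metric.mem_ball, dist_zero_right, ← sq_lt_one_iff₀ (norm_nonneg _), qm_norm]
  exact hx
lemma qm_CD' {a : ℝ} {x : R3} (hx : (rad x - a) ^ 2 + (x 2) ^ 2 ≤ 1) : qm a x ∈ CD := by
  rw [Metric.mem_closedBall, dist_zero_right, ← sq_le_one_iff₀ (norm_nonneg _), qm_norm]
  exact hx
lemma qm_CD {a : ℝ} {x : R3} (hx : x ∈ closure (torus a)) : qm a x ∈ CD := qm_CD' (torus_clos a hx)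

lemma rad_pos' {a : ℝ} (ha : 1 < a) {x : R3} (hx : (rad x - a) ^ 2 + (x 2) ^ 2 ≤ 1) : 0 < rad x := by
  have := re_pos ha (qm_CD' hx)
  rw [qm_re] at this; linarith
lemma rad_pos {a : ℝ} (ha : 1 < a) {x : R3} (hx : x ∈ closure (torus a)) : 0 < rad x :=
  rad_pos' ha (torus_clos a hx)

lemma rad_sq (x : R3) : rad x ^ 2 = x 0 ^ 2 + x 1 ^ 2 := Real.sq_sqrt (by positivity)

lemma torus_ball (a : ℝ) {c y : R3} (hc : rad c = a) (hc2 : c 2 = 0) (ha : 0 < a)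
    (hy : (y 0 - c 0) ^ 2 + (y 1 - c 1) ^ 2 + (y 2) ^ 2 < 1) : y ∈ torus a := by
  rw [torus_eq]
  show (rad y - a) ^ 2 + y 2 ^ 2 < 1
  have h1 := rad_sq y
  have h2 := rad_sq c
  rw [hc] at h2
  have h3 : 0 ≤ rad y := Real.sqrt_nonneg _
  have h4 : y 0 * c 0 + y 1 * c 1 ≤ rad y * a := by
    refine le_of_abs_le (abs_le_of_sq_le_sq ?_ (by positivity))
    rw [mul_pow, h1, h2]
    nlinarith [sq_nonneg (y 0 * c 1 - y 1 * c 0)]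
  nlinarith

lemma torus_ud {a : ℝ} (ha : 1 < a) : UniqueDiffOn ℝ (closure (torus a)) := by
  intro x hx
  have hx' := torus_clos a hx
  simp only [mem_ofPred_eq] at hx'
  have hr := rad_pos ha hx
  set c : R3 := ![a * x 0 / rad x, a * x 1 / rad x, 0] with hc
  have c0 : c 0 = a * x 0 / rad x := rfl
  have c1 : c 1 = a * x 1 / rad x := rfl
  have c2 : c 2 = 0 := rfl
  have hs := rad_sq x
  have hcr : rad c = a := by
    have : c 0 ^ 2 + c 1 ^ 2 = a ^ 2 := by
      rw [c0, c1]; field_simp; rw [hs]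
    rw [rad, this, Real.sqrt_sq (by linarith)]
  let B : Set R3 := {y | (y 0 - c 0) ^ 2 + (y 1 - c 1) ^ 2 + (y 2) ^ 2 < 1}
  have hB : B ⊆ closure (torus a) := fun y hy => subset_closure (torus_ball a hcr c2 (by linarith) hy)
  have oB : IsOpen B := isOpen_lt (by fun_prop) continuous_const
  have hcv : Convex ℝ B := by
    intro y hy w hw α β hα hβ hab
    simp only [B, mem_ofPred_eq, Pi.add_apply, Pi.smul_apply, smul_eq_mul] at hy hw ⊢
    have key : ∀ p q k : ℝ, (α * p + β * q - k) ^ 2 ≤ α * (p - k) ^ 2 + β * (q - k) ^ 2 := by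
      intro p q k
      have : β = 1 - α := by linarith
      subst this
      nlinarith [mul_nonneg (mul_nonneg hα hβ) (sq_nonneg (p - q))]
    have k0 := key (y 0) (w 0) (c 0)
    have k1 := key (y 1) (w 1) (c 1)
    have k2 := key (y 2) (w 2) 0
    simp only [sub_zero] at k2
    rcases hα.eq_or_lt with h | h
    · have : β = 1 := by linarith
      subst this; subst h; linarith
    · nlinarith
  have dx : (x 0 - c 0) ^ 2 + (x 1 - c 1) ^ 2 + (x 2) ^ 2 ≤ 1 := by
    have : (x 0 - c 0) ^ 2 + (x 1 - c 1) ^ 2 = (rad x - a) ^ 2 := by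
      rw [c0, c1]
      have e1 : x 0 - a * x 0 / rad x = (rad x - a) * x 0 / rad x := by field_simp
      have e2 : x 1 - a * x 1 / rad x = (rad x - a) * x 1 / rad x := by field_simp
      rw [e1, e2, div_pow, div_pow, ← add_div, div_eq_iff (by positivity), hs]; ring
    rw [this]; exact hx'
  have hxB : x ∈ closure B := by
    have ht : Tendsto (fun t : ℝ => c + t • (x - c)) (nhdsWithin 1 (Iio 1)) (nhds x) := by
      have : Continuous fun t : ℝ => c + t • (x - c) := by fun_prop
      have := (this.tendsto 1).mono_left (nhdsWithin_le_nhds (s := Iio 1))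
      simpa using this
    apply mem_closure_of_tendsto ht
    filter_upwards [Ioo_mem_nhdsLT (show (0 : ℝ) < 1 by norm_num)] with t ht
    simp only [B, mem_ofPred_eq, Pi.add_apply, Pi.smul_apply, smul_eq_mul, Pi.sub_apply, c2]
    have : (c 0 + t * (x 0 - c 0) - c 0) ^ 2 + (c 1 + t * (x 1 - c 1) - c 1) ^ 2 + (0 + t * (x 2 - 0)) ^ 2
      = t ^ 2 * ((x 0 - c 0) ^ 2 + (x 1 - c 1) ^ 2 + (x 2) ^ 2) := by ring
    rw [this]
    have t2 : t ^ 2 < 1 := by nlinarith [ht.1, ht.2]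
    have t3 : 0 ≤ t ^ 2 := sq_nonneg t
    nlinarith
  have hn : (interior B).Nonempty := by
    rw [oB.interior_eq]
    refine ⟨c, ?_⟩
    simp [B, c2]
  exact (uniqueDiffWithinAt_convex hcv hn hxB).mono hB

lemma torus_compact (a : ℝ) : IsCompact (closure (torus a)) := by
  have hb : Bornology.IsBounded (torus a) := by
    rw [isBounded_iff_forall_norm_le]
    refine ⟨|a| + 1, fun x hx => ?_⟩
    rw [torus_eq] at hx
    simp only [mem_ofPred_eq] at hx
    have hs := rad_sq x
    have h0 : 0 ≤ rad x := Real.sqrt_nonneg _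
    have hr : rad x ≤ |a| + 1 := by
      have : |rad x - a| ≤ 1 := by rw [← sq_le_one_iff_abs_le_one]; nlinarith [sq_nonneg (x 2)]
      have := (abs_le.1 this).2
      linarith [le_abs_self a]
    rw [pi_norm_le_iff_of_nonneg (by positivity)]
    intro i
    rw [Real.norm_eq_abs]
    fin_cases i
    · exact (abs_le_of_sq_le_sq (by nlinarith [sq_nonneg (x 1)]) h0 : |x 0| ≤ rad x).trans hr
    · exact (abs_le_of_sq_le_sq (by nlinarith [sq_nonneg (x 0)]) h0 : |x 1| ≤ rad x).trans hr
    · show |x 2| ≤ _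
      have : |x 2| ≤ 1 := by rw [← sq_le_one_iff_abs_le_one]; nlinarith [sq_nonneg (rad x - a)]
      linarith [abs_nonneg a]
  exact hb.isCompact_closure

lemma rad_smooth {x : R3} (hx : 0 < rad x) : ContDiffAt ℝ 3 rad x := by
  have h : x 0 ^ 2 + x 1 ^ 2 ≠ 0 := by rw [← rad_sq]; positivity
  unfold rad
  exact ContDiffAt.sqrt (f := fun x : R3 => x 0 ^ 2 + x 1 ^ 2) (by fun_prop) h

lemma qm_smooth (a : ℝ) {x : R3} (hx : 0 < rad x) : ContDiffAt ℝ 3 (qm a) x := by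
  have h1 := rad_smooth hx
  unfold qm
  apply ContDiffAt.add
  · exact Complex.ofRealCLM.contDiff.contDiffAt.comp x (h1.sub contDiffAt_const)
  · apply ContDiffAt.mul _ contDiffAt_const
    exact Complex.ofRealCLM.contDiff.contDiffAt.comp x (by fun_prop : ContDiffAt ℝ 3 (fun y : R3 => y 2) x)


lemma dG_C1A {s : Set ℂ} {D : ℂ → ℂ} (h : C1A s D) : C1A s (fun z => dG (D z)) := by
  obtain ⟨h1, D', h2, h3⟩ := h
  let T : ℂ →L[ℝ] ℂ →L[ℝ] ℝ :=
    (ContinuousLinearMap.compL ℝ ℂ ℂ ℝ Complex.reCLM).comp (ContinuousLinearMap.mul ℝ ℂ)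
  have hT : ∀ z, dG (D z) = T (D z) := fun z => rfl
  simp only [hT]
  refine ⟨h1.clm T, fun z => ContinuousLinearMap.compL ℝ ℂ ℂ _ T (D' z), fun z hz => ?_, h3.clm _⟩
  exact T.hasFDerivAt.comp_hasFDerivWithinAt z (h2 z hz)

lemma GF_C2A {f : ℂ → ℝ} (hf : Continuous f) {M L : ℝ} (hM : ∀ w, |f w| ≤ M)
    (hL : ∀ z ∈ CD, ∀ w ∈ CD, |f w - f z| ≤ L * ‖z - w‖) : C2A CD (GF f) := by
  have hb : Bornology.IsBounded CD := Metric.isBounded_closedBall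
  have hLF : HolA CD (LF f) := fun α h0 h1 => LF_holder hf hM hL h0 h1
  have hf1 : HolA CD f := HolA_of_lip hb (L := L) (fun x hx y hy => by
    rw [Real.norm_eq_abs, norm_sub_rev]; exact hL y hy x hx)
  have hdD : HolA CD (fun z => dD (LF f z) (f z)) := by
    let T : ℝ →L[ℝ] (ℂ →L[ℝ] ℂ) := ContinuousLinearMap.toSpanSingleton ℝ
      ((-1 / 2 : ℝ) • (Complex.conjCLE : ℂ →L[ℝ] ℂ))
    have := (hLF.clm (ContinuousLinearMap.mul ℝ ℂ)).add (hf1.clm T)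
    convert this using 2 with z
    unfold dD
    rw [sub_eq_add_neg]
    congr 1
    ext h
    simp [T]
    ring
  have hD : ∀ z ∈ CD, HasFDerivWithinAt (DF f) (dD (LF f z) (f z)) CD z := fun z hz =>
    DF_fd hf hM hL hz
  obtain ⟨K, hK, hk⟩ := hdD.bdd hb
  have hDF : HolA CD (DF f) := HolA_of_lip hb (L := K) (fun x hx y hy =>
    (convex_closedBall (0 : ℂ) 1).norm_image_sub_le_of_norm_hasFDerivWithin_le hD hk hy hx)
  obtain ⟨C, hC, hc⟩ := GF_lip
  refine ⟨HolA_of_lip hb (L := C * M) (fun x hx y hy => hc f M hf hM x hx y hy),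
    fun z => dG (DF f z), fun z hz => GF_fd hf hM hz, dG_C1A ⟨hDF, _, hD, hdD⟩⟩

/-- The three-dimensional potential built from the disk potential. -/
def Phi (a : ℝ) (f : ℂ → ℝ) (x : R3) : ℝ := (√(rad x))⁻¹ * GF f (qm a x)

def GG (a : ℝ) (f : ℂ → ℝ) (z : ℂ) : ℝ := (√(a + z.re))⁻¹ * GF f z

lemma Phi_eq (a : ℝ) (f : ℂ → ℝ) : Phi a f = fun x => GG a f (qm a x) := by
  funext x; simp [Phi, GG, qm_re]

lemma Phi_C2A {a : ℝ} (ha : 1 < a) {f : ℂ → ℝ} (hf : Continuous f) {M L : ℝ} (hM : ∀ w, |f w| ≤ M)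
    (hL : ∀ z ∈ CD, ∀ w ∈ CD, |f w - f z| ≤ L * ‖z - w‖) : C2A (closure (torus a)) (Phi a f) := by
  have hb : Bornology.IsBounded CD := Metric.isBounded_closedBall
  have h1 : C2A CD (fun z : ℂ => (√(a + z.re))⁻¹) := by
    apply C2A_of_smooth (isCompact_closedBall _ _)
    intro z hz
    have hp := re_pos ha hz
    apply ContDiffAt.inv
    · refine ContDiffAt.sqrt (f := fun z : ℂ => a + z.re) ?_ hp.ne'
      exact contDiffAt_const.add Complex.reCLM.contDiff.contDiffAt
    · exact (Real.sqrt_pos.2 hp).ne'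
  have h2 : C2A CD (GG a f) := h1.bilin hb (ContinuousLinearMap.mul ℝ ℝ) (GF_C2A hf hM hL)
  rw [Phi_eq]
  exact h2.comp (fun x hx => qm_CD hx) (torus_compact a) (fun x hx => qm_smooth a (rad_pos ha hx))

lemma Phi_boundary {a : ℝ} (f : ℂ → ℝ) {x : R3} (hx : x ∈ frontier (torus a)) : Phi a f x = 0 := by
  unfold Phi
  rw [GF_boundary f, mul_zero]
  have h := torus_front hx
  rw [← qm_norm] at h
  exact (pow_eq_one_iff_of_nonneg (norm_nonneg _) (by norm_num)).1 h

lemma rad_rot (β : ℝ) (x : R3) : rad (rotZ β x) = rad x := by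
  unfold rad
  congr 1
  show (Real.cos β * x 0 - Real.sin β * x 1) ^ 2 + (Real.sin β * x 0 + Real.cos β * x 1) ^ 2 = _
  have := Real.sin_sq_add_cos_sq β
  linear_combination (x 0 ^ 2 + x 1 ^ 2) * this

lemma Phi_sym (a : ℝ) (f : ℂ → ℝ) : torSym (Phi a f) := by
  intro β x
  unfold Phi qm
  rw [rad_rot]
  rfl

def pr (i : Fin 3) : R3 →L[ℝ] ℝ := ContinuousLinearMap.proj i

lemma hasFD_pr (i : Fin 3) (x : R3) : HasFDerivAt (fun y : R3 => y i) (pr i) x :=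
  (pr i).hasFDerivAt

lemma pr_single (i j : Fin 3) : pr i (Pi.single j (1 : ℝ) : R3) = if i = j then 1 else 0 := by
  show (Pi.single j (1 : ℝ) : R3) i = _
  rw [Pi.single_apply]

lemma rad_fd {x : R3} (hx : 0 < rad x) :
    HasFDerivAt rad ((x 0 / rad x) • pr 0 + (x 1 / rad x) • pr 1) x := by
  have h : x 0 ^ 2 + x 1 ^ 2 ≠ 0 := by rw [← rad_sq]; positivity
  have h1 := (((hasFD_pr 0 x).pow 2).add ((hasFD_pr 1 x).pow 2)).sqrt h
  refine h1.congr_fderiv ?_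
  ext v
  simp only [smul_apply, add_apply, smul_eq_mul]
  have : √(x 0 ^ 2 + x 1 ^ 2) = rad x := rfl
  simp [this]
  field_simp

lemma qm_fd (a : ℝ) {x : R3} (hx : 0 < rad x) : ∃ Q : R3 →L[ℝ] ℂ, HasFDerivAt (qm a) Q x ∧
    (∀ v, (Q v).re = x 0 / rad x * v 0 + x 1 / rad x * v 1) ∧ ∀ v, (Q v).im = v 2 := by
  refine ⟨Complex.ofRealCLM.comp ((x 0 / rad x) • pr 0 + (x 1 / rad x) • pr 1) +
    Complex.I • (Complex.ofRealCLM.comp (pr 2)), ?_, ?_, ?_⟩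
  · unfold qm
    apply HasFDerivAt.add
    · exact Complex.ofRealCLM.hasFDerivAt.comp x ((rad_fd hx).sub_const a)
    · exact (Complex.ofRealCLM.hasFDerivAt.comp x (hasFD_pr 2 x)).mul_const Complex.I
  · intro v
    simp [pr]
  · intro v
    simp [pr]

/-- Laplacian of a function of `(ρ, x₃)`. -/
lemma lap_cyl {a : ℝ} (ha : 1 < a) {G P Q : ℂ → ℝ}
    (hG : ∀ ζ ∈ UD, HasFDerivAt G (P ζ • Complex.reCLM + Q ζ • Complex.imCLM) ζ)
    {x : R3} (hx : x ∈ torus a) {p1 p2 q1 q2 : ℝ}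
    (hP : HasFDerivAt P (p1 • Complex.reCLM + p2 • Complex.imCLM) (qm a x))
    (hQ : HasFDerivAt Q (q1 • Complex.reCLM + q2 • Complex.imCLM) (qm a x)) :
    lap (fun y => G (qm a y)) x = p1 + P (qm a x) / rad x + q2 := by
  have hnb : torus a ∈ nhds x := (torus_open a).mem_nhds hx
  have hr : ∀ y ∈ torus a, 0 < rad y := fun y hy => rad_pos ha (subset_closure hy)
  have hpd : ∀ y ∈ torus a, ∀ i, pd (fun y => G (qm a y)) i y =
      P (qm a y) * (y 0 / rad y * (Pi.single i 1 : R3) 0 + y 1 / rad y * (Pi.single i 1 : R3) 1) +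
        Q (qm a y) * (Pi.single i 1 : R3) 2 := by
    intro y hy i
    obtain ⟨D, h1, h2, h3⟩ := qm_fd a (hr y hy)
    have := (hG _ (qm_UD hy)).comp y h1
    have e : fderiv ℝ (fun y => G (qm a y)) y = _ := this.fderiv
    unfold pd
    rw [e]
    simp [h2, h3]
  have e0 : pd (fun y => G (qm a y)) 0 =ᶠ[nhds x] fun y => P (qm a y) * (y 0 * (rad y)⁻¹) := by
    filter_upwards [hnb] with y hy
    rw [hpd y hy]; simp [div_eq_mul_inv]
  have e1 : pd (fun y => G (qm a y)) 1 =ᶠ[nhds x] fun y => P (qm a y) * (y 1 * (rad y)⁻¹) := by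
    filter_upwards [hnb] with y hy
    rw [hpd y hy]; simp [div_eq_mul_inv]
  have e2 : pd (fun y => G (qm a y)) 2 =ᶠ[nhds x] fun y => Q (qm a y) := by
    filter_upwards [hnb] with y hy
    rw [hpd y hy]; simp
  have hr0 := hr x hx
  obtain ⟨D, h1, h2, h3⟩ := qm_fd a hr0
  have cP := hP.comp x h1
  have cQ := hQ.comp x h1
  have ir := (hasDerivAt_inv hr0.ne').comp_hasFDerivAt x (rad_fd hr0)
  have f0 := cP.mul ((hasFD_pr 0 x).mul ir)
  have f1 := cP.mul ((hasFD_pr 1 x).mul ir)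
  unfold lap
  rw [Fin.sum_univ_three]
  have g0 : fderiv ℝ (pd (fun y => G (qm a y)) 0) x = _ := e0.fderiv_eq.trans f0.fderiv
  have g1 : fderiv ℝ (pd (fun y => G (qm a y)) 1) x = _ := e1.fderiv_eq.trans f1.fderiv
  have g2 : fderiv ℝ (pd (fun y => G (qm a y)) 2) x = _ := e2.fderiv_eq.trans cQ.fderiv
  have u0 : pd (pd (fun y => G (qm a y)) 0) 0 x = P (qm a x) * ((rad x)⁻¹ - x 0 ^ 2 * (rad x)⁻¹ ^ 3) +
      p1 * (x 0 * (rad x)⁻¹) ^ 2 := by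
    rw [pd, g0]
    simp [h2, h3, pr]
    field_simp
    ring
  have u1 : pd (pd (fun y => G (qm a y)) 1) 1 x = P (qm a x) * ((rad x)⁻¹ - x 1 ^ 2 * (rad x)⁻¹ ^ 3) +
      p1 * (x 1 * (rad x)⁻¹) ^ 2 := by
    rw [pd, g1]
    simp [h2, h3, pr]
    field_simp
    ring
  have u2 : pd (pd (fun y => G (qm a y)) 2) 2 x = q2 := by
    rw [pd, g2]
    simp [h2, h3]
  rw [u0, u1, u2]
  have hs := rad_sq x
  field_simp
  linear_combination (P (qm a x) - p1 * rad x) * hs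

lemma msq_fd {a : ℝ} {z : ℂ} (hz : 0 < a + z.re) : HasFDerivAt (fun z : ℂ => (√(a + z.re))⁻¹)
    ((- (√(a + z.re))⁻¹ / (2 * (a + z.re))) • Complex.reCLM) z := by
  have h0 : HasFDerivAt (fun z : ℂ => a + z.re) Complex.reCLM z := Complex.reCLM.hasFDerivAt.const_add a
  have h1 := (hasDerivAt_inv (Real.sqrt_pos.2 hz).ne').comp_hasFDerivAt z (h0.sqrt hz.ne')
  refine h1.congr_fderiv ?_
  ext v
  simp
  have hs := Real.sq_sqrt hz.le
  have hp := Real.sqrt_pos.2 hz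
  rw [hs]
  field_simp

lemma Phi_lap {a : ℝ} (ha : 1 < a) {f : ℂ → ℝ} (hf : Continuous f) {M L : ℝ} (hM : ∀ w, |f w| ≤ M)
    (hL : ∀ z ∈ CD, ∀ w ∈ CD, |f w - f z| ≤ L * ‖z - w‖) {x : R3} (hx : x ∈ torus a) :
    lap (Phi a f) x = (√(rad x))⁻¹ * (- f (qm a x) + GF f (qm a x) / (4 * rad x ^ 2)) := by
  have sub : UD ⊆ CD := Metric.ball_subset_closedBall
  have nb : ∀ z ∈ UD, CD ∈ nhds z := fun z hz =>
    mem_of_superset (Metric.isOpen_ball.mem_nhds hz) sub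
  have hp : ∀ z ∈ UD, 0 < a + z.re := fun z hz => re_pos ha (sub hz)
  have dGF : ∀ z ∈ UD, HasFDerivAt (GF f) (dG (DF f z)) z := fun z hz =>
    (GF_fd hf hM (sub hz)).hasFDerivAt (nb z hz)
  have dDF : ∀ z ∈ UD, HasFDerivAt (DF f) (dD (LF f z) (f z)) z := fun z hz =>
    (DF_fd hf hM hL (sub hz)).hasFDerivAt (nb z hz)
  have dinv : ∀ z ∈ UD, HasFDerivAt (fun z : ℂ => (2 * (a + z.re))⁻¹)
      ((- (2 * (a + z.re) ^ 2)⁻¹) • Complex.reCLM) z := by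
    intro z hz
    have hz0 := hp z hz
    have h0 : HasFDerivAt (fun z : ℂ => 2 * (a + z.re)) ((2 : ℝ) • Complex.reCLM) z :=
      (Complex.reCLM.hasFDerivAt.const_add a).const_mul 2
    have h1 := (hasDerivAt_inv (show 2 * (a + z.re) ≠ 0 by positivity)).comp_hasFDerivAt z h0
    refine h1.congr_fderiv ?_
    ext v <;> simp
    field_simp
  let P : ℂ → ℝ := fun z => (√(a + z.re))⁻¹ * ((DF f z).re - GF f z * (2 * (a + z.re))⁻¹)
  let Q : ℂ → ℝ := fun z => (√(a + z.re))⁻¹ * (- (DF f z).im)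
  have hG : ∀ ζ ∈ UD, HasFDerivAt (GG a f) (P ζ • Complex.reCLM + Q ζ • Complex.imCLM) ζ := by
    intro z hz
    refine ((msq_fd (hp z hz)).mul (dGF z hz)).congr_fderiv ?_
    have := hp z hz
    ext v
    simp [P, Q, dG]
    field_simp
    ring
  set z0 := qm a x with hz0
  have hzU : z0 ∈ UD := qm_UD hx
  have hre : a + z0.re = rad x := by rw [hz0, qm_re]; ring
  have r0 := hp z0 hzU
  have dRe := Complex.reCLM.hasFDerivAt.comp z0 (dDF z0 hzU)
  have dIm := Complex.imCLM.hasFDerivAt.comp z0 (dDF z0 hzU)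
  have HP := (msq_fd r0).mul (dRe.sub ((dGF z0 hzU).mul (dinv z0 hzU)))
  have HQ := (msq_fd r0).mul dIm.neg
  have split : ∀ T : ℂ →L[ℝ] ℝ, T = T 1 • Complex.reCLM + T Complex.I • Complex.imCLM := by
    intro T
    ext v
    have : v = v.re • (1 : ℂ) + v.im • Complex.I := by simp [Complex.re_add_im]
    conv_lhs => rw [this, map_add, map_smul, map_smul]
    simp [mul_comm]
  have HP' : HasFDerivAt P _ z0 := HP
  have HQ' : HasFDerivAt Q _ z0 := HQ
  replace HP' := HP'.congr_fderiv (split _)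
  replace HQ' := HQ'.congr_fderiv (split _)
  rw [Phi_eq]
  rw [lap_cyl ha hG hx HP' HQ', ← hz0, ← hre]
  simp [P, dG, dD]
  field_simp
  ring

lemma vel_rot {γ C : ℝ} (hγ : 3 < γ) {μ : ℝ × ℝ → ℝ} (h : Pro γ C μ) (j : ℕ) {x : R3} (hx : 0 < rad x)
    {φ : ℝ} (hφ : |φ| ≤ 1) (A : ℝ) :
    Integrable (fun v : R3 => (dot v (ephi x) / vb v) ^ j * μ (vb v + φ, rad x * (dot v (ephi x) + A))) ∧
    ∫ v : R3, (dot v (ephi x) / vb v) ^ j * μ (vb v + φ, rad x * (dot v (ephi x) + A)) =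
      MJ j μ (rad x) φ (rad x * A) := by
  set F : R3 → ℝ := fun v => (dot v (ephi x) / vb v) ^ j * μ (vb v + φ, rad x * (dot v (ephi x) + A)) with hF
  have hc : Continuous F := by
    have h1 := vb_cont
    have h2 : Continuous fun v : R3 => dot v (ephi x) := by unfold dot; fun_prop
    have h3 := h.1.continuous
    have h4 : Continuous fun v : R3 => dot v (ephi x) / vb v :=
      h2.div h1 (fun v => by have := vb_ge v; linarith)
    apply (h4.pow j).mul
    exact h3.comp (by fun_prop)
  let c : ℝ := -(x 1) / rad x
  let s : ℝ := x 0 / rad x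
  have hcs : c * c + s * s = 1 := by
    simp only [c, s]
    have := rad_sq x
    field_simp
    rw [this]; ring
  let M : Matrix (Fin 3) (Fin 3) ℝ := !![c, -s, 0; s, c, 0; 0, 0, 1]
  have hdet : M.det = 1 := by
    simp only [M]
    rw [Matrix.det_fin_three]
    simp
    linarith
  have hmap := Real.map_matrix_volume_pi_eq_smul_volume_pi (M := M) (by rw [hdet]; norm_num)
  rw [hdet, inv_one, abs_one, ENNReal.ofReal_one, one_smul] at hmap
  have hMc : Continuous (Matrix.toLin' M) := (Matrix.toLin' M).continuous_of_finiteDimensional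
  have hm0 : ∀ v : R3, Matrix.toLin' M v 0 = c * v 0 - s * v 1 := by
    intro v; simp [M, Matrix.mulVec, dotProduct, Fin.sum_univ_three]; ring
  have hm1 : ∀ v : R3, Matrix.toLin' M v 1 = s * v 0 + c * v 1 := by
    intro v; simp [M, Matrix.mulVec, dotProduct, Fin.sum_univ_three]
  have hm2 : ∀ v : R3, Matrix.toLin' M v 2 = v 2 := by
    intro v; simp [M, Matrix.mulVec, dotProduct, Fin.sum_univ_three]
  have hvb : ∀ v : R3, vb (Matrix.toLin' M v) = vb v := by
    intro v
    unfold vb nsq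
    rw [Fin.sum_univ_three, Fin.sum_univ_three, hm0, hm1, hm2]
    congr 1
    linear_combination (v 0 ^ 2 + v 1 ^ 2) * hcs
  have hdot : ∀ v : R3, dot (Matrix.toLin' M v) (ephi x) = v 0 := by
    intro v
    unfold dot
    rw [Fin.sum_univ_three, hm0, hm1, hm2]
    have e0 : ephi x 0 = c := rfl
    have e1 : ephi x 1 = s := rfl
    have e2 : ephi x 2 = 0 := rfl
    rw [e0, e1, e2]
    linear_combination v 0 * hcs
  have hcomp : F ∘ (Matrix.toLin' M) = fun v : R3 => (v 0 / vb v) ^ j * μ (vb v + φ, rad x * v 0 + rad x * A) := by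
    funext v
    simp only [hF, Function.comp, hvb, hdot, mul_add]
  have hi := MJ_int hγ h j (rad x) (rad x * A) hφ
  have hsm : AEStronglyMeasurable F (Measure.map (Matrix.toLin' M) volume) := hc.aestronglyMeasurable
  constructor
  · have := (integrable_map_measure hsm hMc.aemeasurable).2 (by rw [hcomp]; exact hi)
    rwa [hmap] at this
  · have := integral_map (f := F) hMc.aemeasurable hsm
    rw [hmap] at this
    rw [this]
    have e : ∀ v, F (Matrix.toLin' M v) = _ := fun v => congrFun hcomp v
    simp only [e]
    rfl

lemma hol_mono {X Y : Type*} [PseudoEMetricSpace X] [PseudoEMetricSpace Y] {C D r : ℝ≥0} {f : X → Y} {s : Set X}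
    (h : HolderOnWith C r f s) (hCD : C ≤ D) : HolderOnWith D r f s := by
  intro x hx y hy
  refine (h x hx y hy).trans ?_
  gcongr

end Aux

/-- Lemma C.2, existence of equilibria. For `a > 1` and `γ > 3` there
is `ε₀ > 0`, depending only on `a` and `γ`, such that for all nonnegative `C¹` profiles
`μ±` with decay constant `C_μ < ε₀` there exist toroidally symmetric potentials
`φ⁰, A_φ⁰ ∈ C^{2,α}(Ω̄)` (for every `α ∈ (0,1)`), vanishing on `∂Ω`, solving the
equilibrium Maxwell equations classically on `Ω`. -/
theorem stmt15 (a : ℝ) (ha : 1 < a) (γ : ℝ) (hγ : 3 < γ) :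
    ∃ ε0 : ℝ, 0 < ε0 ∧
      ∀ μ : Bool → ℝ × ℝ → ℝ,
        (∀ b, ContDiff ℝ 1 (μ b)) → (∀ b q, 0 ≤ μ b q) →
        ∀ Cμ : ℝ,
          (∀ b, ∀ e p : ℝ,
            |μ b (e, p)| + |d1 (μ b) (e, p)| + |d2 (μ b) (e, p)| ≤ Cμ / (1 + |e| ^ γ)) →
          Cμ < ε0 →
          ∃ φ0 Aφ0 : R3 → ℝ,
            torSym φ0 ∧ torSym Aφ0 ∧
            ContDiffOn ℝ 2 φ0 (closure (torus a)) ∧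
            ContDiffOn ℝ 2 Aφ0 (closure (torus a)) ∧
            (∀ α : ℝ, 0 < α → α < 1 → ∃ Cα : ℝ≥0,
              HolderOnWith Cα α.toNNReal
                (iteratedFDerivWithin ℝ 2 φ0 (closure (torus a))) (closure (torus a)) ∧
              HolderOnWith Cα α.toNNReal
                (iteratedFDerivWithin ℝ 2 Aφ0 (closure (torus a))) (closure (torus a))) ∧
            (∀ x ∈ frontier (torus a), φ0 x = 0) ∧
            (∀ x ∈ frontier (torus a), Aφ0 x = 0) ∧
            (∀ x ∈ torus a,
              -(lap φ0 x) = ∫ v : R3, (μ true (epm 1 φ0 x v, ppm 1 Aφ0 x v)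
                - μ false (epm (-1) φ0 x v, ppm (-1) Aφ0 x v))) ∧
            (∀ x ∈ torus a,
              -(lap Aφ0 x) + Aφ0 x / (rad x) ^ 2 =
                ∫ v : R3, (dot v (ephi x) / vb v)
                  * (μ true (epm 1 φ0 x v, ppm 1 Aφ0 x v)
                    - μ false (epm (-1) φ0 x v, ppm (-1) Aφ0 x v))) := by
  obtain ⟨ε0, hε, H⟩ := disk_solution ha hγ
  refine ⟨ε0, hε, ?_⟩
  intro μ hμ _ C hC hlt
  have hPro : ∀ b, Pro γ C (μ b) := fun b => ⟨hμ b, hC b⟩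
  obtain ⟨h, g, lh, lg, hb, eh, eg⟩ := H μ C hPro hlt
  obtain ⟨L1, hL1⟩ := xt_lip lh
  obtain ⟨L2, hL2⟩ := xt_lip lg
  have c1 := Phi_C2A ha (xt_cont h) (xt_bound h) hL1
  have c2 := Phi_C2A ha (xt_cont g) (xt_bound g) hL2
  obtain ⟨d1', k1⟩ := c1.final (torus_ud ha)
  obtain ⟨d2', k2⟩ := c2.final (torus_ud ha)
  -- the moments at a point
  have mom : ∀ (j : ℕ) (x : R3) (hx : x ∈ torus a),
      ∫ v : R3, (dot v (ephi x) / vb v) ^ j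
          * (μ true (epm 1 (Phi a (xt h)) x v, ppm 1 (Phi a (xt g)) x v)
            - μ false (epm (-1) (Phi a (xt h)) x v, ppm (-1) (Phi a (xt g)) x v)) =
        (√(rad x))⁻¹ * FJ a j μ (fun z => (√(rr a z))⁻¹ * Gop h z) (fun z => √(rr a z) * Gop g z)
          ⟨qm a x, qm_CD (subset_closure hx)⟩ := by
    intro j x hx
    have hr : 0 < rad x := rad_pos ha (subset_closure hx)
    set z : CD := ⟨qm a x, qm_CD (subset_closure hx)⟩ with hz
    have hrr : rr a z = rad x := by simp only [rr, hz, qm_re]; ring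
    have eP : Phi a (xt h) x = (√(rr a z))⁻¹ * Gop h z := by rw [hrr]; rfl
    have hφ : |Phi a (xt h) x| ≤ 1 := by rw [eP]; exact hb z
    have eA : rad x * Phi a (xt g) x = √(rr a z) * Gop g z := by
      rw [hrr]
      show rad x * ((√(rad x))⁻¹ * GF (xt g) (qm a x)) = √(rad x) * GF (xt g) (qm a x)
      have := Real.sqrt_pos.2 hr
      have h2 := Real.sq_sqrt hr.le
      field_simp
      rw [h2]
    obtain ⟨i1, m1⟩ := vel_rot hγ (hPro true) j hr hφ (Phi a (xt g) x)
    obtain ⟨i2, m2⟩ := vel_rot hγ (hPro false) j hr (φ := - Phi a (xt h) x) (by rwa [abs_neg])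
      (- Phi a (xt g) x)
    have e : ∀ v : R3, (dot v (ephi x) / vb v) ^ j
          * (μ true (epm 1 (Phi a (xt h)) x v, ppm 1 (Phi a (xt g)) x v)
            - μ false (epm (-1) (Phi a (xt h)) x v, ppm (-1) (Phi a (xt g)) x v)) =
        (dot v (ephi x) / vb v) ^ j * μ true (vb v + Phi a (xt h) x,
            rad x * (dot v (ephi x) + Phi a (xt g) x)) -
        (dot v (ephi x) / vb v) ^ j * μ false (vb v + - Phi a (xt h) x,
            rad x * (dot v (ephi x) + - Phi a (xt g) x)) := by
      intro v
      simp only [epm, ppm, one_mul, neg_mul]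
      ring
    simp only [e]
    rw [integral_sub i1 i2, m1, m2, FJ, hrr]
    have hp := Real.sqrt_pos.2 hr
    rw [← mul_assoc, inv_mul_cancel₀ hp.ne', one_mul, mul_neg, eA, eP]
    simp only [hrr]
  refine ⟨Phi a (xt h), Phi a (xt g), Phi_sym _ _, Phi_sym _ _, d1', d2', ?_,
    fun x hx => Phi_boundary _ hx, fun x hx => Phi_boundary _ hx, ?_, ?_⟩
  · intro α h0 h1
    obtain ⟨C1, q1⟩ := k1 α h0 h1
    obtain ⟨C2, q2⟩ := k2 α h0 h1
    exact ⟨max C1 C2, hol_mono q1 (le_max_left _ _), hol_mono q2 (le_max_right _ _)⟩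
  · intro x hx
    have hr : 0 < rad x := rad_pos ha (subset_closure hx)
    have m := mom 0 x hx
    simp only [pow_zero, one_mul] at m
    rw [m, Phi_lap ha (xt_cont h) (xt_bound h) hL1 hx]
    set z : CD := ⟨qm a x, qm_CD (subset_closure hx)⟩ with hz
    have hrr : rr a z = rad x := by simp only [rr, hz, qm_re]; ring
    have e1 : xt h (qm a x) = h z := xt_eq h z
    have e2 : GF (xt h) (qm a x) = Gop h z := rfl
    have := eh z
    rw [hrr] at this
    rw [e1, e2]
    rw [← sub_eq_iff_eq_add'.2 this]
    field_simp
    ring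
  · intro x hx
    have hr : 0 < rad x := rad_pos ha (subset_closure hx)
    have m := mom 1 x hx
    simp only [pow_one] at m
    rw [m, Phi_lap ha (xt_cont g) (xt_bound g) hL2 hx]
    set z : CD := ⟨qm a x, qm_CD (subset_closure hx)⟩ with hz
    have hrr : rr a z = rad x := by simp only [rr, hz, qm_re]; ring
    have e1 : xt g (qm a x) = g z := xt_eq g z
    have e2 : GF (xt g) (qm a x) = Gop g z := rfl
    have := eg z
    rw [hrr] at this
    have e3 : Phi a (xt g) x = (√(rad x))⁻¹ * Gop g z := rfl
    rw [e3, e1, e2]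
    rw [← sub_eq_iff_eq_add'.2 this]
    field_simp
    ring

end
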